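/- Let E ⊆ ℝ^{n+1} be an n-dimensional Ahlfors–David regular set, equipped with a dyadic system 𝔻(E). Then E is uniformly rectifiable if and only if E satisfies the BAUP condition (bilateral approximation by unions of planes). -/

import Mathlib

open MeasureTheory Metric Set
open scoped ENNReal NNReal InnerProductSpace

noncomputable section

abbrev ES (n : ℕ) : Type := EuclideanSpace ℝ (Fin (n + 1))

/-- The surface measure `σ = H^n|_E`. -/
def surfMeasure (n : ℕ) (E : Set (ES n)) : Measure (ES n) :=
  (μH[(n : ℝ)]).restrict E

/-- `E ⊆ ℝ^{n+1}` is `n`-dimensional Ahlfors–David regular with constant `C`. -/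
def IsADR (n : ℕ) (C : ℝ) (E : Set (ES n)) : Prop :=
  IsClosed E ∧ 1 ≤ C ∧
    ∀ x ∈ E, ∀ r : ℝ, 0 < r → ENNReal.ofReal r < EMetric.diam E →
      ENNReal.ofReal (C⁻¹ * r ^ n) ≤ μH[(n : ℝ)] (E ∩ ball x r) ∧
      μH[(n : ℝ)] (E ∩ ball x r) ≤ ENNReal.ofReal (C * r ^ n)

/-- A Christ–David–Semmes dyadic system on `E`. -/
structure DyadicSystem (n : ℕ) (E : Set (ES n)) where
  cubes : ℤ → Set (Set (ES n))
  center : Set (ES n) → ES n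
  a₀ : ℝ
  γ : ℝ
  Cstar : ℝ
  a₀_pos : 0 < a₀
  γ_pos : 0 < γ
  Cstar_pos : 0 < Cstar
  borel : ∀ k : ℤ, ∀ Q ∈ cubes k, MeasurableSet Q
  cover : ∀ k : ℤ, ⋃₀ cubes k = E
  nested : ∀ k m : ℤ, k ≤ m → ∀ Q ∈ cubes m, ∀ Q' ∈ cubes k, Q ⊆ Q' ∨ Q ∩ Q' = ∅
  parent : ∀ k : ℤ, ∀ Q ∈ cubes k, ∀ m : ℤ, m < k → ∃! Q', Q' ∈ cubes m ∧ Q ⊆ Q'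
  diam_le : ∀ k : ℤ, ∀ Q ∈ cubes k, EMetric.diam Q ≤ ENNReal.ofReal (Cstar * 2 ^ (-k))
  center_mem : ∀ k : ℤ, ∀ Q ∈ cubes k, center Q ∈ Q
  contains_ball : ∀ k : ℤ, ∀ Q ∈ cubes k, E ∩ ball (center Q) (a₀ * 2 ^ (-k)) ⊆ Q
  small_boundary : ∀ k : ℤ, ∀ Q ∈ cubes k, ∀ ϱ : ℝ, 0 < ϱ → ϱ < a₀ →
    μH[(n : ℝ)] {x ∈ Q | Metric.infDist x (E \ Q) ≤ ϱ * 2 ^ (-k)} ≤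
      ENNReal.ofReal (Cstar * ϱ ^ γ) * μH[(n : ℝ)] Q

/-- Uniform rectifiability: big pieces of Lipschitz images. -/
def IsUR (n : ℕ) (θ M₀ : ℝ) (E : Set (ES n)) : Prop :=
  0 < θ ∧ 0 < M₀ ∧
    ∀ x ∈ E, ∀ r : ℝ, 0 < r → ENNReal.ofReal r < EMetric.diam E →
      ∃ ρ : EuclideanSpace ℝ (Fin n) → ES n,
        LipschitzWith M₀.toNNReal ρ ∧
        ENNReal.ofReal (θ * r ^ n) ≤ μH[(n : ℝ)] (E ∩ ball x r ∩ ρ '' ball 0 r)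

/-- `P` is an affine hyperplane of `ℝ^{n+1}`. -/
def IsHyperplane {n : ℕ} (P : Set (ES n)) : Prop :=
  ∃ (ν : ES n) (c : ℝ), ‖ν‖ = 1 ∧ P = {Z | ⟪ν, Z⟫_ℝ = c}

/-- `H` is an open half-space with boundary hyperplane `P`. -/
def IsHalfSpacePair {n : ℕ} (H P : Set (ES n)) : Prop :=
  ∃ (ν : ES n) (c : ℝ), ‖ν‖ = 1 ∧ H = {Z | c < ⟪ν, Z⟫_ℝ} ∧ P = {Z | ⟪ν, Z⟫_ℝ = c}

/-- The `ε`-local BAUP condition for a cube `Q` of generation `k`. -/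
def LocalBAUP {n : ℕ} (E : Set (ES n)) (D : DyadicSystem n E) (ε : ℝ) (k : ℤ)
    (Q : Set (ES n)) : Prop :=
  ∃ Ps : Set (Set (ES n)), Ps.Nonempty ∧ (∀ P ∈ Ps, IsHyperplane P) ∧
    (∀ y ∈ E ∩ ball (D.center Q) (10 * Metric.diam Q),
      Metric.infDist y (⋃₀ Ps) ≤ ε * 2 ^ (-k)) ∧
    (∀ z ∈ (⋃₀ Ps) ∩ ball (D.center Q) (10 * Metric.diam Q),
      Metric.infDist z E ≤ ε * 2 ^ (-k))

/-- The `ε`-local WHSA condition with parameter `K₀` for a cube `Q` of generation `k`. -/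
def LocalWHSA {n : ℕ} (E : Set (ES n)) (D : DyadicSystem n E) (K₀ ε : ℝ) (k : ℤ)
    (Q : Set (ES n)) : Prop :=
  ∃ Hs P : Set (ES n), IsHalfSpacePair Hs P ∧
    (∀ Z ∈ P ∩ ball (D.center Q) (ε ^ (-2 : ℤ) * 2 ^ (-k)),
      Metric.infDist Z E ≤ ε * 2 ^ (-k)) ∧
    (∃ z ∈ closure Q, Metric.infDist z P ≤ K₀ ^ ((3 : ℝ) / 2) * 2 ^ (-k)) ∧
    Hs ∩ ball (D.center Q) (ε ^ (-2 : ℤ) * 2 ^ (-k)) ∩ E = ∅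

/-- The family of (generations of) cubes `B` satisfies a Carleson packing condition with
constant `C`. -/
def PackedBy {n : ℕ} (E : Set (ES n)) (D : DyadicSystem n E)
    (B : ℤ → Set (ES n) → Prop) (C : ℝ) : Prop :=
  ∀ k₀ : ℤ, ∀ Q₀ ∈ D.cubes k₀,
    ∑' p : {p : ℤ × Set (ES n) // p.2 ∈ D.cubes p.1 ∧ B p.1 p.2 ∧ p.2 ⊆ Q₀},
      μH[(n : ℝ)] p.1.2 ≤ ENNReal.ofReal C * μH[(n : ℝ)] Q₀

/-- Harmonic: `C²` with vanishing Laplacian. -/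
def HarmonicOn {n : ℕ} (u : ES n → ℝ) (U : Set (ES n)) : Prop :=
  ContDiffOn ℝ 2 u U ∧ ∀ x ∈ U,
    ∑ i : Fin (n + 1),
      fderiv ℝ (fun y => fderiv ℝ u y (EuclideanSpace.single i 1)) x
        (EuclideanSpace.single i 1) = 0

/-! ### Dyadic scales -/

/-- The side length `2 ^ (-j)` of generation `j`. -/
def scale (j : ℤ) : ℝ := (2 : ℝ) ^ (-j)

lemma scale_pos (j : ℤ) : 0 < scale j := by unfold scale; positivity

lemma scale_add_nat (j : ℤ) (i : ℕ) : scale (j + i) = scale j / 2 ^ i := by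
  unfold scale
  rw [neg_add, zpow_add₀ (by norm_num), zpow_neg _ (i : ℤ), zpow_natCast]
  rfl

lemma scale_succ (j : ℤ) : scale (j + 1) = scale j / 2 := by
  simpa using scale_add_nat j 1

lemma scale_anti {i j : ℤ} (h : i ≤ j) : scale j ≤ scale i := by
  unfold scale
  exact zpow_le_zpow_right₀ (by norm_num) (by omega)

lemma scale_half_of_lt {i j : ℤ} (h : i < j) : 2 * scale j ≤ scale i := by
  have := scale_anti (show i + 1 ≤ j from h)
  rw [scale_succ] at this
  linarith

lemma exists_scale_le {r : ℝ} (hr : 0 < r) : ∃ j : ℤ, scale j ≤ r ∧ r < 2 * scale j := by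
  obtain ⟨j, hj₁, hj₂⟩ := exists_mem_Ico_zpow hr (by norm_num : (1 : ℝ) < 2)
  refine ⟨-j, by simpa [scale] using hj₁, ?_⟩
  rw [zpow_add₀ (by norm_num)] at hj₂
  simp only [scale, neg_neg]
  linarith

/-! ### Separated sets and regular measures -/

/-- Distinct points of `s` are at distance at least `t`. -/
def SepBy {X : Type*} [PseudoMetricSpace X] (t : ℝ) (s : Finset X) : Prop :=
  ∀ x ∈ s, ∀ y ∈ s, x ≠ y → t ≤ dist x y

lemma exists_maximal_card {α : Type*} (p : Finset α → Prop) (N : ℕ) (h0 : p ∅)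
    (h : ∀ s, p s → s.card ≤ N) : ∃ s, p s ∧ ∀ s', p s' → s'.card ≤ s.card := by
  classical
  let q : ℕ → Prop := fun k => ∃ s, p s ∧ s.card = k
  have hq0 : q 0 := ⟨∅, h0, rfl⟩
  obtain ⟨s, hs, hk⟩ : q (Nat.findGreatest q N) := Nat.findGreatest_spec (Nat.zero_le _) hq0
  refine ⟨s, hs, fun s' hs' => ?_⟩
  rw [hk]
  exact Nat.le_findGreatest (h s' hs') ⟨s', hs', rfl⟩

lemma exists_net {X : Type*} [MetricSpace X] {A : Set X} (hA : TotallyBounded A) {t : ℝ}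
    (ht : 0 < t) : ∃ s : Finset X, ↑s ⊆ A ∧ SepBy t s ∧ ∀ a ∈ A, ∃ y ∈ s, dist a y < t := by
  classical
  obtain ⟨F, hF, hAF⟩ := Metric.totallyBounded_iff.1 hA (t / 2) (by positivity)
  have hcard : ∀ s : Finset X, (↑s ⊆ A ∧ SepBy t s) → s.card ≤ hF.toFinset.card := by
    rintro s ⟨hsA, hs⟩
    have : ∀ x ∈ s, ∃ y ∈ hF.toFinset, dist x y < t / 2 := by
      intro x hx
      obtain ⟨y, hy, hxy⟩ := mem_iUnion₂.1 (hAF (hsA hx))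
      exact ⟨y, hF.mem_toFinset.2 hy, hxy⟩
    choose! f hf hd using this
    refine Finset.card_le_card_of_injOn f (fun x hx => hf x hx) ?_
    intro x hx y hy hxy
    by_contra hne
    have h1 := hs x hx y hy hne
    have h2 := hd x hx
    have h3 := hd y hy
    have := dist_triangle_right x y (f x)
    rw [← hxy] at h3
    linarith
  obtain ⟨s, ⟨hsA, hs⟩, hmax⟩ := exists_maximal_card (fun s : Finset X => ↑s ⊆ A ∧ SepBy t s)
    _ ⟨by simp, by simp [SepBy]⟩ hcard
  refine ⟨s, hsA, hs, fun a ha => ?_⟩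
  by_contra! hcon
  have has : a ∉ s := fun h => by have := hcon a h; simp at this; linarith
  have := hmax (insert a s) ⟨by simp [Set.insert_subset_iff, ha, hsA], ?_⟩
  · rw [Finset.card_insert_of_notMem has] at this
    omega
  · intro x hx y hy hxy
    rcases Finset.mem_insert.1 hx with rfl | hx' <;> rcases Finset.mem_insert.1 hy with rfl | hy'
    · exact absurd rfl hxy
    · exact hcon _ hy'
    · rw [dist_comm]; exact hcon _ hx'
    · exact hs _ hx' _ hy' hxy

lemma exists_net_of_bounded {X : Type*} [MetricSpace X] [ProperSpace X] {A : Set X}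
    (hA : Bornology.IsBounded A) {t : ℝ} (ht : 0 < t) :
    ∃ s : Finset X, ↑s ⊆ A ∧ SepBy t s ∧ ∀ a ∈ A, ∃ y ∈ s, dist a y < t :=
  exists_net (hA.isCompact_closure.totallyBounded.subset subset_closure) ht

/-- `μ` is concentrated on `S` and `n`-regular there, at all scales. -/
structure RegularOn {X : Type*} [MetricSpace X] [MeasurableSpace X] (μ : Measure X)
    (S : Set X) (n : ℕ) (Λ : ℝ) : Prop where
  one_le : 1 ≤ Λ
  null : μ Sᶜ = 0
  ne_top : ∀ x ∈ S, ∀ r : ℝ, 0 < r → μ (ball x r) ≠ ⊤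
  lower : ∀ x ∈ S, ∀ r : ℝ, 0 < r → Λ⁻¹ * r ^ n ≤ μ.real (ball x r)
  upper : ∀ x ∈ S, ∀ r : ℝ, 0 < r → μ.real (ball x r) ≤ Λ * r ^ n

namespace RegularOn

variable {X : Type*} [MetricSpace X] [MeasurableSpace X] {μ : Measure X}
  {S : Set X} {n : ℕ} {Λ : ℝ}

lemma pos (h : RegularOn μ S n Λ) : 0 < Λ := lt_of_lt_of_le one_pos h.one_le

lemma mono {Λ' : ℝ} (h : RegularOn μ S n Λ) (hΛ : Λ ≤ Λ') : RegularOn μ S n Λ' where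
  one_le := h.one_le.trans hΛ
  null := h.null
  ne_top := h.ne_top
  lower x hx r hr := le_trans (by have := h.pos; gcongr) (h.lower x hx r hr)
  upper x hx r hr := (h.upper x hx r hr).trans (by gcongr)

lemma measure_ball_ne_top (h : RegularOn μ S n Λ) (x : X) (r : ℝ) : μ (ball x r) ≠ ⊤ := by
  by_cases hx : (ball x r ∩ S).Nonempty
  · obtain ⟨y, hy, hyS⟩ := hx
    have hr : 0 < r := pos_of_mem_ball hy
    refine ne_top_of_le_ne_top (h.ne_top y hyS (r + r) (by linarith)) (measure_mono ?_)
    refine ball_subset_ball' ?_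
    rw [dist_comm]
    linarith [mem_ball.1 hy]
  · have : μ (ball x r) = 0 := by
      refine measure_mono_null ?_ h.null
      intro y hy hyS
      exact hx ⟨y, hy, hyS⟩
    simp [this]

lemma measure_ball_le (h : RegularOn μ S n Λ) (x : X) {r : ℝ} (hr : 0 < r) :
    μ.real (ball x r) ≤ Λ * (2 * r) ^ n := by
  have hΛ := h.pos
  by_cases hx : (ball x r ∩ S).Nonempty
  · obtain ⟨y, hy, hyS⟩ := hx
    refine le_trans (measureReal_mono ?_ (h.measure_ball_ne_top y (2 * r)))
      (h.upper y hyS (2 * r) (by linarith))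
    refine ball_subset_ball' ?_
    rw [dist_comm]
    linarith [mem_ball.1 hy]
  · have : μ (ball x r) = 0 := by
      refine measure_mono_null ?_ h.null
      intro y hy hyS
      exact hx ⟨y, hy, hyS⟩
    simp only [Measure.real, this, ENNReal.toReal_zero]
    positivity

lemma ne_top_of_bounded (h : RegularOn μ S n Λ) {A : Set X} (hA : Bornology.IsBounded A) :
    μ A ≠ ⊤ := by
  rcases A.eq_empty_or_nonempty with rfl | ⟨x, -⟩
  · simp
  · obtain ⟨r, hr⟩ := hA.subset_ball x
    exact ne_top_of_le_ne_top (h.measure_ball_ne_top x r) (measure_mono hr)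

lemma measure_closedBall_le (h : RegularOn μ S n Λ) (x : X) {r : ℝ} (hr : 0 < r) :
    μ.real (closedBall x r) ≤ Λ * (4 * r) ^ n := by
  refine (measureReal_mono (closedBall_subset_ball (show r < 2 * r by linarith))
    (h.measure_ball_ne_top _ _)).trans ((h.measure_ball_le x (by linarith)).trans_eq (by ring))

/-- The packing estimate for separated points of `S` whose half-radius balls lie in `A`. -/
lemma card_mul_le [OpensMeasurableSpace X] (h : RegularOn μ S n Λ) {s : Finset X} {A : Set X}
    {t : ℝ} (ht : 0 < t) (hsS : ↑s ⊆ S) (hs : SepBy t s) (hA : μ A ≠ ⊤)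
    (hsA : ∀ x ∈ s, ball x (t / 2) ⊆ A) :
    s.card * (Λ⁻¹ * (t / 2) ^ n) ≤ μ.real A := by
  have hdis : Set.PairwiseDisjoint (↑s) (fun x : X => ball x (t / 2)) := by
    intro x hx y hy hxy
    exact ball_disjoint_ball (by linarith [hs x hx y hy hxy])
  calc s.card * (Λ⁻¹ * (t / 2) ^ n) = ∑ x ∈ s, Λ⁻¹ * (t / 2) ^ n := by simp
    _ ≤ ∑ x ∈ s, μ.real (ball x (t / 2)) :=
        Finset.sum_le_sum fun x hx => h.lower x (hsS hx) _ (by positivity)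
    _ = μ.real (⋃ x ∈ s, ball x (t / 2)) :=
        (measureReal_biUnion_finset hdis (fun _ _ => measurableSet_ball)
          (fun x _ => h.measure_ball_ne_top x _)).symm
    _ ≤ μ.real A := measureReal_mono (iUnion₂_subset hsA) hA

lemma card_le_of_subset_ball [OpensMeasurableSpace X] (h : RegularOn μ S n Λ) {s : Finset X}
    {x : X} {t r : ℝ} (ht : 0 < t) (hr : 0 < r) (hsS : ↑s ⊆ S) (hs : SepBy t s)
    (hsA : ∀ y ∈ s, dist y x < r) :
    (s.card : ℝ) ≤ Λ ^ 2 * (4 * (r + t) / t) ^ n := by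
  have h1 := h.card_mul_le ht hsS hs (h.measure_ball_ne_top x (r + t)) (fun y hy =>
    ball_subset_ball' (by linarith [hsA y hy]))
  have h2 := h.measure_ball_le x (show 0 < r + t by linarith)
  have hΛ := h.pos
  have h3 : (s.card : ℝ) * (Λ⁻¹ * (t / 2) ^ n) ≤ Λ * (2 * (r + t)) ^ n := h1.trans h2
  have h4 : Λ ^ 2 * (4 * (r + t) / t) ^ n * (Λ⁻¹ * (t / 2) ^ n) = Λ * (2 * (r + t)) ^ n := by
    have : (4 * (r + t) / t) * (t / 2) = 2 * (r + t) := by field_simp; ring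
    rw [← this, mul_pow]
    field_simp
  rw [← h4] at h3
  exact le_of_mul_le_mul_right h3 (by positivity)

/-- The measure of a bounded set is controlled by the size of any of its nets. -/
lemma measure_le_of_net (h : RegularOn μ S n Λ) {s : Finset X} {A : Set X} {t : ℝ} (ht : 0 < t)
    (hs : ∀ a ∈ A, ∃ y ∈ s, dist a y < t) : μ.real A ≤ s.card * (Λ * (2 * t) ^ n) := by
  have hsub : A ⊆ ⋃ y ∈ s, ball y t := fun a ha => by
    obtain ⟨y, hy, hd⟩ := hs a ha
    exact mem_iUnion₂.2 ⟨y, hy, hd⟩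
  have hfin : μ (⋃ y ∈ s, ball y t) ≠ ⊤ :=
    ((measure_biUnion_lt_top s.finite_toSet
      (fun y _ => (h.measure_ball_ne_top y t).lt_top))).ne
  calc μ.real A ≤ μ.real (⋃ y ∈ s, ball y t) := measureReal_mono hsub hfin
    _ ≤ ∑ y ∈ s, μ.real (ball y t) := measureReal_biUnion_finset_le _ _
    _ ≤ ∑ y ∈ s, Λ * (2 * t) ^ n := Finset.sum_le_sum fun y _ => h.measure_ball_le y ht
    _ = s.card * (Λ * (2 * t) ^ n) := by simp

end RegularOn

lemma regularOn_volume (n : ℕ) : ∃ Λ : ℝ,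
    RegularOn (volume : Measure (EuclideanSpace ℝ (Fin n))) univ n Λ := by
  set v := (volume : Measure (EuclideanSpace ℝ (Fin n))).real (ball 0 1) with hv
  have hvpos : 0 < v := by
    refine ENNReal.toReal_pos (measure_ball_pos _ _ one_pos).ne' measure_ball_lt_top.ne
  have key : ∀ (x : EuclideanSpace ℝ (Fin n)) (r : ℝ), 0 < r →
      (volume : Measure (EuclideanSpace ℝ (Fin n))).real (ball x r) = r ^ n * v := by
    intro x r hr
    rw [Measure.real, Measure.addHaar_ball_of_pos _ _ hr, ENNReal.toReal_mul,
      ENNReal.toReal_ofReal (by positivity), finrank_euclideanSpace_fin]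
    rfl
  refine ⟨max 1 (max v v⁻¹), le_max_left _ _, by simp, fun _ _ _ _ => measure_ball_lt_top.ne, ?_, ?_⟩
  · intro x _ r hr
    rw [key x r hr, mul_comm]
    gcongr
    refine inv_le_of_inv_le₀ hvpos ?_
    exact (le_max_right _ _).trans (le_max_right _ _)
  · intro x _ r hr
    rw [key x r hr, mul_comm]
    gcongr
    exact (le_max_left _ _).trans (le_max_right _ _)

/-! ### Dyadic cubes -/

namespace DyadicSystem

variable {n : ℕ} {E : Set (ES n)} (D : DyadicSystem n E)

lemma subset_E {j : ℤ} {Q : Set (ES n)} (hQ : Q ∈ D.cubes j) : Q ⊆ E := by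
  rw [← D.cover j]
  exact subset_sUnion_of_mem hQ

lemma subset_of_mem {i j : ℤ} (hij : i ≤ j) {Q Q' : Set (ES n)} (hQ : Q ∈ D.cubes j)
    (hQ' : Q' ∈ D.cubes i) {x : ES n} (hx : x ∈ Q) (hx' : x ∈ Q') : Q ⊆ Q' := by
  rcases D.nested i j hij Q hQ Q' hQ' with h | h
  · exact h
  · exact absurd (show x ∈ Q ∩ Q' from ⟨hx, hx'⟩) (by simp [h])

lemma eq_of_mem {j : ℤ} {Q Q' : Set (ES n)} (hQ : Q ∈ D.cubes j)
    (hQ' : Q' ∈ D.cubes j) {x : ES n} (hx : x ∈ Q) (hx' : x ∈ Q') : Q = Q' :=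
  (D.subset_of_mem le_rfl hQ hQ' hx hx').antisymm (D.subset_of_mem le_rfl hQ' hQ hx' hx)

lemma exists_cube (j : ℤ) {x : ES n} (hx : x ∈ E) : ∃ Q, Q ∈ D.cubes j ∧ x ∈ Q := by
  rw [← D.cover j] at hx
  exact hx

open Classical in
/-- The cube of generation `j` containing `x`. -/
def cubeAt (j : ℤ) (x : ES n) : Set (ES n) :=
  if h : ∃ Q, Q ∈ D.cubes j ∧ x ∈ Q then h.choose else ∅

lemma cubeAt_mem (j : ℤ) {x : ES n} (hx : x ∈ E) : D.cubeAt j x ∈ D.cubes j := by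
  rw [cubeAt, dif_pos (D.exists_cube j hx)]
  exact (D.exists_cube j hx).choose_spec.1

lemma mem_cubeAt (j : ℤ) {x : ES n} (hx : x ∈ E) : x ∈ D.cubeAt j x := by
  rw [cubeAt, dif_pos (D.exists_cube j hx)]
  exact (D.exists_cube j hx).choose_spec.2

lemma cubeAt_eq {j : ℤ} {Q : Set (ES n)} (hQ : Q ∈ D.cubes j) {x : ES n} (hx : x ∈ Q) :
    D.cubeAt j x = Q :=
  D.eq_of_mem (D.cubeAt_mem j (D.subset_E hQ hx)) hQ (D.mem_cubeAt j (D.subset_E hQ hx)) hx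

open Classical in
/-- The cubes of generations `k, …, m` inside `T`, with their generations. -/
def pairs (k m : ℤ) (T : Set (ES n)) : Finset (ℤ × Set (ES n)) :=
  if h : {p : ℤ × Set (ES n) | (k ≤ p.1 ∧ p.1 ≤ m) ∧ p.2 ∈ D.cubes p.1 ∧ p.2 ⊆ T}.Finite then
    h.toFinset else ∅

end DyadicSystem

/-- Pairwise disjointness of a finite family of sets with multiplicities. -/
def DisjPairs {n : ℕ} (s : Finset (ℤ × Set (ES n))) : Prop :=
  ∀ p ∈ s, ∀ q ∈ s, ∀ x, x ∈ p.2 → x ∈ q.2 → p = q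

/-- A regular set of positive dimension with a dyadic system, all structural constants being
controlled by `Λ`. -/
structure Nice (n : ℕ) (E : Set (ES n)) (D : DyadicSystem n E) (Λ : ℝ) : Prop where
  n_pos : 1 ≤ n
  closed : IsClosed E
  reg : RegularOn (surfMeasure n E) E n Λ
  lower : ∀ j, ∀ Q ∈ D.cubes j, Λ⁻¹ * scale j ^ n ≤ (surfMeasure n E).real Q
  upper : ∀ j, ∀ Q ∈ D.cubes j, (surfMeasure n E).real Q ≤ Λ * scale j ^ n
  dist_le : ∀ j, ∀ Q ∈ D.cubes j, ∀ x ∈ Q, ∀ y ∈ Q, dist x y ≤ Λ * scale j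
  inner : ∀ j, ∀ Q ∈ D.cubes j, E ∩ ball (D.center Q) (Λ⁻¹ * scale j) ⊆ Q
  diam_lower : ∀ j, ∀ Q ∈ D.cubes j, Λ⁻¹ * scale j ≤ diam Q

namespace Nice

variable {n : ℕ} {E : Set (ES n)} {D : DyadicSystem n E} {Λ : ℝ}

lemma bounded (h : Nice n E D Λ) {j : ℤ} {Q : Set (ES n)} (hQ : Q ∈ D.cubes j) :
    Bornology.IsBounded Q :=
  Metric.isBounded_iff.2 ⟨_, fun x hx y hy => h.dist_le j Q hQ x hx y hy⟩

lemma diam_upper (h : Nice n E D Λ) {j : ℤ} {Q : Set (ES n)} (hQ : Q ∈ D.cubes j) :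
    diam Q ≤ Λ * scale j :=
  diam_le_of_forall_dist_le (by have := h.reg.pos; have := scale_pos j; positivity)
    (h.dist_le j Q hQ)

lemma ne_top (h : Nice n E D Λ) {j : ℤ} {Q : Set (ES n)} (hQ : Q ∈ D.cubes j) :
    surfMeasure n E Q ≠ ⊤ := h.reg.ne_top_of_bounded (h.bounded hQ)

lemma measure_pos (h : Nice n E D Λ) {j : ℤ} {Q : Set (ES n)} (hQ : Q ∈ D.cubes j) :
    0 < (surfMeasure n E).real Q := by
  have := h.reg.pos; have := scale_pos j
  exact lt_of_lt_of_le (by positivity) (h.lower j Q hQ)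

lemma sum_measure_eq (h : Nice n E D Λ) {s : Finset (ℤ × Set (ES n))}
    (hs : ∀ p ∈ s, p.2 ∈ D.cubes p.1) (hd : DisjPairs s) :
    ∑ p ∈ s, (surfMeasure n E).real p.2 = (surfMeasure n E).real (⋃ p ∈ s, p.2) := by
  refine (measureReal_biUnion_finset ?_ (fun p hp => D.borel _ _ (hs p hp))
    (fun p hp => h.ne_top (hs p hp))).symm
  intro p hp q hq hpq
  refine Set.disjoint_left.2 fun x hx hx' => hpq (hd p hp q hq x hx hx')

lemma sum_measure_le (h : Nice n E D Λ) {s : Finset (ℤ × Set (ES n))} {A : Set (ES n)}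
    (hs : ∀ p ∈ s, p.2 ∈ D.cubes p.1) (hd : DisjPairs s) (hA : ∀ p ∈ s, p.2 ⊆ A)
    (hfin : surfMeasure n E A ≠ ⊤) :
    ∑ p ∈ s, (surfMeasure n E).real p.2 ≤ (surfMeasure n E).real A := by
  rw [h.sum_measure_eq hs hd]
  exact measureReal_mono (iUnion₂_subset hA) hfin

lemma finite_cubes (h : Nice n E D Λ) (j : ℤ) {T : Set (ES n)} (hT : Bornology.IsBounded T) :
    {Q | Q ∈ D.cubes j ∧ Q ⊆ T}.Finite := by
  classical
  by_contra hinf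
  have hΛ := h.reg.pos
  have hj := scale_pos j
  have hpos : 0 < Λ⁻¹ * scale j ^ n := by positivity
  obtain ⟨N, hN⟩ := exists_nat_gt ((surfMeasure n E).real T / (Λ⁻¹ * scale j ^ n))
  obtain ⟨t, ht, hcard⟩ := Set.Infinite.exists_subset_card_eq hinf N
  have h1 := h.sum_measure_le (s := t.image fun Q => (j, Q)) (A := T) (by
    intro p hp
    obtain ⟨Q, hQ, rfl⟩ := Finset.mem_image.1 hp
    exact (ht hQ).1) (by
    intro p hp q hq x hx hx'
    obtain ⟨Q, hQ, rfl⟩ := Finset.mem_image.1 hp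
    obtain ⟨Q', hQ', rfl⟩ := Finset.mem_image.1 hq
    rw [D.eq_of_mem (ht hQ).1 (ht hQ').1 hx hx']) (by
    intro p hp
    obtain ⟨Q, hQ, rfl⟩ := Finset.mem_image.1 hp
    exact (ht hQ).2) (h.reg.ne_top_of_bounded hT)
  rw [Finset.sum_image (fun a _ b _ hab => (Prod.ext_iff.1 hab).2)] at h1
  have h2 : (t.card : ℝ) * (Λ⁻¹ * scale j ^ n) ≤ (surfMeasure n E).real T := by
    refine le_trans ?_ h1
    rw [← nsmul_eq_mul]
    exact Finset.card_nsmul_le_sum _ _ _ fun Q hQ => h.lower j Q (ht hQ).1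
  rw [div_lt_iff₀ hpos, ← hcard] at hN
  linarith

lemma finite_pairs (h : Nice n E D Λ) (k m : ℤ) {T : Set (ES n)} (hT : Bornology.IsBounded T) :
    {p : ℤ × Set (ES n) | (k ≤ p.1 ∧ p.1 ≤ m) ∧ p.2 ∈ D.cubes p.1 ∧ p.2 ⊆ T}.Finite := by
  refine ((Set.finite_Icc k m).biUnion (t := fun j => (fun Q => (j, Q)) ''
    {Q | Q ∈ D.cubes j ∧ Q ⊆ T}) (fun j _ => (h.finite_cubes j hT).image _)).subset ?_
  rintro ⟨j, Q⟩ ⟨hj, hQ⟩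
  exact mem_iUnion₂.2 ⟨j, hj, Q, hQ, rfl⟩

lemma mem_pairs (h : Nice n E D Λ) {k m : ℤ} {T : Set (ES n)} (hT : Bornology.IsBounded T)
    {p : ℤ × Set (ES n)} :
    p ∈ D.pairs k m T ↔ (k ≤ p.1 ∧ p.1 ≤ m) ∧ p.2 ∈ D.cubes p.1 ∧ p.2 ⊆ T := by
  classical
  rw [DyadicSystem.pairs, dif_pos (h.finite_pairs k m hT)]
  simp

end Nice

namespace DyadicSystem

variable {n : ℕ} {E : Set (ES n)} (D : DyadicSystem n E)

open Classical in
/-- The maximal cubes of generations `k + 1, …, m` in `T` that do not meet `F`. -/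
def maxCubes (k m : ℤ) (T F : Set (ES n)) : Finset (ℤ × Set (ES n)) :=
  {p ∈ D.pairs (k + 1) m T |
    p.2 ∩ F = ∅ ∧ ∀ Q ∈ D.cubes (p.1 - 1), p.2 ⊆ Q → (Q ∩ F).Nonempty}

end DyadicSystem

namespace Nice

variable {n : ℕ} {E : Set (ES n)} {D : DyadicSystem n E} {Λ : ℝ}

lemma mem_maxCubes (h : Nice n E D Λ) {k m : ℤ} {T F : Set (ES n)} (hT : T ∈ D.cubes k)
    {p : ℤ × Set (ES n)} :
    p ∈ D.maxCubes k m T F ↔ ((k + 1 ≤ p.1 ∧ p.1 ≤ m) ∧ p.2 ∈ D.cubes p.1 ∧ p.2 ⊆ T) ∧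
      p.2 ∩ F = ∅ ∧ ∀ Q ∈ D.cubes (p.1 - 1), p.2 ⊆ Q → (Q ∩ F).Nonempty := by
  classical
  rw [DyadicSystem.maxCubes, Finset.mem_filter, h.mem_pairs (h.bounded hT)]

lemma disjPairs_maxCubes (h : Nice n E D Λ) {k m : ℤ} {T F : Set (ES n)}
    (hT : T ∈ D.cubes k) : DisjPairs (D.maxCubes k m T F) := by
  have key : ∀ p ∈ D.maxCubes k m T F, ∀ q ∈ D.maxCubes k m T F, ∀ x, x ∈ p.2 → x ∈ q.2 →
      q.1 ≤ p.1 := by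
    intro p hp q hq x hx hx'
    rw [h.mem_maxCubes hT] at hp hq
    by_contra! hlt
    have hxE := D.subset_E hp.1.2.1 hx
    obtain ⟨y, hy, hyF⟩ := hq.2.2 (D.cubeAt (q.1 - 1) x) (D.cubeAt_mem _ hxE)
      (D.subset_of_mem (by omega) hq.1.2.1 (D.cubeAt_mem _ hxE) hx' (D.mem_cubeAt _ hxE))
    have : y ∈ p.2 := D.subset_of_mem (by omega) (D.cubeAt_mem _ hxE) hp.1.2.1
      (D.mem_cubeAt _ hxE) hx hy
    exact absurd (show y ∈ p.2 ∩ F from ⟨this, hyF⟩) (by simp [hp.2.1])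
  intro p hp q hq x hx hx'
  have h1 : p.1 = q.1 := le_antisymm (key q hq p hp x hx' hx) (key p hp q hq x hx hx')
  rw [h.mem_maxCubes hT] at hp hq
  refine Prod.ext h1 ?_
  have := hq.1.2.1
  rw [← h1] at this
  exact D.eq_of_mem hp.1.2.1 this hx hx'

lemma exists_maxCube (h : Nice n E D Λ) {k m : ℤ} {T F : Set (ES n)}
    (hT : T ∈ D.cubes k) (hF : (T ∩ F).Nonempty) {j : ℤ} (hkj : k ≤ j) (hjm : j ≤ m)
    {Q : Set (ES n)} (hQ : Q ∈ D.cubes j) (hQT : Q ⊆ T) (hQF : Q ∩ F = ∅) :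
    ∃ p ∈ D.maxCubes k m T F, Q ⊆ p.2 ∧ p.1 ≤ j := by
  obtain ⟨i, rfl⟩ : ∃ i : ℕ, j = k + i := ⟨(j - k).toNat, by omega⟩
  induction i generalizing Q with
  | zero =>
    have hQ' : Q ∈ D.cubes k := by simpa using hQ
    have : Q = T := D.eq_of_mem hQ' hT (D.center_mem _ _ hQ) (hQT (D.center_mem _ _ hQ))
    rw [this] at hQF
    simp [hQF] at hF
  | succ i ih =>
    have hxQ := D.center_mem _ _ hQ
    set x := D.center Q
    have hxE := D.subset_E hQ hxQ
    have hsub : Q ⊆ D.cubeAt (k + i) x :=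
      D.subset_of_mem (by push_cast; omega) hQ (D.cubeAt_mem _ hxE) hxQ (D.mem_cubeAt _ hxE)
    by_cases hmeet : (D.cubeAt (k + i) x ∩ F).Nonempty
    · refine ⟨(k + (i + 1 : ℕ), Q), (h.mem_maxCubes hT).2
        ⟨⟨⟨by push_cast; omega, hjm⟩, hQ, hQT⟩, hQF, ?_⟩, subset_rfl, le_rfl⟩
      intro Q' hQ' hQQ'
      have hQ'' : Q' ∈ D.cubes (k + i) := by
        have : (k + (i + 1 : ℕ) : ℤ) - 1 = k + i := by push_cast; ring
        rwa [this] at hQ'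
      rwa [← D.cubeAt_eq hQ'' (hQQ' hxQ)]
    · obtain ⟨p, hp, h1, h2⟩ := ih
        (D.subset_of_mem (by omega) (D.cubeAt_mem _ hxE) hT (D.mem_cubeAt _ hxE) (hQT hxQ))
        (Set.not_nonempty_iff_eq_empty.1 hmeet) (by omega) (by push_cast at hjm; omega)
        (D.cubeAt_mem (k + i) hxE)
      exact ⟨p, hp, hsub.trans h1, h2.trans (by push_cast; omega)⟩

end Nice

lemma nice_of_isADR {n : ℕ} {C : ℝ} {E : Set (ES n)} (hE : IsADR n C E) (D : DyadicSystem n E)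
    (hn : 1 ≤ n) (hdiam : ediam E = ⊤) : ∃ Λ, Nice n E D Λ := by
  obtain ⟨hclosed, hC1, hreg⟩ := hE
  have hC : 0 < C := by linarith
  have hreg' : ∀ x ∈ E, ∀ r : ℝ, 0 < r →
      ENNReal.ofReal (C⁻¹ * r ^ n) ≤ surfMeasure n E (ball x r) ∧
      surfMeasure n E (ball x r) ≤ ENNReal.ofReal (C * r ^ n) := by
    intro x hx r hr
    have := hreg x hx r hr (lt_of_lt_of_eq ENNReal.ofReal_lt_top hdiam.symm)
    rw [surfMeasure, Measure.restrict_apply measurableSet_ball, inter_comm]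
    exact this
  have hR : RegularOn (surfMeasure n E) E n C := by
    refine ⟨hC1, ?_, ?_, ?_, ?_⟩
    · rw [surfMeasure, Measure.restrict_apply hclosed.measurableSet.compl]
      simp
    · exact fun x hx r hr => ne_top_of_le_ne_top ENNReal.ofReal_ne_top (hreg' x hx r hr).2
    · intro x hx r hr
      have hfin := ne_top_of_le_ne_top ENNReal.ofReal_ne_top (hreg' x hx r hr).2
      exact (ENNReal.ofReal_le_iff_le_toReal hfin).1 (hreg' x hx r hr).1
    · intro x hx r hr
      exact ENNReal.toReal_le_of_le_ofReal (by positivity) (hreg' x hx r hr).2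
  have ha := D.a₀_pos
  have hCs := D.Cstar_pos
  have hdist : ∀ j, ∀ Q ∈ D.cubes j, ∀ x ∈ Q, ∀ y ∈ Q, dist x y ≤ D.Cstar * scale j := by
    intro j Q hQ x hx y hy
    have hj := scale_pos j
    have h1 := (edist_le_ediam_of_mem hx hy).trans (D.diam_le j Q hQ)
    rw [edist_dist] at h1
    exact (ENNReal.ofReal_le_ofReal_iff (by positivity)).1 h1
  have hbdd : ∀ j, ∀ Q ∈ D.cubes j, Bornology.IsBounded Q := fun j Q hQ =>
    Metric.isBounded_iff.2 ⟨_, fun x hx y hy => hdist j Q hQ x hx y hy⟩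
  have hlow : ∀ j, ∀ Q ∈ D.cubes j, C⁻¹ * D.a₀ ^ n * scale j ^ n ≤ (surfMeasure n E).real Q := by
    intro j Q hQ
    have hj := scale_pos j
    have hc := D.subset_E hQ (D.center_mem j Q hQ)
    have h1 := hR.lower _ hc (D.a₀ * scale j) (by positivity)
    have h2 : (surfMeasure n E) (ball (D.center Q) (D.a₀ * scale j)) ≤ surfMeasure n E Q := by
      rw [surfMeasure, Measure.restrict_apply measurableSet_ball,
        Measure.restrict_apply (D.borel j Q hQ)]
      refine measure_mono ?_
      rintro y ⟨hy, hyE⟩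
      exact ⟨D.contains_ball j Q hQ ⟨hyE, hy⟩, hyE⟩
    have h3 := ENNReal.toReal_mono (hR.ne_top_of_bounded (hbdd j Q hQ)) h2
    rw [mul_assoc, ← mul_pow]
    exact h1.trans h3
  have hup : ∀ j, ∀ Q ∈ D.cubes j, (surfMeasure n E).real Q ≤
      C * (2 * D.Cstar) ^ n * scale j ^ n := by
    intro j Q hQ
    have hj := scale_pos j
    have hc := D.subset_E hQ (D.center_mem j Q hQ)
    have h1 := hR.upper _ hc (2 * D.Cstar * scale j) (by positivity)
    rw [mul_assoc, ← mul_pow]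
    refine le_trans (measureReal_mono ?_ (hR.measure_ball_ne_top _ _)) h1
    intro y hy
    have := hdist j Q hQ y hy _ (D.center_mem j Q hQ)
    refine lt_of_le_of_lt this ?_
    have : 0 < D.Cstar * scale j := by positivity
    linarith
  set t : ℝ := min 1 (C⁻¹ * D.a₀ ^ n / C / 2 ^ (n + 1)) with ht
  have htpos : 0 < t := by positivity
  have ht1 : t ≤ 1 := min_le_left _ _
  have hdl : ∀ j, ∀ Q ∈ D.cubes j, t * scale j ≤ diam Q := by
    intro j Q hQ
    by_contra! hlt
    have hj := scale_pos j
    have hc := D.subset_E hQ (D.center_mem j Q hQ)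
    have h1 := hR.upper _ hc (t * scale j) (by positivity)
    have h2 : (surfMeasure n E).real Q ≤ C * (t * scale j) ^ n := by
      refine le_trans (measureReal_mono ?_ (hR.measure_ball_ne_top _ _)) h1
      intro y hy
      exact lt_of_le_of_lt (dist_le_diam_of_mem (hbdd j Q hQ) hy (D.center_mem j Q hQ)) hlt
    have h3 := (hlow j Q hQ).trans h2
    rw [mul_pow, ← mul_assoc] at h3
    have h4 := le_of_mul_le_mul_right h3 (by positivity)
    have h5 : t ^ n ≤ t := by
      calc t ^ n ≤ t ^ 1 := pow_le_pow_of_le_one htpos.le ht1 hn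
        _ = t := pow_one t
    have h6 : C * t ^ n ≤ C * (C⁻¹ * D.a₀ ^ n / C / 2 ^ (n + 1)) := by
      gcongr
      exact h5.trans (min_le_right _ _)
    have h7 : C * (C⁻¹ * D.a₀ ^ n / C / 2 ^ (n + 1)) = (C⁻¹ * D.a₀ ^ n) / 2 ^ (n + 1) := by
      field_simp
    rw [h7] at h6
    have h8 : (C⁻¹ * D.a₀ ^ n) / 2 ^ (n + 1) < C⁻¹ * D.a₀ ^ n :=
      div_lt_self (by positivity) (one_lt_pow₀ (by norm_num) (by omega))
    linarith
  set Λ : ℝ := C + (C⁻¹ * D.a₀ ^ n)⁻¹ + C * (2 * D.Cstar) ^ n + D.Cstar + D.a₀⁻¹ + t⁻¹ with hΛ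
  have p1 : 0 < (C⁻¹ * D.a₀ ^ n)⁻¹ := by positivity
  have p2 : 0 < C * (2 * D.Cstar) ^ n := by positivity
  have p3 : 0 < D.a₀⁻¹ := by positivity
  have p4 : 0 < t⁻¹ := by positivity
  have hΛC : C ≤ Λ := by linarith
  refine ⟨Λ, hn, hclosed, hR.mono hΛC, ?_, ?_, ?_, ?_, ?_⟩
  · intro j Q hQ
    have hj := scale_pos j
    refine le_trans ?_ (hlow j Q hQ)
    gcongr
    exact inv_le_of_inv_le₀ (by positivity) (by linarith)
  · intro j Q hQ
    have hj := scale_pos j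
    refine (hup j Q hQ).trans ?_
    gcongr
    linarith
  · intro j Q hQ x hx y hy
    have hj := scale_pos j
    refine (hdist j Q hQ x hx y hy).trans ?_
    gcongr
    linarith
  · intro j Q hQ
    have hj := scale_pos j
    refine subset_trans (inter_subset_inter_right _ (ball_subset_ball ?_)) (D.contains_ball j Q hQ)
    change Λ⁻¹ * scale j ≤ D.a₀ * scale j
    gcongr
    exact inv_le_of_inv_le₀ ha (by linarith)
  · intro j Q hQ
    have hj := scale_pos j
    refine le_trans ?_ (hdl j Q hQ)
    gcongr
    exact inv_le_of_inv_le₀ htpos (by linarith)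

/-! ### Orthogonal coordinates along a unit vector -/

/-- Coordinates on `ES n` adapted to a unit vector `ν`: `π` is the projection along `ν` and
`ι` its orthogonal section. -/
structure Frame (n : ℕ) where
  ν : ES n
  π : ES n →ₗ[ℝ] EuclideanSpace ℝ (Fin n)
  ι : EuclideanSpace ℝ (Fin n) →ₗ[ℝ] ES n
  norm_ν : ‖ν‖ = 1
  π_ι : ∀ p, π (ι p) = p
  inner_ι : ∀ p, ⟪ν, ι p⟫_ℝ = 0
  decomp : ∀ z, ι (π z) + ⟪ν, z⟫_ℝ • ν = z
  norm_ι : ∀ p, ‖ι p‖ = ‖p‖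

lemma exists_frame {n : ℕ} {ν : ES n} (hν : ‖ν‖ = 1) : ∃ F : Frame n, F.ν = ν := by
  have hν0 : ν ≠ 0 := by
    rintro rfl
    simp at hν
  have : Fact (Module.finrank ℝ (ES n) = n + 1) := ⟨by simp⟩
  let b := OrthonormalBasis.fromOrthogonalSpanSingleton (𝕜 := ℝ) n hν0
  have hmem : ∀ w : (Submodule.span ℝ {ν})ᗮ, ⟪ν, (w : ES n)⟫_ℝ = 0 := fun w =>
    Submodule.mem_orthogonal_singleton_iff_inner_right.1 w.2
  refine ⟨{ν := ν
           π := b.repr.toLinearEquiv.toLinearMap ∘ₗ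
              ((Submodule.span ℝ {ν})ᗮ.orthogonalProjectionOnto).toLinearMap
           ι := (Submodule.span ℝ {ν})ᗮ.subtype ∘ₗ b.repr.symm.toLinearEquiv.toLinearMap
           norm_ν := hν
           π_ι := ?_, inner_ι := ?_, decomp := ?_, norm_ι := ?_ }, rfl⟩
  · intro p
    simp
  · intro p
    exact hmem _
  · intro z
    have h1 := (Submodule.span ℝ {ν}).starProjection_add_starProjection_orthogonal z
    have h2 : (Submodule.span ℝ {ν}).starProjection z = ⟪ν, z⟫_ℝ • ν :=
      Submodule.starProjection_unit_singleton ℝ hν z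
    rw [h2, add_comm] at h1
    simpa using h1
  · intro p
    change ‖b.repr.symm p‖ = ‖p‖
    simp

namespace Frame

variable {n : ℕ} (F : Frame n)

lemma inner_self : ⟪F.ν, F.ν⟫_ℝ = 1 := by
  rw [real_inner_self_eq_norm_sq, F.norm_ν]; norm_num

lemma π_ν : F.π F.ν = 0 := by
  have h := F.decomp F.ν
  rw [F.inner_self, one_smul] at h
  have : F.ι (F.π F.ν) = 0 := by simpa using h
  rw [← norm_eq_zero, ← F.norm_ι, this, norm_zero]

lemma norm_sq (z : ES n) : ‖z‖ ^ 2 = ‖F.π z‖ ^ 2 + ⟪F.ν, z⟫_ℝ ^ 2 := by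
  conv_lhs => rw [← F.decomp z]
  rw [← real_inner_self_eq_norm_sq, inner_add_left, inner_add_right, inner_add_right,
    real_inner_self_eq_norm_sq, F.norm_ι, real_inner_smul_right, real_inner_smul_left,
    real_inner_smul_left, real_inner_smul_right, F.inner_self, real_inner_comm F.ν (F.ι _), F.inner_ι]
  ring

lemma norm_π_le (z : ES n) : ‖F.π z‖ ≤ ‖z‖ := by
  have := F.norm_sq z
  nlinarith [norm_nonneg z, norm_nonneg (F.π z), sq_nonneg ⟪F.ν, z⟫_ℝ]

lemma abs_inner_le (z : ES n) : |⟪F.ν, z⟫_ℝ| ≤ ‖z‖ := by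
  have := abs_real_inner_le_norm F.ν z
  rwa [F.norm_ν, one_mul] at this

lemma norm_le (z : ES n) : ‖z‖ ≤ ‖F.π z‖ + |⟪F.ν, z⟫_ℝ| := by
  conv_lhs => rw [← F.decomp z]
  refine (norm_add_le _ _).trans ?_
  rw [F.norm_ι, norm_smul, F.norm_ν, mul_one, Real.norm_eq_abs]

lemma norm_π_sub_le (z w : ES n) : ‖F.π z - F.π w‖ ≤ dist z w := by
  rw [← map_sub, dist_eq_norm]
  exact F.norm_π_le _

end Frame

/-! ### Overlap and counting lemmas -/

/-- Finitely many measurable subsets of `B` that overlap only among nearby indices. -/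
lemma sum_measure_le_of_overlap {X : Type*} [MeasurableSpace X] {μ : Measure X} {s : Finset ℤ}
    {A : ℤ → Set X} {B : Set X} {J : ℕ} (hB : μ B ≠ ⊤) (hA : ∀ j ∈ s, MeasurableSet (A j))
    (hAB : ∀ j ∈ s, A j ⊆ B)
    (hover : ∀ i ∈ s, ∀ j ∈ s, i + J ≤ j → Disjoint (A i) (A j)) :
    ∑ j ∈ s, μ.real (A j) ≤ J * μ.real B := by
  classical
  by_cases hJ : J = 0
  · subst hJ
    have : ∀ j ∈ s, μ.real (A j) = 0 := by
      intro j hj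
      have := hover j hj j hj (by simp)
      rw [disjoint_self] at this
      simp [show A j = ∅ from this]
    rw [Finset.sum_eq_zero this]
    simp
  have hJ' : 0 < (J : ℤ) := by positivity
  have h1 : ∑ j ∈ s, μ.real (A j) =
      ∑ r ∈ Finset.range J, ∑ j ∈ s with (j % (J : ℤ)).toNat = r, μ.real (A j) := by
    refine (Finset.sum_fiberwise_of_maps_to (fun j _ => ?_) _).symm
    have h1 := Int.emod_nonneg j hJ'.ne'
    have h2 := Int.emod_lt_of_pos j hJ'
    rw [Finset.mem_range]
    omega
  rw [h1]
  have h2 : ∀ r ∈ Finset.range J, ∑ j ∈ s with (j % (J : ℤ)).toNat = r, μ.real (A j) ≤ μ.real B := by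
    intro r _
    rw [← measureReal_biUnion_finset ?_ ?_ ?_]
    · refine measureReal_mono (iUnion₂_subset fun j hj => hAB j (Finset.mem_filter.1 hj).1) hB
    · intro i hi j hj hij
      have hi' := Finset.mem_filter.1 (Finset.mem_coe.1 hi)
      have hj' := Finset.mem_filter.1 (Finset.mem_coe.1 hj)
      have hmod : i % J = j % J := by
        have h1 := Int.emod_nonneg i hJ'.ne'
        have h2 := Int.emod_nonneg j hJ'.ne'
        omega
      have hdvd : (J : ℤ) ∣ i - j := Int.dvd_of_emod_eq_zero (by
        rw [Int.sub_emod, hmod]; simp)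
      obtain ⟨q, hq⟩ := hdvd
      have hq0 : q ≠ 0 := by
        rintro rfl
        apply hij
        omega
      rcases lt_or_gt_of_ne hq0 with h | h
      · refine hover i hi'.1 j hj'.1 ?_
        nlinarith
      · refine (hover j hj'.1 i hi'.1 ?_).symm
        nlinarith
    · exact fun j hj => hA j (Finset.mem_filter.1 hj).1
    · exact fun j hj => ne_top_of_le_ne_top hB (measure_mono (hAB j (Finset.mem_filter.1 hj).1))
  calc _ ≤ ∑ r ∈ Finset.range J, μ.real B := Finset.sum_le_sum h2
    _ = J * μ.real B := by simp

/-- A set close to a whole `n`-dimensional disc contains many separated points near it. -/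
lemma exists_sep_near_disc (n : ℕ) : ∃ c : ℝ, 0 < c ∧ ∀ (E : Set (ES n)) (p μ : ES n) (R u : ℝ),
    ‖μ‖ = 1 → 0 < u → 0 < R →
    (∀ z, ⟪μ, z - p⟫_ℝ = 0 → dist z p < R → ∃ z' ∈ E, dist z z' ≤ u) →
    ∃ s : Finset (ES n), ↑s ⊆ E ∧ SepBy (2 * u) s ∧
      (∀ x ∈ s, ∃ z, ⟪μ, z - p⟫_ℝ = 0 ∧ dist z p < R ∧ dist z x ≤ u) ∧
      c * R ^ n ≤ s.card * u ^ n := by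
  classical
  obtain ⟨Λ, hv⟩ := regularOn_volume n
  have hΛ := hv.pos
  refine ⟨(Λ * 8 ^ n)⁻¹ * Λ⁻¹, by positivity, ?_⟩
  intro E p μ R u hμ hu hR hE
  obtain ⟨F, rfl⟩ := exists_frame hμ
  obtain ⟨t, htR, hts, htc⟩ := exists_net_of_bounded
    (isBounded_ball (x := (0 : EuclideanSpace ℝ (Fin n))) (r := R)) (show 0 < 4 * u by linarith)
  have hz : ∀ a ∈ t, ∃ x ∈ E, dist (p + F.ι a) x ≤ u := by
    intro a ha
    refine hE _ (by simp [F.inner_ι]) ?_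
    have := htR ha
    rw [mem_ball_zero_iff] at this
    simpa [dist_eq_norm, F.norm_ι] using this
  choose! f hfE hfd using hz
  have hsep : ∀ a ∈ t, ∀ b ∈ t, a ≠ b → 2 * u ≤ dist (f a) (f b) := by
    intro a ha b hb hab
    have h1 := hts a ha b hb hab
    have h2 : dist (p + F.ι a) (p + F.ι b) = dist a b := by
      rw [dist_add_left, dist_eq_norm, ← map_sub, F.norm_ι, dist_eq_norm]
    have h3 := dist_triangle4 (p + F.ι a) (f a) (f b) (p + F.ι b)
    have h4 := hfd a ha
    have h5 := hfd b hb
    rw [dist_comm] at h5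
    linarith
  have hinj : Set.InjOn f t := by
    intro a ha b hb hab
    by_contra hne
    have := hsep a ha b hb hne
    rw [hab, dist_self] at this
    linarith
  refine ⟨t.image f, ?_, ?_, ?_, ?_⟩
  · intro x hx
    obtain ⟨a, ha, rfl⟩ := Finset.mem_image.1 (Finset.mem_coe.1 hx)
    exact hfE a ha
  · intro x hx y hy hxy
    obtain ⟨a, ha, rfl⟩ := Finset.mem_image.1 hx
    obtain ⟨b, hb, rfl⟩ := Finset.mem_image.1 hy
    exact hsep a ha b hb (fun h => hxy (by rw [h]))
  · intro x hx
    obtain ⟨a, ha, rfl⟩ := Finset.mem_image.1 hx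
    refine ⟨p + F.ι a, by simp [F.inner_ι], ?_, hfd a ha⟩
    have := htR ha
    rw [mem_ball_zero_iff] at this
    simpa [dist_eq_norm, F.norm_ι] using this
  · rw [Finset.card_image_of_injOn hinj]
    have h1 := hv.measure_le_of_net (show 0 < 4 * u by linarith) htc
    have h2 := (hv.lower 0 (mem_univ _) R hR).trans h1
    have h3 : (2 * (4 * u)) ^ n = 8 ^ n * u ^ n := by rw [← mul_pow]; ring
    rw [h3] at h2
    have h4 : (Λ * 8 ^ n)⁻¹ * Λ⁻¹ * R ^ n ≤
        (Λ * 8 ^ n)⁻¹ * (t.card * (Λ * (8 ^ n * u ^ n))) := by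
      rw [mul_assoc]
      gcongr
    refine h4.trans_eq ?_
    field_simp

/-- If over each point of `S` the set `E` has `M` points that are spread out vertically, then
`S` is small. -/
lemma shadow_bound (n : ℕ) (Λ : ℝ) : ∃ C : ℝ, 0 < C ∧ ∀ (E : Set (ES n)) (F : Frame n)
    (S : Set (EuclideanSpace ℝ (Fin n))) (L u : ℝ) (M : ℕ) (y₀ : ES n),
    RegularOn (surfMeasure n E) E n Λ → 0 < u → u ≤ L → 1 ≤ M →
    (∀ p ∈ S, ∃ b s : ℝ, |s| = 1 ∧ ∀ i < M, ∃ x ∈ E, ‖F.π x - p‖ ≤ u ∧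
      |⟪F.ν, x⟫_ℝ - (b + s * (4 * u * i))| ≤ u ∧ dist x y₀ ≤ L) →
    volume.real S * M ≤ C * L ^ n := by
  classical
  obtain ⟨Λv, hv⟩ := regularOn_volume n
  have hΛv := hv.pos
  refine ⟨(Λ ^ 2 + 1) * Λv * 72 ^ n, by positivity, ?_⟩
  intro E F S L u M y₀ hreg hu huL hM hS
  have hL : 0 < L := by linarith
  have hSb : Bornology.IsBounded S := by
    refine (isBounded_closedBall (x := F.π y₀) (r := u + L)).subset ?_
    intro p hp
    obtain ⟨b, s, -, h⟩ := hS p hp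
    obtain ⟨x, -, h1, -, h3⟩ := h 0 (by omega)
    have h4 := F.norm_π_sub_le x y₀
    rw [mem_closedBall, dist_eq_norm]
    have h5 := norm_sub_le_norm_sub_add_norm_sub p (F.π x) (F.π y₀)
    rw [norm_sub_rev] at h1
    linarith
  obtain ⟨t, htS, hts, htc⟩ := exists_net_of_bounded hSb (show 0 < 3 * u by linarith)
  choose! b s hs f hfE hfp hfh hfd using hS
  have hsep : ∀ q ∈ t ×ˢ Finset.range M, ∀ q' ∈ t ×ˢ Finset.range M, q ≠ q' →
      u ≤ dist (f q.1 q.2) (f q'.1 q'.2) := by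
    rintro ⟨p, i⟩ hq ⟨p', i'⟩ hq' hne
    simp only [Finset.mem_product, Finset.mem_range] at hq hq'
    have hp := htS hq.1
    have hp' := htS hq'.1
    dsimp only
    by_cases hpp : p = p'
    · subst hpp
      have hii : i ≠ i' := fun h => hne (by rw [h])
      have h1 := hfh p hp i hq.2
      have h2 := hfh p hp i' hq'.2
      have h3 := F.abs_inner_le (f p i - f p i')
      rw [inner_sub_right, ← dist_eq_norm] at h3
      have h4 : 4 * u ≤ |s p * (4 * u * i) - s p * (4 * u * i')| := by
        rw [← mul_sub, ← mul_sub, abs_mul, hs p hp, one_mul, abs_mul,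
          abs_of_pos (show 0 < 4 * u by linarith)]
        have : (1 : ℝ) ≤ |(i : ℝ) - i'| := by
          have h : (1 : ℤ) ≤ |(i : ℤ) - i'| := Int.one_le_abs (by omega)
          exact_mod_cast h
        nlinarith
      have h5 : |s p * (4 * u * i) - s p * (4 * u * i')| ≤
          |⟪F.ν, f p i⟫_ℝ - ⟪F.ν, f p i'⟫_ℝ| + u + u := by
        rw [abs_le] at h1 h2
        refine abs_le.2 ⟨?_, ?_⟩
        · linarith [neg_abs_le (⟪F.ν, f p i⟫_ℝ - ⟪F.ν, f p i'⟫_ℝ)]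
        · linarith [le_abs_self (⟪F.ν, f p i⟫_ℝ - ⟪F.ν, f p i'⟫_ℝ)]
      linarith
    · have h1 := hts p hq.1 p' hq'.1 hpp
      have h2 := hfp p hp i hq.2
      have h3 := hfp p' hp' i' hq'.2
      have h4 := F.norm_π_sub_le (f p i) (f p' i')
      rw [← dist_eq_norm] at h2 h3 h4
      have h6 := dist_triangle4 p (F.π (f p i)) (F.π (f p' i')) p'
      rw [dist_comm] at h2
      linarith
  have hinj : Set.InjOn (fun q : EuclideanSpace ℝ (Fin n) × ℕ => f q.1 q.2)
      ↑(t ×ˢ Finset.range M) := by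
    intro q hq q' hq' h
    by_contra hne
    have := hsep q hq q' hq' hne
    dsimp only at h
    rw [h, dist_self] at this
    linarith
  have hcard := hreg.card_le_of_subset_ball
    (s := (t ×ˢ Finset.range M).image fun q => f q.1 q.2) (x := y₀) (t := u) (r := 2 * L)
    hu (by linarith) (by
      intro x hx
      obtain ⟨q, hq, rfl⟩ := Finset.mem_image.1 (Finset.mem_coe.1 hx)
      rw [Finset.mem_product, Finset.mem_range] at hq
      exact hfE _ (htS hq.1) _ hq.2) (by
      intro x hx y hy hxy
      obtain ⟨q, hq, rfl⟩ := Finset.mem_image.1 hx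
      obtain ⟨q', hq', rfl⟩ := Finset.mem_image.1 hy
      exact hsep q hq q' hq' (fun h => hxy (by rw [h]))) (by
      intro x hx
      obtain ⟨q, hq, rfl⟩ := Finset.mem_image.1 hx
      rw [Finset.mem_product, Finset.mem_range] at hq
      have := hfd _ (htS hq.1) _ hq.2
      linarith)
  rw [Finset.card_image_of_injOn hinj, Finset.card_product, Finset.card_range] at hcard
  push_cast at hcard
  have h1 := hv.measure_le_of_net (show 0 < 3 * u by linarith) htc
  have h2 : 4 * (2 * L + u) / u ≤ 12 * L / u := by
    apply div_le_div_of_nonneg_right _ hu.le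
    linarith
  have h3 : (t.card : ℝ) * M ≤ Λ ^ 2 * (12 * L / u) ^ n := hcard.trans (by gcongr)
  calc volume.real S * M ≤ t.card * (Λv * (2 * (3 * u)) ^ n) * M := by gcongr
    _ = (t.card * M) * (Λv * (2 * (3 * u)) ^ n) := by ring
    _ ≤ (Λ ^ 2 * (12 * L / u) ^ n) * (Λv * (2 * (3 * u)) ^ n) := by gcongr
    _ = Λ ^ 2 * Λv * ((12 * L / u) * (2 * (3 * u))) ^ n := by rw [mul_pow (12 * L / u)]; ring
    _ = Λ ^ 2 * Λv * 72 ^ n * L ^ n := by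
        have : (12 * L / u) * (2 * (3 * u)) = 72 * L := by field_simp; ring
        rw [this, mul_pow]; ring
    _ ≤ (Λ ^ 2 + 1) * Λv * 72 ^ n * L ^ n := by gcongr; linarith

/-! ### Stopping-time construction over a flat cube -/

/-- The data of the stopping-time construction: `good j y` says that `E` is flat around `y` at
generation `j`, `c` is a point around which the first generation is flat along the plane
through `p₀` orthogonal to `F.ν`, and all points are good from generation `k` up to some
generation at most `m`. -/
structure StopData (n : ℕ) (E : Set (ES n)) where
  F : Frame n
  k : ℤ
  m : ℤ
  c : ES n
  p₀ : ES n
  a : ℝ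
  e : ℝ
  δ : ℝ
  η : ℝ
  good : ℤ → ES n → Prop
  hkm : k < m
  a_pos : 0 < a
  a_le : a ≤ 1
  e_pos : 0 < e
  δ_pos : 0 < δ
  δ_le : δ ≤ 1
  η_pos : 0 < η
  η_le : 100 * η ≤ a
  e_le : 128 * e ≤ δ * η
  good_lt : ∀ j y, good j y → j < m
  flat : ∀ j, ∀ y ∈ E, good j y → ∃ p μ : ES n, dist y p ≤ e * scale j ∧ ‖μ‖ = 1 ∧
    ∀ z, ⟪μ, z - p⟫_ℝ = 0 → dist z p < 5 * a * scale j → ∃ z' ∈ E, dist z z' ≤ e * scale j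
  good_k : ∀ z ∈ E, dist z c < a * scale k → good k z
  dist_p₀ : dist c p₀ ≤ e * scale k
  start : ∀ z, ⟪F.ν, z - p₀⟫_ℝ = 0 → dist z p₀ < 5 * a * scale k →
    ∃ z' ∈ E, dist z z' ≤ e * scale k

namespace StopData

variable {n : ℕ} {E : Set (ES n)} (S : StopData n E)

/-- A steep disc of generation `j` close to `E`. -/
def SteepDisc (j : ℤ) (p μ : ES n) : Prop :=
  ‖μ‖ = 1 ∧ |⟪μ, S.F.ν⟫_ℝ| < S.δ ∧
    ∀ z, ⟪μ, z - p⟫_ℝ = 0 → dist z p < 5 * S.a * scale j → ∃ z' ∈ E, dist z z' ≤ S.e * scale j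

/-- The union of the steep discs of generation `j`. -/
def V (j : ℤ) : Set (ES n) :=
  {v | ∃ p μ, S.SteepDisc j p μ ∧ ⟪μ, v - p⟫_ℝ = 0 ∧ dist v p < 5 * S.a * scale j}

/-- `z` is a point of `E` near the vertical line over `p`, first bad at generation `s`, which
stays away from the steep discs before. -/
def Term (p : EuclideanSpace ℝ (Fin n)) (z : ES n) (s : ℤ) : Prop :=
  z ∈ E ∧ dist z S.c < S.a * scale S.k ∧ S.k < s ∧ s ≤ S.m ∧
  (∀ i, S.k ≤ i → i < s → S.good i z) ∧ ¬ S.good s z ∧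
  ‖S.F.π z - p‖ ≤ 2 * S.e * scale s ∧
  ∀ i, S.k ≤ i → i < s → ∀ v ∈ S.V i, S.η / 4 * scale i ≤ dist z v

/-- `y` meets a steep disc of generation `j`, but none of the earlier ones. -/
def Steep (j : ℤ) (y : ES n) : Prop :=
  y ∈ E ∧ S.k ≤ j ∧ j < S.m ∧ dist y S.c < S.a * scale S.k ∧
  (∀ i, S.k ≤ i → i < j → ∀ v ∈ S.V i, S.η / 4 * scale i ≤ dist y v) ∧
  ∃ v ∈ S.V j, dist y v < S.η * scale j

/-- The points of the base lying under a steep disc. -/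
def bad : Set (EuclideanSpace ℝ (Fin n)) :=
  {p | ∃ j y, S.Steep j y ∧ ‖S.F.π y - p‖ ≤ 2 * S.e * scale j}

lemma e_le_η : 128 * S.e ≤ S.η := by
  have := S.e_le; have := S.δ_le; have := S.η_pos
  nlinarith

/-- Moving along a non-steep plane to a nearby vertical line. -/
lemma exists_next {j : ℤ} {y : ES n} (hy : y ∈ E) (hg : S.good j y)
    (hV : ∀ v ∈ S.V j, S.η * scale j ≤ dist y v) {t : ℝ} (ht : 0 ≤ t)
    (hta : 4 * t ≤ S.a * S.δ)
    {p : EuclideanSpace ℝ (Fin n)} (hp : ‖S.F.π y - p‖ ≤ t * scale j) :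
    ∃ y' ∈ E, ‖S.F.π y' - p‖ ≤ 2 * S.e * scale (j + 1) ∧
      dist y' y ≤ (2 * t + 4 * S.e) / S.δ * scale j := by
  obtain ⟨p₁, μ, hyp, hμ, hplane⟩ := S.flat j y hy hg
  have hj := scale_pos j
  have ha := S.a_pos; have he := S.e_pos; have hδ := S.δ_pos; have hη := S.η_pos
  have hδ1 := S.δ_le
  have heη := S.e_le_η
  have hea := S.η_le
  have hedη := S.e_le
  have hsteep : S.δ ≤ |⟪μ, S.F.ν⟫_ℝ| := by
    by_contra! hlt
    have := hV p₁ ⟨p₁, μ, ⟨hμ, hlt, hplane⟩, by simp, by simp; positivity⟩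
    have : S.η * scale j ≤ S.e * scale j := this.trans hyp
    have := le_of_mul_le_mul_right this hj
    linarith
  have hne : ⟪μ, S.F.ν⟫_ℝ ≠ 0 := by
    intro h
    rw [h, abs_zero] at hsteep
    linarith
  set q := p - S.F.π p₁ with hq
  set s := -⟪μ, S.F.ι q⟫_ℝ / ⟪μ, S.F.ν⟫_ℝ with hs
  set w := p₁ + (S.F.ι q + s • S.F.ν) with hw
  have hqn : ‖q‖ ≤ (t + S.e) * scale j := by
    have h1 := S.F.norm_π_sub_le y p₁
    have h2 := norm_sub_le_norm_sub_add_norm_sub p (S.F.π y) (S.F.π p₁)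
    rw [norm_sub_rev] at hp
    rw [hq]
    linarith
  have hsn : |s| ≤ (t + S.e) / S.δ * scale j := by
    rw [hs, abs_div, abs_neg]
    have h1 : |⟪μ, S.F.ι q⟫_ℝ| ≤ (t + S.e) * scale j := by
      have := abs_real_inner_le_norm μ (S.F.ι q)
      rw [hμ, one_mul, S.F.norm_ι] at this
      exact this.trans hqn
    rw [div_mul_eq_mul_div]
    gcongr
  have hwp : dist w p₁ ≤ 2 * ((t + S.e) / S.δ) * scale j := by
    have h1 : dist w p₁ ≤ ‖q‖ + |s| := by
      rw [hw, dist_eq_norm, add_sub_cancel_left]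
      refine (norm_add_le _ _).trans ?_
      rw [S.F.norm_ι, norm_smul, S.F.norm_ν, mul_one, Real.norm_eq_abs]
    have h2 : t + S.e ≤ (t + S.e) / S.δ := by
      rw [le_div_iff₀ hδ]
      nlinarith
    nlinarith
  have hwplane : ⟪μ, w - p₁⟫_ℝ = 0 := by
    rw [hw, add_sub_cancel_left, inner_add_right, real_inner_smul_right, hs]
    field_simp
    ring
  have htd : (t + S.e) / S.δ ≤ S.a := by
    rw [div_le_iff₀ hδ]
    nlinarith
  obtain ⟨y', hy', hd⟩ := hplane w hwplane (by
    have h : 2 * ((t + S.e) / S.δ) < 5 * S.a := by linarith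
    exact hwp.trans_lt (mul_lt_mul_of_pos_right h hj))
  refine ⟨y', hy', ?_, ?_⟩
  · have h1 : S.F.π w = p := by
      rw [hw, map_add, map_add, map_smul, S.F.π_ν, smul_zero, add_zero, S.F.π_ι, hq]
      abel
    have h2 := S.F.norm_π_sub_le w y'
    rw [h1, norm_sub_rev] at h2
    rw [scale_succ]
    linarith
  · have h1 := dist_triangle4 y' w p₁ y
    rw [dist_comm y' w, dist_comm p₁ y] at h1
    have h2 : S.e ≤ S.e / S.δ := by
      rw [le_div_iff₀ hδ]
      nlinarith
    have h3 : (2 * t + 4 * S.e) / S.δ * scale j =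
        2 * ((t + S.e) / S.δ) * scale j + 2 * (S.e / S.δ * scale j) := by ring
    have h4 : S.e * scale j ≤ S.e / S.δ * scale j := by gcongr
    linarith

/-- The displacement constant of one step. -/
def θ : ℝ := 8 * S.e / S.δ

lemma θ_pos : 0 < S.θ := by
  have := S.e_pos; have := S.δ_pos
  unfold θ; positivity

lemma θ_le : 16 * S.θ ≤ S.η := by
  have := S.e_le; have := S.δ_pos
  unfold θ
  rw [mul_div_assoc', div_le_iff₀ this]
  linarith

lemma not_good_m (y : ES n) : ¬ S.good S.m y := fun h => lt_irrefl _ (S.good_lt _ _ h)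

lemma exists_first_bad {y : ES n} (hy : y ∈ E) (hc : dist y S.c < S.a * scale S.k) :
    ∃ s, S.k < s ∧ s ≤ S.m ∧ (∀ i, S.k ≤ i → i < s → S.good i y) ∧ ¬ S.good s y := by
  classical
  have hex : ∃ i : ℕ, ¬ S.good (S.k + i) y := by
    refine ⟨(S.m - S.k).toNat, ?_⟩
    have := S.hkm
    rw [show S.k + ((S.m - S.k).toNat : ℤ) = S.m by omega]
    exact S.not_good_m y
  have h1 := Nat.find_spec hex
  have h2 : ∀ i < Nat.find hex, S.good (S.k + i) y := fun i hi => by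
    simpa using Nat.find_min hex hi
  refine ⟨S.k + Nat.find hex, ?_, ?_, ?_, h1⟩
  · rcases Nat.eq_zero_or_pos (Nat.find hex) with h0 | h0
    · rw [h0] at h1
      exact absurd (S.good_k y hy hc) (by simpa using h1)
    · omega
  · by_contra! hlt
    have hkm := S.hkm
    have := h2 (S.m - S.k).toNat (by omega)
    rw [show S.k + ((S.m - S.k).toNat : ℤ) = S.m by omega] at this
    exact S.not_good_m y this
  · intro i hi1 hi2
    have := h2 (i - S.k).toNat (by omega)
    rwa [show S.k + ((i - S.k).toNat : ℤ) = i by omega] at this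

/-- Following the vertical line over a point that lies under no steep disc. -/
lemma exists_term {p : EuclideanSpace ℝ (Fin n)} (hp : p ∉ S.bad) {j : ℤ} {y : ES n}
    (hy : y ∈ E) (hkj : S.k ≤ j) (hjm : j ≤ S.m)
    (hyp : ‖S.F.π y - p‖ ≤ 2 * S.e * scale j)
    (hc : dist y S.c + 2 * S.θ * scale j < S.a * scale S.k)
    (hV : ∀ i, S.k ≤ i → i < j → ∀ v ∈ S.V i,
      S.η / 4 * scale i + 2 * S.θ * scale j ≤ dist y v) :
    ∃ z s, S.Term p z s ∧ dist z y ≤ 2 * S.θ * scale j := by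
  obtain ⟨N, hN⟩ : ∃ N : ℕ, j + N = S.m := ⟨(S.m - j).toNat, by omega⟩
  induction N generalizing j y with
  | zero =>
    have hj := scale_pos j
    have hθ := S.θ_pos
    have hθj : 0 < S.θ * scale j := by positivity
    obtain ⟨s, hs1, hs2, hs3, hs4⟩ := S.exists_first_bad hy (by linarith)
    have hsj : s ≤ j := by simp at hN; omega
    refine ⟨y, s, ⟨hy, by linarith, hs1, hs2, hs3, hs4, ?_, ?_⟩, by simp; linarith⟩
    · refine hyp.trans ?_
      have := S.e_pos; have := scale_anti hsj
      gcongr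
    · intro i hi1 hi2 v hv
      have := hV i hi1 (by omega) v hv
      linarith
  | succ N ih =>
    have hj := scale_pos j
    have hθ := S.θ_pos
    have hθj : 0 < S.θ * scale j := by positivity
    obtain ⟨s, hs1, hs2, hs3, hs4⟩ := S.exists_first_bad hy (by linarith)
    by_cases hsj : s ≤ j
    · refine ⟨y, s, ⟨hy, by linarith, hs1, hs2, hs3, hs4, ?_, ?_⟩, by simp; linarith⟩
      · refine hyp.trans ?_
        have := S.e_pos; have := scale_anti hsj
        gcongr
      · intro i hi1 hi2 v hv
        have := hV i hi1 (by omega) v hv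
        linarith
    · push Not at hsj
      have hgood := hs3 j hkj hsj
      have hVj : ∀ v ∈ S.V j, S.η * scale j ≤ dist y v := by
        intro v hv
        by_contra! hlt
        refine hp ⟨j, y, ⟨hy, hkj, by omega, by linarith, ?_, v, hv, hlt⟩, hyp⟩
        intro i hi1 hi2 v hv
        have := hV i hi1 (by omega) v hv
        linarith
      have he := S.e_pos; have hδ := S.δ_pos; have hη := S.η_pos; have ha := S.a_pos
      obtain ⟨y', hy', hyp', hyd⟩ := S.exists_next hy hgood hVj (t := 2 * S.e) (by linarith)
        (by have := S.e_le; have := S.η_le; nlinarith) hyp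
      have hyd' : dist y' y ≤ S.θ * scale j := by
        refine hyd.trans_eq ?_
        unfold θ
        ring
      have hθη := S.θ_le
      have hs := scale_succ j
      obtain ⟨z, s', hz, hzd⟩ := ih hy' (by omega) (by push_cast at hN; omega) hyp' (by
          have := dist_triangle y' y S.c
          rw [hs]
          linarith) (by
          intro i hi1 hi2 v hv
          have h1 := dist_triangle y y' v
          rw [dist_comm y y'] at h1
          rw [hs]
          rcases eq_or_lt_of_le (show i ≤ j by omega) with rfl | hij
          · have := hVj v hv
            nlinarith
          · have := hV i hi1 hij v hv
            linarith) (by push_cast at hN; omega)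
      refine ⟨z, s', hz, ?_⟩
      have := dist_triangle z y' y
      rw [hs] at hzd
      linarith

lemma Term.dist_V {S : StopData n E} {p : EuclideanSpace ℝ (Fin n)} {z : ES n} {s : ℤ}
    (h : S.Term p z s) (hp : p ∉ S.bad) {i : ℤ} (hi : S.k ≤ i) (his : i < s) {v : ES n}
    (hv : v ∈ S.V i) : S.η * scale i ≤ dist z v := by
  obtain ⟨hz, hc, hs1, hs2, hg, hb, hπ, hV⟩ := h
  by_contra! hlt
  refine hp ⟨i, z, ⟨hz, hi, by omega, hc, fun i' h1 h2 => hV i' h1 (by omega), v, hv, hlt⟩, ?_⟩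
  refine hπ.trans ?_
  have := S.e_pos; have := scale_anti his.le
  gcongr

/-- The height over the initial plane. -/
def height (z : ES n) : ℝ := ⟪S.F.ν, z - S.p₀⟫_ℝ

lemma abs_height_sub_le (z w : ES n) : |S.height z - S.height w| ≤ dist z w := by
  have := S.F.abs_inner_le (z - w)
  rw [dist_eq_norm]
  refine le_trans (le_of_eq ?_) this
  rw [height, height, ← inner_sub_right]
  simp

/-- Each good point of the base has a terminal point near the initial plane. -/
lemma exists_term_near {p : EuclideanSpace ℝ (Fin n)} (hp : p ∉ S.bad)
    (hpc : ‖p - S.F.π S.c‖ < S.a / 8 * scale S.k) :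
    ∃ z s, S.Term p z s ∧ |S.height z| ≤ S.η * scale S.k := by
  have hk := scale_pos S.k
  have ha := S.a_pos; have he := S.e_pos; have hη := S.η_pos; have hηa := S.η_le
  have heη := S.e_le_η; have hθ := S.θ_pos; have hθη := S.θ_le
  set w := S.p₀ + S.F.ι (p - S.F.π S.p₀) with hw
  have hq : ‖p - S.F.π S.p₀‖ ≤ (S.a / 8 + S.e) * scale S.k := by
    have h1 := norm_sub_le_norm_sub_add_norm_sub p (S.F.π S.c) (S.F.π S.p₀)
    have h2 := S.F.norm_π_sub_le S.c S.p₀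
    have := S.dist_p₀
    linarith
  have hwp : dist w S.p₀ ≤ (S.a / 8 + S.e) * scale S.k := by
    rw [hw, dist_eq_norm, add_sub_cancel_left, S.F.norm_ι]
    exact hq
  obtain ⟨y, hy, hyw⟩ := S.start w (by rw [hw, add_sub_cancel_left, S.F.inner_ι]) (by
    refine hwp.trans_lt ?_
    gcongr
    linarith)
  have hπw : S.F.π w = p := by
    rw [hw, map_add, S.F.π_ι]
    abel
  obtain ⟨z, s, hz, hzd⟩ := S.exists_term hp hy le_rfl S.hkm.le (by
    have := S.F.norm_π_sub_le w y
    rw [hπw, norm_sub_rev] at this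
    have : 0 < S.e * scale S.k := by positivity
    linarith) (by
    have h1 := dist_triangle4 y w S.p₀ S.c
    rw [dist_comm y w, dist_comm S.p₀ S.c] at h1
    have := S.dist_p₀
    have : S.a / 8 + S.e + S.e + S.e + 2 * S.θ < S.a := by linarith
    have := mul_lt_mul_of_pos_right this hk
    linarith) (fun i h1 h2 => by omega)
  refine ⟨z, s, hz, ?_⟩
  have h1 := S.abs_height_sub_le z y
  have h2 := S.abs_height_sub_le w y
  have h3 : S.height w = 0 := by
    rw [height, hw, add_sub_cancel_left, S.F.inner_ι]
  rw [h3, zero_sub, abs_neg] at h2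
  have h4 := abs_sub_abs_le_abs_sub (S.height z) (S.height y)
  have : S.e + 2 * S.θ ≤ S.η := by linarith
  have := mul_le_mul_of_nonneg_right this hk.le
  linarith

/-- A terminal point can be moved to a terminal point over a nearby base point. -/
lemma Term.exists_move {S : StopData n E} {p p' : EuclideanSpace ℝ (Fin n)} {z : ES n} {s : ℤ}
    (h : S.Term p z s) (hp : p ∉ S.bad) (hp' : p' ∉ S.bad) {j : ℤ} (hkj : S.k ≤ j) (hjs : j < s)
    (hc : dist z S.c ≤ S.a / 2 * scale S.k)
    (hpp : ‖p - p'‖ ≤ S.δ * S.η / 16 * scale j) :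
    ∃ z' s', S.Term p' z' s' ∧ dist z' z ≤ S.η * scale j := by
  have hV := fun {i : ℤ} (hi : S.k ≤ i) (his : i < s) {v : ES n} (hv : v ∈ S.V i) =>
    h.dist_V hp hi his hv
  obtain ⟨hz, -, hs1, hs2, hg, hb, hπ, -⟩ := h
  have hj := scale_pos j
  have hk := scale_pos S.k
  have hjk := scale_anti hkj
  have ha := S.a_pos; have he := S.e_pos; have hη := S.η_pos; have hηa := S.η_le
  have heη := S.e_le_η; have hθ := S.θ_pos; have hθη := S.θ_le; have hδ := S.δ_pos
  have hel := S.e_le; have hδ1 := S.δ_le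
  obtain ⟨y, hy, hyp, hyz⟩ := S.exists_next hz (hg j hkj hjs) (fun v hv => hV hkj hjs hv)
    (t := S.δ * S.η / 16 + 2 * S.e) (by positivity) (by nlinarith) (p := p') (by
      have h1 := norm_sub_le_norm_sub_add_norm_sub (S.F.π z) p p'
      have h2 : 2 * S.e * scale s ≤ 2 * S.e * scale j := by
        have := scale_anti hjs.le
        gcongr
      linarith)
  have hyz' : dist y z ≤ (S.η / 8 + S.θ) * scale j := by
    refine hyz.trans_eq ?_
    unfold θ
    field_simp
    ring
  have hs := scale_succ j
  obtain ⟨z', s', hz', hzd⟩ := S.exists_term hp' hy (j := j + 1) (by omega) (by omega) hyp (by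
      have h1 := dist_triangle y z S.c
      rw [hs]
      have h2 : (S.η / 8 + 2 * S.θ) * scale j ≤ (S.η / 8 + 2 * S.θ) * scale S.k := by
        gcongr
      have h3 : S.η / 8 + 2 * S.θ + S.a / 2 < S.a := by linarith
      have := mul_lt_mul_of_pos_right h3 hk
      linarith) (by
      intro i hi1 hi2 v hv
      have h1 := hV hi1 (by omega) hv
      have h2 := dist_triangle z y v
      rw [dist_comm z y] at h2
      rw [hs]
      have h3 : (S.η / 8 + 2 * S.θ) * scale j ≤ (S.η / 8 + 2 * S.θ) * scale i := by
        have := scale_anti (show i ≤ j by omega)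
        gcongr
      have h4 : (S.η / 8 + 2 * S.θ) * scale i ≤ S.η * (3 / 4) * scale i := by
        have := scale_pos i
        gcongr
        linarith
      linarith)
  refine ⟨z', s', hz', ?_⟩
  have h1 := dist_triangle z' y z
  rw [hs] at hzd
  have : S.η / 8 + 2 * S.θ ≤ S.η := by linarith
  have := mul_le_mul_of_nonneg_right this hj.le
  linarith

end StopData

/-! ### The measure of the set of bad base points -/

/-- Almost vertical segments inside a steep disc. -/
lemma exists_segment_in_disc {n : ℕ} {p μ ν v : ES n} {R τ δ : ℝ} (hμ : ‖μ‖ = 1) (hν : ‖ν‖ = 1)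
    (hδ : |⟪μ, ν⟫_ℝ| < δ) (hτ : 0 < τ) (hτ1 : τ < 1) (hv : ⟪μ, v - p⟫_ℝ = 0) (hvR : dist v p < R) :
    ∃ s : ℝ, |s| = 1 ∧ ∃ v' : ES n, dist v v' ≤ τ ^ 2 * R ∧ ∀ t : ℝ, 0 ≤ t → t ≤ τ * R →
      ∃ z, ⟪μ, z - p⟫_ℝ = 0 ∧ dist z p < R ∧ ‖z - (v' + (s * t) • ν)‖ ≤ δ * t := by
  have hR : 0 < R := lt_of_le_of_lt dist_nonneg hvR
  set w := ν - ⟪μ, ν⟫_ℝ • μ with hw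
  have hμμ : ⟪μ, μ⟫_ℝ = 1 := by rw [real_inner_self_eq_norm_sq, hμ]; norm_num
  have hνν : ⟪ν, ν⟫_ℝ = 1 := by rw [real_inner_self_eq_norm_sq, hν]; norm_num
  have hμw : ⟪μ, w⟫_ℝ = 0 := by
    rw [hw, inner_sub_right, real_inner_smul_right, hμμ]; ring
  have hw1 : ‖w‖ ^ 2 ≤ 1 := by
    rw [← real_inner_self_eq_norm_sq]
    have : ⟪w, w⟫_ℝ = 1 - ⟪μ, ν⟫_ℝ ^ 2 := by
      conv_lhs => rw [hw, inner_sub_left, real_inner_smul_left, hμw, inner_sub_right,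
        real_inner_smul_right, hνν, real_inner_comm μ ν]
      ring
    rw [this]
    nlinarith [sq_nonneg ⟪μ, ν⟫_ℝ]
  obtain ⟨s, hs, hsw⟩ : ∃ s : ℝ, |s| = 1 ∧ s * ⟪v - p, w⟫_ℝ ≤ 0 := by
    rcases le_total ⟪v - p, w⟫_ℝ 0 with h | h
    · exact ⟨1, by simp, by simpa using h⟩
    · exact ⟨-1, by simp, by simpa using h⟩
  have hs2 : s ^ 2 = 1 := by rw [← sq_abs, hs]; norm_num
  refine ⟨s, hs, p + (1 - τ ^ 2) • (v - p), ?_, ?_⟩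
  · rw [dist_eq_norm, show v - (p + (1 - τ ^ 2) • (v - p)) = τ ^ 2 • (v - p) by module, norm_smul,
      ← dist_eq_norm, Real.norm_eq_abs, abs_of_pos (by positivity)]
    gcongr
  · intro t ht htR
    refine ⟨p + (1 - τ ^ 2) • (v - p) + (s * t) • w, ?_, ?_, ?_⟩
    · rw [show p + (1 - τ ^ 2) • (v - p) + (s * t) • w - p =
        (1 - τ ^ 2) • (v - p) + (s * t) • w by abel, inner_add_right, real_inner_smul_right,
        real_inner_smul_right, hv, hμw]
      ring
    · rw [dist_eq_norm, show p + (1 - τ ^ 2) • (v - p) + (s * t) • w - p =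
        (1 - τ ^ 2) • (v - p) + (s * t) • w by abel]
      have h0 : 0 ≤ 1 - τ ^ 2 := by nlinarith
      refine lt_of_pow_lt_pow_left₀ 2 hR.le ?_
      rw [norm_add_sq_real, real_inner_smul_left, real_inner_smul_right, norm_smul, norm_smul,
        mul_pow, mul_pow, Real.norm_eq_abs, Real.norm_eq_abs, sq_abs, sq_abs, ← dist_eq_norm]
      have h1 : dist v p ^ 2 < R ^ 2 := by gcongr
      have h2 : t ^ 2 ≤ (τ * R) ^ 2 := by gcongr
      have h3 : (s * t) ^ 2 * ‖w‖ ^ 2 ≤ t ^ 2 := by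
        rw [mul_pow, hs2, one_mul]
        exact mul_le_of_le_one_right (sq_nonneg t) hw1
      have h4 : 2 * ((1 - τ ^ 2) * (s * t * ⟪v - p, w⟫_ℝ)) ≤ 0 := by
        have : (1 - τ ^ 2) * t * (s * ⟪v - p, w⟫_ℝ) ≤ 0 :=
          mul_nonpos_of_nonneg_of_nonpos (by positivity) hsw
        nlinarith
      have h5 : (1 - τ ^ 2) ^ 2 * dist v p ^ 2 ≤ (1 - τ ^ 2) * dist v p ^ 2 := by
        have : (1 - τ ^ 2) ^ 2 ≤ 1 - τ ^ 2 := by nlinarith [sq_nonneg τ]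
        gcongr
      have h7 : (1 - τ ^ 2) * dist v p ^ 2 < (1 - τ ^ 2) * R ^ 2 := by
        have : 0 < 1 - τ ^ 2 := by nlinarith
        gcongr
      have h8 : (τ * R) ^ 2 = τ ^ 2 * R ^ 2 := by ring
      nlinarith
    · rw [show p + (1 - τ ^ 2) • (v - p) + (s * t) • w -
        (p + (1 - τ ^ 2) • (v - p) + (s * t) • ν) = (s * t) • (w - ν) by module, hw,
        sub_sub_cancel_left, norm_smul, norm_neg, norm_smul, hμ, Real.norm_eq_abs, Real.norm_eq_abs,
        abs_mul, hs, one_mul, abs_of_nonneg ht, mul_one, mul_comm]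
      gcongr

namespace StopData

variable {n : ℕ} {E : Set (ES n)} (S : StopData n E)

/-- Near a steep disc the set `E` carries a substantial amount of mass. -/
lemma exists_mass_near (n : ℕ) {Λ a : ℝ} (hΛ : 0 < Λ) (ha : 0 < a) : ∃ c : ℝ, 0 < c ∧
    ∀ (E : Set (ES n)) (S : StopData n E), RegularOn (surfMeasure n E) E n Λ → S.a = a →
      ∀ j y, S.Steep j y → ∃ X : Set (ES n), MeasurableSet X ∧ X ⊆ ball y (12 * scale j) ∧
        (∀ x ∈ X, ∃ v ∈ S.V j, dist x v < S.η / 16 * scale j) ∧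
        c * scale j ^ n ≤ (surfMeasure n E).real X := by
  obtain ⟨c, hc, h⟩ := exists_sep_near_disc n
  refine ⟨Λ⁻¹ * c * (5 * a) ^ n, by positivity, ?_⟩
  rintro E S hreg rfl j y ⟨hy, hkj, hjm, hyc, hyV, v, ⟨p, μ, ⟨hμ, hμν, hdisc⟩, hv, hvp⟩, hyv⟩
  have hj := scale_pos j
  have hη := S.η_pos; have heη := S.e_le_η; have ha1 := S.a_le; have hη1 := S.η_le
  set u := S.η / 32 * scale j with hu
  have hu0 : 0 < u := by positivity
  obtain ⟨s, hsE, hsep, hs, hcard⟩ := h E p μ (5 * S.a * scale j) u hμ hu0 (by positivity)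
    (fun z hz hzp => by
      obtain ⟨z', hz', hd⟩ := hdisc z hz hzp
      refine ⟨z', hz', hd.trans ?_⟩
      rw [hu]
      gcongr
      linarith)
  have hV : ∀ x ∈ ⋃ x ∈ s, ball x u, ∃ v ∈ S.V j, dist v p < 5 * S.a * scale j ∧
      dist x v < S.η / 16 * scale j := by
    intro x hx
    obtain ⟨x', hx', hd⟩ := mem_iUnion₂.1 hx
    obtain ⟨z, hz, hzp, hzx⟩ := hs x' hx'
    refine ⟨z, ⟨p, μ, ⟨hμ, hμν, hdisc⟩, hz, hzp⟩, hzp, ?_⟩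
    have h1 := dist_triangle x x' z
    rw [dist_comm x' z] at h1
    have h2 : dist x x' < u := hd
    have : S.η / 16 * scale j = u + u := by rw [hu]; ring
    linarith
  refine ⟨⋃ x ∈ s, ball x u, s.measurableSet_biUnion fun x _ => measurableSet_ball, ?_, ?_, ?_⟩
  · intro x hx
    obtain ⟨z, -, hzp, hxz⟩ := hV x hx
    rw [mem_ball]
    have h1 := dist_triangle4 x z p v
    have h2 := dist_triangle x v y
    rw [dist_comm p v] at h1
    rw [dist_comm v y] at h2
    have h3 : S.η / 16 + 5 * S.a + 5 * S.a + S.η < 12 := by linarith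
    have := mul_lt_mul_of_pos_right h3 hj
    linarith
  · intro x hx
    obtain ⟨z, hz, -, hxz⟩ := hV x hx
    exact ⟨z, hz, hxz⟩
  · have h1 := hreg.card_mul_le (t := 2 * u) (A := ⋃ x ∈ s, ball x u) (by positivity) hsE hsep
      ((measure_biUnion_lt_top s.finite_toSet
        (fun y _ => (hreg.measure_ball_ne_top y _).lt_top))).ne (fun x hx => by
          rw [show 2 * u / 2 = u by ring]
          exact subset_iUnion₂_of_subset x hx subset_rfl)
    refine le_trans ?_ h1
    rw [show 2 * u / 2 = u by ring]
    calc Λ⁻¹ * c * (5 * S.a) ^ n * scale j ^ n = Λ⁻¹ * (c * (5 * S.a * scale j) ^ n) := by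
          rw [mul_pow (5 * S.a)]; ring
      _ ≤ Λ⁻¹ * (s.card * u ^ n) := by gcongr
      _ = _ := by ring

/-- The base points under a cluster of steep points. -/
def shadow (j : ℤ) (y₀ : ES n) : Set (EuclideanSpace ℝ (Fin n)) :=
  {p | ∃ y, S.Steep j y ∧ dist y y₀ < 32 * scale j ∧ ‖S.F.π y - p‖ ≤ 2 * S.e * scale j}

lemma measure_shadow_le (n : ℕ) (Λ : ℝ) {a : ℝ} (ha : 0 < a) : ∃ C : ℝ, 0 < C ∧
    ∀ (E : Set (ES n)) (S : StopData n E) (τ : ℝ), RegularOn (surfMeasure n E) E n Λ → S.a = a →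
      0 < τ → τ < 1 → S.δ = τ ^ 2 → S.η = τ ^ 2 → ∀ j y₀,
        volume.real (S.shadow j y₀) ≤ C * τ * scale j ^ n := by
  obtain ⟨C, hC, h⟩ := shadow_bound n Λ
  refine ⟨C * 48 ^ n * 16 / a, by positivity, ?_⟩
  rintro E S τ hreg rfl hτ hτ1 hδ hη j y₀
  have hj := scale_pos j
  have heη := S.e_le_η; have ha1 := S.a_le; have hη1 := S.η_le; have he := S.e_pos
  rw [hη] at heη hη1
  set u := 16 * τ ^ 2 * scale j with hu
  set M := ⌈S.a / (16 * τ)⌉₊ with hM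
  have hMpos : 0 < S.a / (16 * τ) := by positivity
  have key := h E S.F (S.shadow j y₀) (48 * scale j) u M y₀ hreg (by positivity) (by
      rw [hu]; gcongr; nlinarith) (Nat.one_le_ceil_iff.2 hMpos) (by
    rintro p ⟨y, ⟨hy, hkj, hjm, hyc, hyV, v, ⟨p₁, μ, ⟨hμ, hμν, hdisc⟩, hv, hvp⟩, hyv⟩, hyy, hyp⟩
    obtain ⟨s, hs, v', hvv, hseg⟩ := exists_segment_in_disc hμ S.F.norm_ν hμν hτ hτ1 hv hvp
    refine ⟨⟪S.F.ν, v'⟫_ℝ, s, hs, fun i hi => ?_⟩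
    have hi1 : (i : ℝ) ≤ S.a / (16 * τ) := by
      have := Nat.lt_ceil.1 hi
      exact this.le
    have hi2 : 16 * τ * i ≤ S.a := by
      rw [le_div_iff₀ (by positivity)] at hi1
      linarith
    have ht : 4 * u * i ≤ 4 * S.a * τ * scale j := by
      have h1 : 4 * u * i = 4 * (16 * τ * i) * τ * scale j := by rw [hu]; ring
      rw [h1]; gcongr
    obtain ⟨z, hz, hzp, hzv⟩ := hseg (4 * u * i) (by positivity) (by
      refine ht.trans ?_
      have : 0 < S.a * τ * scale j := by positivity
      linarith)
    obtain ⟨x, hx, hzx⟩ := hdisc z hz hzp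
    set b := v' + (s * (4 * u * i)) • S.F.ν with hb
    have hzb : ‖z - b‖ ≤ 4 * τ ^ 2 * scale j := by
      refine hzv.trans ?_
      rw [hδ]
      have h1 : 4 * u * i ≤ 4 * 1 * 1 * scale j := ht.trans (by gcongr)
      have := mul_le_mul_of_nonneg_left h1 (sq_nonneg τ)
      linarith
    have hxb : dist x b ≤ 5 * τ ^ 2 * scale j := by
      have h1 := dist_triangle x z b
      rw [dist_comm x z, dist_eq_norm z b] at h1
      have : S.e * scale j ≤ τ ^ 2 * scale j := by gcongr; linarith
      linarith
    have hvv' : dist v v' ≤ 5 * τ ^ 2 * scale j := by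
      refine hvv.trans ?_
      have : τ ^ 2 * (5 * S.a * scale j) ≤ τ ^ 2 * (5 * 1 * scale j) := by gcongr
      linarith
    rw [hη] at hyv
    have hτj : 0 < τ ^ 2 * scale j := by positivity
    refine ⟨x, hx, ?_, ?_, ?_⟩
    · have h1 := S.F.norm_π_sub_le x b
      have h2 := S.F.norm_π_sub_le v v'
      have h3 := S.F.norm_π_sub_le y v
      have h4 : S.F.π b = S.F.π v' := by
        rw [hb, map_add, map_smul, S.F.π_ν, smul_zero, add_zero]
      rw [h4] at h1
      have h5 : ‖S.F.π x - p‖ ≤ ‖S.F.π x - S.F.π v'‖ + ‖S.F.π v - S.F.π v'‖ +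
          ‖S.F.π y - S.F.π v‖ + ‖S.F.π y - p‖ := by
        have e : S.F.π x - p = (S.F.π x - S.F.π v') - (S.F.π v - S.F.π v') -
          (S.F.π y - S.F.π v) + (S.F.π y - p) := by abel
        rw [e]
        refine (norm_add_le _ _).trans ?_
        gcongr
        refine (norm_sub_le _ _).trans ?_
        gcongr
        exact norm_sub_le _ _
      have h6 : S.e * scale j ≤ τ ^ 2 * scale j := by gcongr; linarith
      rw [hu]
      linarith
    · have h1 := S.F.abs_inner_le (x - b)
      rw [← dist_eq_norm] at h1
      have h2 : ⟪S.F.ν, x - b⟫_ℝ = ⟪S.F.ν, x⟫_ℝ - (⟪S.F.ν, v'⟫_ℝ + s * (4 * u * i)) := by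
        rw [hb, inner_sub_right, inner_add_right, real_inner_smul_right, S.F.inner_self]
        ring
      rw [← h2, hu]
      linarith
    · have h1 := dist_triangle4 x z p₁ v
      have h2 := dist_triangle4 x v y y₀
      rw [dist_comm x z, dist_comm p₁ v] at h1
      rw [dist_comm v y] at h2
      have h3 : S.e + 5 * S.a + 5 * S.a + τ ^ 2 + 32 ≤ 48 := by nlinarith
      have := mul_le_mul_of_nonneg_right h3 hj.le
      linarith)
  have h1 : S.a / (16 * τ) ≤ M := Nat.le_ceil _
  have h2 : volume.real (S.shadow j y₀) * (S.a / (16 * τ)) ≤ C * (48 * scale j) ^ n :=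
    le_trans (by gcongr) key
  rw [← le_div_iff₀ hMpos] at h2
  refine h2.trans_eq ?_
  rw [mul_pow]
  field_simp

lemma isBounded_bad : Bornology.IsBounded S.bad := by
  refine (isBounded_closedBall (x := S.F.π S.c) (r := (S.a + 2 * S.e) * scale S.k)).subset ?_
  rintro p ⟨j, y, hy, hp⟩
  have h1 := S.F.norm_π_sub_le y S.c
  have h3 := hy.2.2.2.1
  rw [mem_closedBall, dist_eq_norm]
  have h2 := norm_sub_le_norm_sub_add_norm_sub p (S.F.π y) (S.F.π S.c)
  rw [norm_sub_rev p (S.F.π y)] at h2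
  have h4 : 2 * S.e * scale j ≤ 2 * S.e * scale S.k := by
    have := scale_anti hy.2.1
    have := S.e_pos
    gcongr
  linarith

/-- The base points under steep discs have small measure if steepness is measured finely. -/
lemma measure_bad_le (n : ℕ) {Λ a : ℝ} (ha : 0 < a) : ∃ C : ℝ, 0 < C ∧
    ∀ (E : Set (ES n)) (S : StopData n E) (N : ℕ), RegularOn (surfMeasure n E) E n Λ → S.a = a →
      S.δ = (2⁻¹ ^ N) ^ 2 → S.η = (2⁻¹ ^ N) ^ 2 →
        volume.real S.bad ≤ C * (2⁻¹ ^ N * (2 * N + 7)) * scale S.k ^ n := by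
  by_cases hΛ : 0 < Λ
  swap
  · exact ⟨1, one_pos, fun E S N hreg => absurd hreg.pos hΛ⟩
  obtain ⟨C, hC, hshadow⟩ := measure_shadow_le n Λ ha
  obtain ⟨c, hc, hmass⟩ := exists_mass_near n hΛ ha
  refine ⟨C / c * Λ * 32 ^ n, by positivity, ?_⟩
  rintro E S N hreg hSa hδ hη
  set τ : ℝ := 2⁻¹ ^ N with hτ
  have hτ0 : 0 < τ := by positivity
  have hη1 := S.η_le; have ha1 := S.a_le; have hη0 := S.η_pos
  have hτ1 : τ < 1 := by
    by_contra! hle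
    have : 1 ≤ τ ^ 2 := by nlinarith
    linarith
  choose! X hXm hXb hXV hXc using hmass E S hreg hSa
  have hnet : ∀ j, ∃ s : Finset (ES n), ↑s ⊆ {y | S.Steep j y} ∧ SepBy (32 * scale j) s ∧
      ∀ y ∈ {y | S.Steep j y}, ∃ y' ∈ s, dist y y' < 32 * scale j := fun j =>
    exists_net_of_bounded ((isBounded_ball (x := S.c) (r := S.a * scale S.k)).subset
      fun y hy => hy.2.2.2.1) (by have := scale_pos j; positivity)
  choose s hsub hsep hcov using hnet
  set A : ℤ → Set (ES n) := fun j => ⋃ y ∈ s j, X j y with hA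
  have hle : ∀ j, volume.real (⋃ y ∈ s j, S.shadow j y) ≤
      C * τ / c * (surfMeasure n E).real (A j) := by
    intro j
    have h1 : (surfMeasure n E).real (A j) = ∑ y ∈ s j, (surfMeasure n E).real (X j y) := by
      refine measureReal_biUnion_finset ?_ (fun y hy => hXm j y (hsub j hy)) (fun y hy => ?_)
      · intro y hy y' hy' hne
        refine Disjoint.mono (hXb j y (hsub j hy)) (hXb j y' (hsub j hy')) (ball_disjoint_ball ?_)
        have := hsep j y hy y' hy' hne
        have := scale_pos j
        linarith
      · exact hreg.ne_top_of_bounded (isBounded_ball.subset (hXb j y (hsub j hy)))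
    rw [h1, Finset.mul_sum]
    refine (measureReal_biUnion_finset_le _ _).trans (Finset.sum_le_sum fun y hy => ?_)
    refine (hshadow E S τ hreg hSa hτ0 hτ1 hδ hη j y).trans ?_
    calc C * τ * scale j ^ n = C * τ / c * (c * scale j ^ n) := by field_simp
      _ ≤ _ := by have := hXc j y (hsub j hy); gcongr
  have hbad : S.bad ⊆ ⋃ j ∈ Finset.Ico S.k S.m, ⋃ y ∈ s j, S.shadow j y := by
    rintro p ⟨j, y, hy, hyp⟩
    obtain ⟨y', hy', hd⟩ := hcov j y hy
    exact mem_iUnion₂.2 ⟨j, Finset.mem_Ico.2 ⟨hy.2.1, hy.2.2.1⟩,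
      mem_iUnion₂.2 ⟨y', hy', y, hy, hd, hyp⟩⟩
  have hsb : ∀ j y, Bornology.IsBounded (S.shadow j y) := by
    intro j y
    refine (isBounded_closedBall (x := S.F.π y) (r := 32 * scale j + 2 * S.e * scale j)).subset ?_
    rintro p ⟨y', hy', hd, hp⟩
    have h1 := S.F.norm_π_sub_le y' y
    rw [mem_closedBall, dist_eq_norm]
    have h2 := norm_sub_le_norm_sub_add_norm_sub p (S.F.π y') (S.F.π y)
    rw [norm_sub_rev p (S.F.π y')] at h2
    linarith
  have hover := sum_measure_le_of_overlap (μ := surfMeasure n E) (s := Finset.Ico S.k S.m)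
    (A := A) (B := ball S.c (16 * scale S.k)) (J := 2 * N + 7) (hreg.measure_ball_ne_top _ _)
    (fun j _ => (s j).measurableSet_biUnion fun y hy => hXm j y (hsub j hy)) (by
      intro j hj x hx
      obtain ⟨y, hy, hxy⟩ := mem_iUnion₂.1 hx
      have h1 : dist x y < 12 * scale j := hXb j y (hsub j hy) hxy
      have h2 := (hsub j hy).2.2.2.1
      have h3 := dist_triangle x y S.c
      have h4 := scale_anti (Finset.mem_Ico.1 hj).1
      have h5 := scale_pos S.k
      have h6 : S.a * scale S.k ≤ 1 * scale S.k := by gcongr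
      rw [mem_ball]
      linarith) (by
      intro i hi j hj hij
      rw [Set.disjoint_left]
      intro x hxi hxj
      obtain ⟨y, hy, hxy⟩ := mem_iUnion₂.1 hxi
      obtain ⟨y', hy', hxy'⟩ := mem_iUnion₂.1 hxj
      obtain ⟨v, hv, hxv⟩ := hXV i y (hsub i hy) x hxy
      have h1 : dist x y' < 12 * scale j := hXb j y' (hsub j hy') hxy'
      have h2 := (hsub j hy').2.2.2.2.1 i (Finset.mem_Ico.1 hi).1 (by omega) v hv
      have h3 := dist_triangle y' x v
      rw [dist_comm y' x] at h3
      have h4 : scale j ≤ S.η / 128 * scale i := by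
        refine (scale_anti hij).trans_eq ?_
        rw [scale_add_nat, hη, hτ, pow_add, pow_mul', inv_pow]
        field_simp
        norm_num
      have := scale_pos i
      have : 0 < S.η * scale i := by positivity
      linarith)
  have hball := hreg.measure_ball_le S.c (show 0 < 16 * scale S.k by
    have := scale_pos S.k; positivity)
  calc volume.real S.bad ≤ volume.real (⋃ j ∈ Finset.Ico S.k S.m, ⋃ y ∈ s j, S.shadow j y) :=
        measureReal_mono hbad ((Bornology.isBounded_biUnion_finset _).2 fun j _ =>
          (Bornology.isBounded_biUnion_finset _).2 fun y _ => hsb j y).measure_lt_top.ne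
    _ ≤ ∑ j ∈ Finset.Ico S.k S.m, volume.real (⋃ y ∈ s j, S.shadow j y) :=
        measureReal_biUnion_finset_le _ _
    _ ≤ ∑ j ∈ Finset.Ico S.k S.m, C * τ / c * (surfMeasure n E).real (A j) :=
        Finset.sum_le_sum fun j _ => hle j
    _ = C * τ / c * ∑ j ∈ Finset.Ico S.k S.m, (surfMeasure n E).real (A j) := by
        rw [Finset.mul_sum]
    _ ≤ C * τ / c * ((2 * N + 7 : ℕ) * (Λ * (2 * (16 * scale S.k)) ^ n)) := by
        gcongr
        exact hover.trans (by gcongr)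
    _ = _ := by
        rw [show 2 * (16 * scale S.k) = 32 * scale S.k by ring, mul_pow]
        push_cast
        ring

end StopData

namespace StopData

variable {n : ℕ} {E : Set (ES n)} (S : StopData n E)

/-- The part of the initial plane over which the construction takes place. -/
def base : Set (EuclideanSpace ℝ (Fin n)) := ball (S.F.π S.c) (S.a / 8 * scale S.k)

/-- Terminal points of almost minimal height. -/
lemma exists_lowest {p : EuclideanSpace ℝ (Fin n)} (hp : p ∉ S.bad) (hpb : p ∈ S.base) :
    ∃ z s, S.Term p z s ∧ dist z S.c ≤ S.a / 2 * scale S.k ∧ |S.height z| ≤ 2 * S.η * scale S.k ∧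
      ∀ z' s', S.Term p z' s' → |S.height z| ≤ |S.height z'| + S.η * scale S.m := by
  have hm := scale_pos S.m
  have hη := S.η_pos
  rw [base, mem_ball, dist_eq_norm] at hpb
  obtain ⟨z₀, s₀, h₀, hz₀⟩ := S.exists_term_near hp hpb
  obtain ⟨_, ⟨z, s, hz, rfl⟩, hlt⟩ := Real.lt_sInf_add_pos
    (s := {x | ∃ z s, S.Term p z s ∧ |S.height z| = x}) ⟨_, z₀, s₀, h₀, rfl⟩
    (ε := S.η * scale S.m) (by positivity)
  have hmin : ∀ z' s', S.Term p z' s' → |S.height z| ≤ |S.height z'| + S.η * scale S.m := by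
    intro z' s' h'
    have : sInf {x | ∃ z s, S.Term p z s ∧ |S.height z| = x} ≤ |S.height z'| :=
      csInf_le ⟨0, by rintro _ ⟨z, s, -, rfl⟩; exact abs_nonneg _⟩ ⟨z', s', h', rfl⟩
    linarith
  have hheight : |S.height z| ≤ 2 * S.η * scale S.k := by
    have h1 := hmin z₀ s₀ h₀
    have h2 : S.η * scale S.m ≤ S.η * scale S.k := by
      have := scale_anti S.hkm.le
      gcongr
    linarith
  refine ⟨z, s, hz, ?_, hheight, hmin⟩
  have h1 := S.F.norm_le (z - S.c)
  rw [map_sub] at h1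
  have h2 := norm_sub_le_norm_sub_add_norm_sub (S.F.π z) p (S.F.π S.c)
  have h3 := hz.2.2.2.2.2.2.1
  have h4 : 2 * S.e * scale s ≤ 2 * S.e * scale S.k := by
    have := scale_anti hz.2.2.1.le
    have := S.e_pos
    gcongr
  have h5 : |⟪S.F.ν, z - S.c⟫_ℝ| ≤ |S.height z| + S.e * scale S.k := by
    have h6 := S.abs_height_sub_le S.c S.p₀
    have h7 : S.height S.p₀ = 0 := by simp [height]
    rw [h7, sub_zero] at h6
    have h8 : ⟪S.F.ν, z - S.c⟫_ℝ = S.height z - S.height S.c := by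
      rw [height, height, ← inner_sub_right]
      simp
    rw [h8]
    exact (abs_sub _ _).trans (by linarith [S.dist_p₀])
  rw [dist_eq_norm]
  have := S.e_le_η; have := S.η_le
  have h6 : S.a / 8 + 2 * S.e + 2 * S.η + S.e ≤ S.a / 2 := by linarith
  have := mul_le_mul_of_nonneg_right h6 (scale_pos S.k).le
  linarith

lemma abs_height_le_of_lowest {p p' : EuclideanSpace ℝ (Fin n)} {z z' : ES n} {s : ℤ}
    (hp : p ∉ S.bad) (hp' : p' ∉ S.bad) (hz : S.Term p z s)
    (hzc : dist z S.c ≤ S.a / 2 * scale S.k) (hz' : |S.height z'| ≤ 2 * S.η * scale S.k)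
    (hmin : ∀ w t, S.Term p' w t → |S.height z'| ≤ |S.height w| + S.η * scale S.m) :
    |S.height z'| ≤ |S.height z| + 256 / (S.δ * S.η) * (‖p - p'‖ + scale s) := by
  have hη := S.η_pos; have hδ := S.δ_pos; have hδ1 := S.δ_le; have hη1 := S.η_le
  have ha := S.a_le; have hk := scale_pos S.k
  set c := S.δ * S.η / 16 with hc
  have hc0 : 0 < c := by positivity
  have hc1 : c ≤ 1 := by nlinarith
  set X := max (‖p - p'‖ / c) (scale (s - 1)) with hX
  have hX1 : scale (s - 1) ≤ X := le_max_right _ _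
  have hX2 : ‖p - p'‖ ≤ c * X := by
    rw [mul_comm, ← div_le_iff₀ hc0]; exact le_max_left _ _
  have hXpos : 0 < X := (scale_pos _).trans_le hX1
  have hs : scale (s - 1) = 2 * scale s := by
    have := scale_succ (s - 1)
    rw [sub_add_cancel] at this
    linarith
  have hX3 : X ≤ (‖p - p'‖ + 2 * scale s) / c := by
    have := scale_pos s
    refine max_le (by gcongr; linarith) ?_
    rw [hs, le_div_iff₀ hc0]
    nlinarith [norm_nonneg (p - p')]
  obtain ⟨j, hj1, hj2⟩ := exists_scale_le (show 0 < 2 * X by positivity)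
  have hj := scale_pos j
  have hjs : j < s := by
    by_contra! hle
    have := scale_anti (show s - 1 ≤ j by omega)
    linarith
  have hfin : |S.height z'| ≤ |S.height z| + 4 * scale j := by
    rcases lt_or_ge j S.k with hjk | hjk
    · have h1 := scale_half_of_lt hjk
      have h2 : 2 * S.η * scale S.k ≤ 2 * scale S.k := by
        have : S.η ≤ 1 := by linarith
        nlinarith
      linarith [abs_nonneg (S.height z)]
    · obtain ⟨w, t, hw, hd⟩ := hz.exists_move hp hp' hjk hjs hzc (hX2.trans (by gcongr; linarith))
      have h1 := hmin w t hw
      have h2 := (abs_sub_abs_le_abs_sub _ _).trans (S.abs_height_sub_le w z)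
      have h3 : S.η * scale S.m ≤ S.η * scale j := by
        have := hz.2.2.2.1
        have := scale_anti (show j ≤ S.m by omega)
        gcongr
      have h4 : S.η * scale j ≤ 1 * scale j := by gcongr; linarith
      linarith
  have h1 : 4 * scale j ≤ 8 * ((‖p - p'‖ + 2 * scale s) / c) := by linarith
  have hs0 := scale_pos s
  have h2 : 8 * ((‖p - p'‖ + 2 * scale s) / c) = 128 / (S.δ * S.η) * (‖p - p'‖ + 2 * scale s) := by
    rw [hc]; field_simp; norm_num
  have h3 : 128 / (S.δ * S.η) * (‖p - p'‖ + 2 * scale s) ≤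
      128 / (S.δ * S.η) * (2 * (‖p - p'‖ + scale s)) := by
    gcongr
    linarith [norm_nonneg (p - p')]
  have h4 : 128 / (S.δ * S.η) * (2 * (‖p - p'‖ + scale s)) =
      256 / (S.δ * S.η) * (‖p - p'‖ + scale s) := by ring
  linarith

/-- A selection of terminal points forming a Lipschitz graph at the scales of their
generations. -/
lemma exists_selection (hbad : 2 * volume.real S.bad ≤ volume.real S.base) :
    ∃ (P : Set (EuclideanSpace ℝ (Fin n))) (z : EuclideanSpace ℝ (Fin n) → ES n)
      (s : EuclideanSpace ℝ (Fin n) → ℤ),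
      (∀ p ∈ P, S.Term p (z p) (s p)) ∧ P ⊆ S.base ∧ volume.real S.base ≤ 4 * volume.real P ∧
      ∀ p ∈ P, ∀ p' ∈ P, dist (z p) (z p') ≤ 1024 / (S.δ * S.η) *
        (‖S.F.π (z p) - S.F.π (z p')‖ + scale (s p) + scale (s p')) := by
  have hlow := fun (p : EuclideanSpace ℝ (Fin n)) (h : p ∉ S.bad ∧ p ∈ S.base) =>
    S.exists_lowest h.1 h.2
  choose! z s hz hzc hzh hmin using hlow
  have key : ∀ P ⊆ S.base \ S.bad, (∀ p ∈ P, ∀ p' ∈ P,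
      |S.height (z p) - S.height (z p')| ≤ |(|S.height (z p)| - |S.height (z p')|)|) →
      ∀ p ∈ P, ∀ p' ∈ P, dist (z p) (z p') ≤ 1024 / (S.δ * S.η) *
        (‖S.F.π (z p) - S.F.π (z p')‖ + scale (s p) + scale (s p')) := by
    intro P hP hsign p hp p' hp'
    have h := hP hp
    have h' := hP hp'
    have h1 := S.abs_height_le_of_lowest h.2 h'.2 (hz p ⟨h.2, h.1⟩) (hzc p ⟨h.2, h.1⟩)
      (hzh p' ⟨h'.2, h'.1⟩) (hmin p' ⟨h'.2, h'.1⟩)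
    have h2 := S.abs_height_le_of_lowest h'.2 h.2 (hz p' ⟨h'.2, h'.1⟩) (hzc p' ⟨h'.2, h'.1⟩)
      (hzh p ⟨h.2, h.1⟩) (hmin p ⟨h.2, h.1⟩)
    rw [norm_sub_rev] at h2
    have hη := S.η_pos; have hδ := S.δ_pos; have hδ1 := S.δ_le; have hη1 := S.η_le
    have ha := S.a_le; have he := S.e_le_η; have he0 := S.e_pos
    set K := 256 / (S.δ * S.η) with hK
    have hK1 : 1 ≤ K := by
      rw [hK, le_div_iff₀ (by positivity)]
      nlinarith
    have hs := scale_pos (s p); have hs' := scale_pos (s p')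
    have h3 : |S.height (z p) - S.height (z p')| ≤ K * (‖p - p'‖ + scale (s p) + scale (s p')) := by
      refine (hsign p hp p' hp').trans (abs_le.2 ⟨?_, ?_⟩)
      · have : 0 < K * scale (s p') := by positivity
        linarith
      · have : 0 < K * scale (s p) := by positivity
        linarith
    have h4 := S.F.norm_le (z p - z p')
    rw [map_sub, ← dist_eq_norm] at h4
    have h5 : ⟪S.F.ν, z p - z p'⟫_ℝ = S.height (z p) - S.height (z p') := by
      rw [height, height, ← inner_sub_right]
      simp
    rw [h5] at h4
    have h6 := (hz p ⟨h.2, h.1⟩).2.2.2.2.2.2.1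
    have h7 := (hz p' ⟨h'.2, h'.1⟩).2.2.2.2.2.2.1
    have h8 : ‖p - p'‖ ≤ ‖S.F.π (z p) - S.F.π (z p')‖ + 2 * S.e * scale (s p) +
        2 * S.e * scale (s p') := by
      have e : p - p' = (S.F.π (z p) - S.F.π (z p')) - (S.F.π (z p) - p) +
        (S.F.π (z p') - p') := by abel
      rw [e]
      refine (norm_add_le _ _).trans ?_
      gcongr
      refine (norm_sub_le _ _).trans ?_
      gcongr
    have h9 : 2 * S.e ≤ 1 := by linarith
    have h10 : ‖p - p'‖ ≤ ‖S.F.π (z p) - S.F.π (z p')‖ + scale (s p) + scale (s p') := by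
      nlinarith
    set d := ‖S.F.π (z p) - S.F.π (z p')‖ + scale (s p) + scale (s p') with hd
    have hd0 := norm_nonneg (S.F.π (z p) - S.F.π (z p'))
    have h11 : K * (‖p - p'‖ + scale (s p) + scale (s p')) ≤ K * (2 * d) := by
      gcongr
      linarith
    have h12 : d ≤ K * d := le_mul_of_one_le_left (by positivity) hK1
    have h13 : 1024 / (S.δ * S.η) * d = 4 * (K * d) := by rw [hK]; ring
    rw [h13]
    linarith
  have hfin : ∀ A ⊆ S.base, volume A ≠ ⊤ := fun A hA =>
    (isBounded_ball.subset hA).measure_lt_top.ne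
  set P₁ := {p ∈ S.base \ S.bad | 0 ≤ S.height (z p)} with hP₁
  set P₂ := {p ∈ S.base \ S.bad | S.height (z p) < 0} with hP₂
  have h1 : S.base ⊆ S.bad ∪ (P₁ ∪ P₂) := by
    intro p hp
    by_cases hb : p ∈ S.bad
    · exact Or.inl hb
    · rcases le_or_gt 0 (S.height (z p)) with h | h
      · exact Or.inr (Or.inl ⟨⟨hp, hb⟩, h⟩)
      · exact Or.inr (Or.inr ⟨⟨hp, hb⟩, h⟩)
  have hP₁b : P₁ ⊆ S.base := fun p hp => hp.1.1
  have hP₂b : P₂ ⊆ S.base := fun p hp => hp.1.1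
  have h2 : volume.real S.base ≤ volume.real S.bad + (volume.real P₁ + volume.real P₂) := by
    refine (measureReal_mono h1 ?_).trans ((measureReal_union_le _ _).trans ?_)
    · exact measure_union_ne_top S.isBounded_bad.measure_lt_top.ne
        (measure_union_ne_top (hfin _ hP₁b) (hfin _ hP₂b))
    · gcongr
      exact measureReal_union_le _ _
  rcases le_total (volume.real P₂) (volume.real P₁) with h | h
  · refine ⟨P₁, z, s, fun p hp => hz p ⟨hp.1.2, hp.1.1⟩, hP₁b, by linarith,
      key P₁ (fun p hp => hp.1) fun p hp p' hp' => ?_⟩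
    rw [abs_of_nonneg hp.2, abs_of_nonneg hp'.2]
  · refine ⟨P₂, z, s, fun p hp => hz p ⟨hp.1.2, hp.1.1⟩, hP₂b, by linarith,
      key P₂ (fun p hp => hp.1) fun p hp p' hp' => ?_⟩
    rw [abs_of_neg hp.2, abs_of_neg hp'.2, abs_sub_comm, neg_sub_neg]

end StopData

namespace Nice

variable {n : ℕ} {E : Set (ES n)} {D : DyadicSystem n E} {Λ : ℝ}

lemma pos (h : Nice n E D Λ) : 0 < Λ := h.reg.pos

lemma center_mem_E (_h : Nice n E D Λ) {j : ℤ} {Q : Set (ES n)} (hQ : Q ∈ D.cubes j) :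
    D.center Q ∈ E := D.subset_E hQ (D.center_mem j Q hQ)

/-- A flat cube has a plane near each of its points, which stays close to `E`. -/
lemma exists_plane (h : Nice n E D Λ) {ε : ℝ} (hε : 0 < ε) (hεΛ : 2 * ε ≤ Λ⁻¹) {j : ℤ}
    {Q : Set (ES n)} (hQ : Q ∈ D.cubes j) (hB : LocalBAUP E D ε j Q) {y : ES n} (hy : y ∈ Q) :
    ∃ p μ : ES n, dist y p ≤ 2 * ε * scale j ∧ ‖μ‖ = 1 ∧
      ∀ z, ⟪μ, z - p⟫_ℝ = 0 → dist z p < 5 * Λ⁻¹ * scale j →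
        ∃ z' ∈ E, dist z z' ≤ 2 * ε * scale j := by
  obtain ⟨Ps, ⟨P₀, hP₀⟩, hhyp, h1, h2⟩ := hB
  have hj := scale_pos j
  have hdiam := h.diam_lower j Q hQ
  have hΛ := h.pos
  have hyd : dist y (D.center Q) ≤ diam Q :=
    dist_le_diam_of_mem (h.bounded hQ) hy (D.center_mem j Q hQ)
  have hdpos : 0 < diam Q := lt_of_lt_of_le (by positivity) hdiam
  have hne : (⋃₀ Ps).Nonempty := by
    obtain ⟨ν, b, hν, rfl⟩ := hhyp P₀ hP₀
    refine ⟨b • ν, _, hP₀, ?_⟩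
    simp [real_inner_smul_right, hν]
  have hlt : ε * 2 ^ (-j) < 2 * ε * scale j := by
    change ε * scale j < _
    have : 0 < ε * scale j := by positivity
    linarith
  have h3 := (h1 y ⟨D.subset_E hQ hy, by rw [mem_ball]; linarith⟩).trans_lt hlt
  obtain ⟨p, hp, hyp⟩ := (infDist_lt_iff hne).1 h3
  obtain ⟨P, hP, hpP⟩ := hp
  obtain ⟨μ, b, hμ, rfl⟩ := hhyp P hP
  refine ⟨p, μ, hyp.le, hμ, fun z hz hzp => ?_⟩
  have hzP : z ∈ {Z | ⟪μ, Z⟫_ℝ = b} := by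
    rw [inner_sub_right, sub_eq_zero] at hz
    exact hz.trans hpP
  have hzc : z ∈ ball (D.center Q) (10 * diam Q) := by
    rw [mem_ball]
    have h4 := dist_triangle4 z p y (D.center Q)
    rw [dist_comm p y] at h4
    have h5 : 2 * ε * scale j ≤ Λ⁻¹ * scale j := by gcongr
    linarith
  obtain ⟨z', hz', hd⟩ := (infDist_lt_iff ⟨_, h.center_mem_E hQ⟩).1
    ((h2 z ⟨⟨_, hP, hzP⟩, hzc⟩).trans_lt hlt)
  exact ⟨z', hz', hd.le⟩

/-- The stopping-time data started at a flat cube. -/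
lemma exists_stopData (h : Nice n E D Λ) {ε τ : ℝ} (hε : 0 < ε) (hτ : 0 < τ)
    (hετ : 256 * ε ≤ τ * τ) (hτΛ : 100 * τ ≤ Λ⁻¹) {k m : ℤ} (hkm : k < m) {T : Set (ES n)}
    (hT : T ∈ D.cubes k) (hB : LocalBAUP E D ε k T) :
    ∃ S : StopData n E, S.k = k ∧ S.m = m ∧ S.c = D.center T ∧ S.a = Λ⁻¹ ∧ S.e = 2 * ε ∧
      S.δ = τ ∧ S.η = τ ∧ S.good = fun j y => j < m ∧ LocalBAUP E D ε j (D.cubeAt j y) := by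
  have hΛ1 : Λ⁻¹ ≤ 1 := inv_le_one_of_one_le₀ h.reg.one_le
  have hεΛ : 2 * ε ≤ Λ⁻¹ := by nlinarith
  obtain ⟨p₀, ν, hp₀, hν, hplane⟩ := h.exists_plane hε hεΛ hT hB (D.center_mem k T hT)
  obtain ⟨F, rfl⟩ := exists_frame hν
  have hΛ := h.pos
  exact ⟨{
    F := F, k := k, m := m, c := D.center T, p₀ := p₀, a := Λ⁻¹, e := 2 * ε, δ := τ, η := τ
    good := fun j y => j < m ∧ LocalBAUP E D ε j (D.cubeAt j y)
    hkm := hkm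
    a_pos := by positivity
    a_le := hΛ1
    e_pos := by positivity
    δ_pos := hτ
    δ_le := by linarith
    η_pos := hτ
    η_le := hτΛ
    e_le := by linarith
    good_lt := fun j y hg => hg.1
    flat := fun j y hy hg => h.exists_plane hε hεΛ (D.cubeAt_mem j hy) hg.2 (D.mem_cubeAt j hy)
    good_k := fun z hz hzc => ⟨hkm, by
      rw [D.cubeAt_eq hT (h.inner k T hT ⟨hz, hzc⟩)]
      exact hB⟩
    dist_p₀ := hp₀
    start := hplane }, rfl, rfl, rfl, rfl, rfl, rfl, rfl, rfl⟩

/-- Below a flat cube one finds disjoint cubes which are bad or of the last generation, carry a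
definite proportion of the mass, and form a Lipschitz graph at their scales. -/
lemma exists_lipschitz_family (h : Nice n E D Λ) {ε₀ : ℝ} (hε₀ : 0 < ε₀) :
    ∃ ε η C : ℝ, 0 < ε ∧ ε < ε₀ ∧ 0 < η ∧ 1 ≤ C ∧ ∀ k m : ℤ, k < m → ∀ T ∈ D.cubes k,
      LocalBAUP E D ε k T →
      ∃ (π : ES n →ₗ[ℝ] EuclideanSpace ℝ (Fin n)) (s : Finset (ℤ × Set (ES n)))
        (z : ℤ × Set (ES n) → ES n),
        (∀ x, ‖π x‖ ≤ ‖x‖) ∧ s ⊆ D.pairs (k + 1) m T ∧ DisjPairs s ∧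
        (∀ p ∈ s, p.1 = m ∨ ¬ LocalBAUP E D ε p.1 p.2) ∧ (∀ p ∈ s, z p ∈ p.2) ∧
        η * (surfMeasure n E).real T ≤ ∑ p ∈ s, (surfMeasure n E).real p.2 ∧
        ∀ p ∈ s, ∀ q ∈ s, dist (z p) (z q) ≤
          C * (‖π (z p) - π (z q)‖ + scale p.1 + scale q.1) := by
  classical
  have hΛ := h.pos
  have hΛ1 := h.reg.one_le
  have hΛi : 0 < Λ⁻¹ := by positivity
  obtain ⟨C, hC, hbad⟩ := StopData.measure_bad_le n (Λ := Λ) hΛi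
  obtain ⟨Λv, hv⟩ := regularOn_volume n
  have hΛv := hv.pos
  obtain ⟨N, hN1, hN2⟩ : ∃ N : ℕ, 100 * ((2:ℝ)⁻¹ ^ N) ^ 2 ≤ Λ⁻¹ ∧
      2 * (C * (2⁻¹ ^ N * (2 * N + 7))) ≤ Λv⁻¹ * (Λ⁻¹ / 8) ^ n := by
    have t1 : Filter.Tendsto (fun N : ℕ => (2:ℝ)⁻¹ ^ N) Filter.atTop (nhds 0) :=
      tendsto_pow_atTop_nhds_zero_of_lt_one (by norm_num) (by norm_num)
    have t2 : Filter.Tendsto (fun N : ℕ => (N:ℝ) * (2:ℝ)⁻¹ ^ N) Filter.atTop (nhds 0) :=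
      tendsto_self_mul_const_pow_of_lt_one (by norm_num) (by norm_num)
    have t3 : Filter.Tendsto (fun N : ℕ => 100 * ((2:ℝ)⁻¹ ^ N) ^ 2) Filter.atTop (nhds 0) := by
      simpa using (t1.pow 2).const_mul 100
    have t4 : Filter.Tendsto (fun N : ℕ => 2 * (C * ((2:ℝ)⁻¹ ^ N * (2 * N + 7)))) Filter.atTop
        (nhds 0) := by
      have := ((t2.const_mul 2).add (t1.const_mul 7)).const_mul (2 * C)
      simp only [mul_zero, add_zero] at this
      refine this.congr fun N => ?_
      ring
    obtain ⟨N, hN⟩ := ((t3.eventually (gt_mem_nhds hΛi)).and (t4.eventually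
      (gt_mem_nhds (show 0 < Λv⁻¹ * (Λ⁻¹ / 8) ^ n by positivity)))).exists
    exact ⟨N, hN.1.le, hN.2.le⟩
  set τ : ℝ := (2⁻¹ ^ N) ^ 2 with hτ
  have hτ0 : 0 < τ := by positivity
  set ε := min (ε₀ / 2) (τ * τ / 256) with hε
  have hε0 : 0 < ε := by positivity
  have hετ : 256 * ε ≤ τ * τ := by
    have := min_le_right (ε₀ / 2) (τ * τ / 256)
    linarith
  refine ⟨ε, (4 * (Λv * (6 * Λ) ^ n * Λ))⁻¹ * (Λv⁻¹ * (Λ⁻¹ / 8) ^ n) * Λ⁻¹, 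
    max 1 ((1024 / (τ * τ)) * (2 * Λ) + 2 * Λ), hε0, ?_, by positivity, le_max_left _ _, ?_⟩
  · exact (min_le_left _ _).trans_lt (by linarith)
  intro k m hkm T hT hB
  obtain ⟨S, hSk, hSm, hSc, hSa, hSe, hSδ, hSη, hSg⟩ :=
    h.exists_stopData hε0 hτ0 hετ hN1 hkm hT hB
  have hk := scale_pos k
  have hbase : Λv⁻¹ * (Λ⁻¹ / 8) ^ n * scale k ^ n ≤ volume.real S.base := by
    rw [mul_assoc, ← mul_pow, StopData.base, hSa, hSk]
    exact hv.lower _ (mem_univ _) _ (by positivity)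
  obtain ⟨P, z, s, hterm, hPb, hPm, hexp⟩ := S.exists_selection (by
    have h1 := hbad E S N h.reg hSa hSδ hSη
    rw [hSk] at h1
    refine le_trans ?_ hbase
    calc 2 * volume.real S.bad ≤ 2 * (C * (2⁻¹ ^ N * (2 * N + 7))) * scale k ^ n := by linarith
      _ ≤ _ := by gcongr)
  rw [hSδ, hSη] at hexp
  have hTb := h.bounded hT
  set f : EuclideanSpace ℝ (Fin n) → ℤ × Set (ES n) := fun p => (s p, D.cubeAt (s p) (z p)) with hf
  have hfp : ∀ p ∈ P, f p ∈ D.pairs (k + 1) m T := by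
    intro p hp
    obtain ⟨hz, hzc, hs1, hs2, -⟩ := hterm p hp
    rw [hSc, hSa, hSk] at hzc
    rw [hSk] at hs1
    rw [hSm] at hs2
    rw [h.mem_pairs hTb]
    refine ⟨⟨by simp only [hf]; omega, hs2⟩, D.cubeAt_mem _ hz, ?_⟩
    exact D.subset_of_mem hs1.le (D.cubeAt_mem _ hz) hT (D.mem_cubeAt _ hz)
      (h.inner k T hT ⟨hz, hzc⟩)
  have hns : ∀ p ∈ P, s p = m ∨ ¬ LocalBAUP E D ε (s p) (D.cubeAt (s p) (z p)) := by
    intro p hp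
    obtain ⟨hz, -, hs1, hs2, -, hg, -⟩ := hterm p hp
    rw [hSg] at hg
    rw [hSm] at hs2
    by_contra! hcon
    exact hg ⟨lt_of_le_of_ne hs2 hcon.1, hcon.2⟩
  have hord : ∀ p ∈ P, ∀ q ∈ P, ∀ x, x ∈ (f p).2 → x ∈ (f q).2 → s q ≤ s p := by
    intro p hp q hq x hx hx'
    by_contra! hlt
    obtain ⟨hz, -, hs1, -, -, hg, -⟩ := hterm p hp
    obtain ⟨hz', -, hs1', -, hg', -⟩ := hterm q hq
    have h1 := hg' (s p) hs1.le hlt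
    have h2 := D.subset_of_mem hlt.le (D.cubeAt_mem _ hz') (D.cubeAt_mem _ hz) hx' hx
    rw [hSg] at h1 hg
    simp only at h1 hg
    rw [D.cubeAt_eq (D.cubeAt_mem _ hz) (h2 (D.mem_cubeAt _ hz'))] at h1
    exact hg h1
  set B := {R ∈ D.pairs (k + 1) m T | ∃ p ∈ P, f p = R} with hBdef
  have hmemB : ∀ R, R ∈ B ↔ ∃ p ∈ P, f p = R := by
    intro R
    rw [hBdef, Finset.mem_filter]
    exact ⟨fun h => h.2, fun ⟨p, hp, hR⟩ => ⟨hR ▸ hfp p hp, p, hp, hR⟩⟩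
  choose! r hrP hr using fun R (hR : R ∈ B) => (hmemB R).1 hR
  have hzR : ∀ R ∈ B, z (r R) ∈ R.2 := by
    intro R hR
    have h1 : D.cubeAt (s (r R)) (z (r R)) = R.2 := congrArg Prod.snd (hr R hR)
    exact h1.subset (D.mem_cubeAt (s (r R)) (hterm _ (hrP R hR)).1)
  have hsR : ∀ R ∈ B, s (r R) = R.1 := fun R hR => congrArg Prod.fst (hr R hR)
  refine ⟨S.F.π, B, fun R => z (r R), S.F.norm_π_le, Finset.filter_subset _ _, ?_, ?_, hzR, ?_, ?_⟩
  · intro R hR R' hR' x hx hx'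
    obtain ⟨p, hp, rfl⟩ := (hmemB R).1 hR
    obtain ⟨q, hq, rfl⟩ := (hmemB R').1 hR'
    have hs : s p = s q := le_antisymm (hord q hq p hp x hx' hx) (hord p hp q hq x hx hx')
    refine Prod.ext hs ?_
    have h1 := D.cubeAt_mem (s p) (hterm p hp).1
    have h2 : (f q).2 ∈ D.cubes (s p) := hs ▸ D.cubeAt_mem (s q) (hterm q hq).1
    exact D.eq_of_mem h1 h2 hx hx'
  · intro R hR
    obtain ⟨p, hp, rfl⟩ := (hmemB R).1 hR
    exact hns p hp
  · have hcov : P ⊆ ⋃ R ∈ B, ball (S.F.π (z (r R))) (3 * Λ * scale R.1) := by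
      intro p hp
      have hR : f p ∈ B := (hmemB _).2 ⟨p, hp, rfl⟩
      refine mem_iUnion₂.2 ⟨f p, hR, ?_⟩
      obtain ⟨hz, -, -, -, -, -, hπ, -⟩ := hterm p hp
      have h1 := h.dist_le (s p) _ (D.cubeAt_mem (s p) hz) _ (D.mem_cubeAt _ hz) _ (hzR _ hR)
      have h2 := S.F.norm_π_sub_le (z p) (z (r (f p)))
      have h3 := norm_sub_le_norm_sub_add_norm_sub p (S.F.π (z p)) (S.F.π (z (r (f p))))
      rw [norm_sub_rev p (S.F.π (z p))] at h3
      rw [mem_ball, dist_eq_norm]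
      have hs := scale_pos (s p)
      have h4 := S.e_le_η
      have h5 := S.η_le
      have h6 := S.a_le
      have h7 : 2 * S.e * scale (s p) ≤ 1 * scale (s p) := by gcongr; linarith
      have h8 : 1 * scale (s p) ≤ Λ * scale (s p) := by gcongr
      change _ < 3 * Λ * scale (s p)
      have : 0 < Λ * scale (s p) := by positivity
      linarith
    have hvol : volume.real P ≤ Λv * (6 * Λ) ^ n * Λ * ∑ R ∈ B, (surfMeasure n E).real R.2 := by
      calc volume.real P ≤ volume.real (⋃ R ∈ B, ball (S.F.π (z (r R))) (3 * Λ * scale R.1)) :=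
            measureReal_mono hcov ((Bornology.isBounded_biUnion_finset _).2 fun _ _ =>
              isBounded_ball).measure_lt_top.ne
        _ ≤ ∑ R ∈ B, volume.real (ball (S.F.π (z (r R))) (3 * Λ * scale R.1)) :=
            measureReal_biUnion_finset_le _ _
        _ ≤ ∑ R ∈ B, Λv * (6 * Λ) ^ n * Λ * (surfMeasure n E).real R.2 := by
            refine Finset.sum_le_sum fun R hR => ?_
            have hs := scale_pos R.1
            refine (hv.measure_ball_le _ (by positivity)).trans ?_
            have h1 := h.lower R.1 R.2 ((h.mem_pairs hTb).1 (Finset.mem_filter.1 hR).1).2.1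
            rw [inv_mul_le_iff₀ hΛ] at h1
            calc Λv * (2 * (3 * Λ * scale R.1)) ^ n = Λv * (6 * Λ) ^ n * scale R.1 ^ n := by
                  rw [show 2 * (3 * Λ * scale R.1) = 6 * Λ * scale R.1 by ring, mul_pow (6 * Λ)]
                  ring
              _ ≤ Λv * (6 * Λ) ^ n * (Λ * (surfMeasure n E).real R.2) := by gcongr
              _ = _ := by ring
        _ = _ := by rw [Finset.mul_sum]
    have h1 := h.upper k T hT
    set W := Λv * (6 * Λ) ^ n * Λ with hW
    have hW0 : 0 < W := by positivity
    have h2 : Λv⁻¹ * (Λ⁻¹ / 8) ^ n * scale k ^ n ≤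
        4 * (W * ∑ R ∈ B, (surfMeasure n E).real R.2) := by linarith
    calc (4 * W)⁻¹ * (Λv⁻¹ * (Λ⁻¹ / 8) ^ n) * Λ⁻¹ * (surfMeasure n E).real T
        ≤ (4 * W)⁻¹ * (Λv⁻¹ * (Λ⁻¹ / 8) ^ n) * Λ⁻¹ * (Λ * scale k ^ n) := by gcongr
      _ = (4 * W)⁻¹ * (Λv⁻¹ * (Λ⁻¹ / 8) ^ n * scale k ^ n) := by field_simp
      _ ≤ (4 * W)⁻¹ * (4 * (W * ∑ R ∈ B, (surfMeasure n E).real R.2)) := by gcongr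
      _ = _ := by field_simp
  · intro R hR R' hR'
    have h1 := hexp (r R) (hrP R hR) (r R') (hrP R' hR')
    rw [hsR R hR, hsR R' hR'] at h1
    refine h1.trans ?_
    have := scale_pos R.1; have := scale_pos R'.1
    gcongr
    refine le_trans ?_ (le_max_right _ _)
    have : 0 < 1024 / (τ * τ) := by positivity
    nlinarith

end Nice

/-- A subdivision scheme for cubes down to generation `m`: every cube of an earlier generation is
partitioned into smaller cubes, to which anchor points in `ℝ^n` are attached that control the
mutual distances. -/
structure Branching (n : ℕ) (E : Set (ES n)) (D : DyadicSystem n E) (m : ℤ) (C η ε : ℝ) where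
  K : ℤ × Set (ES n) → Finset (ℤ × Set (ES n))
  a : ℤ × Set (ES n) → ℤ × Set (ES n) → EuclideanSpace ℝ (Fin n)
  terminal : ∀ p, ¬ p.1 < m → K p = ∅
  subset_pairs : ∀ p, p.2 ∈ D.cubes p.1 → K p ⊆ D.pairs (p.1 + 1) m p.2
  disj : ∀ p, p.2 ∈ D.cubes p.1 → DisjPairs (K p)
  cover : ∀ p, p.1 < m → p.2 ∈ D.cubes p.1 → p.2 ⊆ ⋃ q ∈ K p, q.2
  norm_a_le : ∀ p, p.2 ∈ D.cubes p.1 → ∀ q ∈ K p, ‖a p q‖ ≤ C * scale p.1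
  dist_le : ∀ p, p.2 ∈ D.cubes p.1 → ∀ q ∈ K p, ∀ q' ∈ K p, ∀ x ∈ q.2, ∀ x' ∈ q'.2,
    dist x x' ≤ C * (‖a p q - a p q'‖ + scale q.1 + scale q'.1)
  many : ∀ p, p.1 < m → p.2 ∈ D.cubes p.1 → LocalBAUP E D ε p.1 p.2 →
    ∃ s ⊆ K p, (∀ q ∈ s, q.1 = m ∨ ¬ LocalBAUP E D ε q.1 q.2) ∧
      η * (surfMeasure n E).real p.2 ≤ ∑ q ∈ s, (surfMeasure n E).real q.2

namespace Nice

variable {n : ℕ} {E : Set (ES n)} {D : DyadicSystem n E} {Λ : ℝ}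

/-- Completing a disjoint family of subcubes to a partition. -/
lemma exists_partition (h : Nice n E D Λ) {k m : ℤ} (hkm : k < m) {T : Set (ES n)}
    (hT : T ∈ D.cubes k) {s : Finset (ℤ × Set (ES n))} (hs : s ⊆ D.pairs (k + 1) m T)
    (hd : DisjPairs s) (hne : s.Nonempty) :
    ∃ K : Finset (ℤ × Set (ES n)), s ⊆ K ∧ K ⊆ D.pairs (k + 1) m T ∧ DisjPairs K ∧
      T ⊆ ⋃ q ∈ K, q.2 ∧
      ∀ q ∈ K, ∃ p ∈ s, scale p.1 ≤ scale q.1 ∧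
        ∀ x ∈ q.2, ∀ y ∈ p.2, dist x y ≤ 2 * Λ * scale q.1 := by
  classical
  have hTb := h.bounded hT
  have hΛ := h.pos
  set F : Set (ES n) := ⋃ p ∈ s, p.2 with hF
  have hsmem : ∀ p ∈ s, (k + 1 ≤ p.1 ∧ p.1 ≤ m) ∧ p.2 ∈ D.cubes p.1 ∧ p.2 ⊆ T :=
    fun p hp => (h.mem_pairs hTb).1 (hs hp)
  have hTF : (T ∩ F).Nonempty := by
    obtain ⟨p, hp⟩ := hne
    have h1 := D.center_mem _ _ (hsmem p hp).2.1
    exact ⟨_, (hsmem p hp).2.2 h1, mem_iUnion₂.2 ⟨p, hp, h1⟩⟩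
  have hmax : ∀ q ∈ D.maxCubes k m T F, ((k + 1 ≤ q.1 ∧ q.1 ≤ m) ∧ q.2 ∈ D.cubes q.1 ∧ q.2 ⊆ T) ∧
      q.2 ∩ F = ∅ ∧ ∀ Q ∈ D.cubes (q.1 - 1), q.2 ⊆ Q → (Q ∩ F).Nonempty :=
    fun q hq => (h.mem_maxCubes hT).1 hq
  have hsF : ∀ p ∈ s, ∀ q ∈ D.maxCubes k m T F, ∀ x, x ∈ p.2 → x ∈ q.2 → False := by
    intro p hp q hq x hx hx'
    have h1 : x ∈ q.2 ∩ F := ⟨hx', mem_iUnion₂.2 ⟨p, hp, hx⟩⟩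
    rw [(hmax q hq).2.1] at h1
    exact h1
  refine ⟨s ∪ D.maxCubes k m T F, Finset.subset_union_left, ?_, ?_, ?_, ?_⟩
  · refine Finset.union_subset hs fun q hq => (h.mem_pairs hTb).2 (hmax q hq).1
  · intro p hp q hq x hx hx'
    rcases Finset.mem_union.1 hp with hp | hp <;> rcases Finset.mem_union.1 hq with hq | hq
    · exact hd p hp q hq x hx hx'
    · exact (hsF p hp q hq x hx hx').elim
    · exact (hsF q hq p hp x hx' hx).elim
    · exact h.disjPairs_maxCubes hT p hp q hq x hx hx'
  · intro x hx
    have hxE := D.subset_E hT hx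
    have hQ := D.cubeAt_mem m hxE
    have hxQ := D.mem_cubeAt m hxE
    by_cases hQF : D.cubeAt m x ∩ F = ∅
    · obtain ⟨p, hp, h1, -⟩ := h.exists_maxCube hT hTF hkm.le le_rfl hQ
        (D.subset_of_mem hkm.le hQ hT hxQ hx) hQF
      exact mem_iUnion₂.2 ⟨p, Finset.mem_union_right _ hp, h1 hxQ⟩
    · obtain ⟨y, hy, hyF⟩ := Set.nonempty_iff_ne_empty.2 hQF
      obtain ⟨p, hp, hyp⟩ := mem_iUnion₂.1 hyF
      exact mem_iUnion₂.2 ⟨p, Finset.mem_union_left _ hp,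
        D.subset_of_mem (hsmem p hp).1.2 hQ (hsmem p hp).2.1 hy hyp hxQ⟩
  · intro q hq
    rcases Finset.mem_union.1 hq with hq | hq
    · refine ⟨q, hq, le_rfl, fun x hx y hy => ?_⟩
      have h1 := h.dist_le _ _ (hsmem q hq).2.1 x hx y hy
      have := scale_pos q.1
      have : 0 < Λ * scale q.1 := by positivity
      linarith
    · obtain ⟨⟨-, hqc, hqT⟩, hqF, hpar⟩ := hmax q hq
      have hcq := D.center_mem _ _ hqc
      have hcE := D.subset_E hqc hcq
      have hPc := D.cubeAt_mem (q.1 - 1) hcE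
      have hcP := D.mem_cubeAt (q.1 - 1) hcE
      have hqP := D.subset_of_mem (by omega) hqc hPc hcq hcP
      obtain ⟨y, hyP, hyF⟩ := hpar _ hPc hqP
      obtain ⟨p, hp, hyp⟩ := mem_iUnion₂.1 hyF
      have hlt : q.1 - 1 < p.1 := by
        by_contra! hle
        exact hsF p hp q hq _
          (D.subset_of_mem hle hPc (hsmem p hp).2.1 hyP hyp hcP) hcq
      have hpP := D.subset_of_mem hlt.le (hsmem p hp).2.1 hPc hyp hyP
      refine ⟨p, hp, scale_anti (by omega), fun x hx y hy => ?_⟩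
      have h1 := h.dist_le _ _ hPc x (hqP hx) y (hpP hy)
      have h2 := scale_succ (q.1 - 1)
      rw [sub_add_cancel] at h2
      have h3 : scale (q.1 - 1) = 2 * scale q.1 := by linarith
      rw [h3] at h1
      linarith

lemma exists_branching (h : Nice n E D Λ) {ε₀ : ℝ} (hε₀ : 0 < ε₀) :
    ∃ ε η C : ℝ, 0 < ε ∧ ε < ε₀ ∧ 0 < η ∧ 1 ≤ C ∧ Λ ≤ C ∧
      ∀ m : ℤ, Nonempty (Branching n E D m C η ε) := by
  classical
  obtain ⟨ε, η, C, hε, hεε₀, hη, hC, hfam⟩ := h.exists_lipschitz_family hε₀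
  have hΛ1 := h.reg.one_le
  refine ⟨ε, η, 2 * Λ + C, hε, hεε₀, hη, by linarith, by linarith, fun m => ?_⟩
  have key : ∀ p : ℤ × Set (ES n), ∃ (K : Finset (ℤ × Set (ES n)))
      (a : ℤ × Set (ES n) → EuclideanSpace ℝ (Fin n)), (¬ p.1 < m → K = ∅) ∧
      (p.2 ∈ D.cubes p.1 → K ⊆ D.pairs (p.1 + 1) m p.2 ∧ DisjPairs K ∧
        (p.1 < m → p.2 ⊆ ⋃ q ∈ K, q.2) ∧ (∀ q ∈ K, ‖a q‖ ≤ (2 * Λ + C) * scale p.1) ∧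
        (∀ q ∈ K, ∀ q' ∈ K, ∀ x ∈ q.2, ∀ x' ∈ q'.2,
          dist x x' ≤ (2 * Λ + C) * (‖a q - a q'‖ + scale q.1 + scale q'.1)) ∧
        (p.1 < m → LocalBAUP E D ε p.1 p.2 →
          ∃ s ⊆ K, (∀ q ∈ s, q.1 = m ∨ ¬ LocalBAUP E D ε q.1 q.2) ∧
            η * (surfMeasure n E).real p.2 ≤ ∑ q ∈ s, (surfMeasure n E).real q.2)) := by
    rintro ⟨k, T⟩
    by_cases hkm : k < m
    swap
    · refine ⟨∅, 0, fun _ => rfl, fun _ => ⟨by simp, by simp [DisjPairs], fun h' => (hkm h').elim,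
        by simp, by simp, fun h' => (hkm h').elim⟩⟩
    by_cases hT : T ∈ D.cubes k
    swap
    · exact ⟨∅, 0, fun _ => rfl, fun h' => (hT h').elim⟩
    have hTb := h.bounded hT
    have hk := scale_pos k
    by_cases hB : LocalBAUP E D ε k T
    · obtain ⟨π, s, z, hπ, hs, hd, hns, hz, hmass, hsep⟩ := hfam k m hkm T hT hB
      have hne : s.Nonempty := by
        by_contra hcon
        rw [Finset.not_nonempty_iff_eq_empty] at hcon
        rw [hcon, Finset.sum_empty] at hmass
        have := mul_pos hη (h.measure_pos hT)
        linarith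
      obtain ⟨K, hsK, hK, hdK, hcov, hrep⟩ := h.exists_partition hkm hT hs hd hne
      choose! r hr hr1 hr2 using hrep
      refine ⟨K, fun q => π (z (r q)) - π (D.center T), fun h' => (h' hkm).elim, fun _ =>
        ⟨hK, hdK, fun _ => hcov, ?_, ?_, fun _ _ => ⟨s, hsK, hns, hmass⟩⟩⟩
      · intro q hq
        change ‖π (z (r q)) - π (D.center T)‖ ≤ (2 * Λ + C) * scale k
        rw [← map_sub]
        refine (hπ _).trans ?_
        rw [← dist_eq_norm]
        have h1 : z (r q) ∈ T := ((h.mem_pairs hTb).1 (hs (hr q hq))).2.2 (hz _ (hr q hq))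
        refine (h.dist_le k T hT _ h1 _ (D.center_mem k T hT)).trans ?_
        gcongr
        linarith
      · intro q hq q' hq' x hx x' hx'
        rw [sub_sub_sub_cancel_right]
        have h1 := hr2 q hq x hx _ (hz _ (hr q hq))
        have h2 := hr2 q' hq' x' hx' _ (hz _ (hr q' hq'))
        have h3 := hsep _ (hr q hq) _ (hr q' hq')
        have h4 := hr1 q hq
        have h5 := hr1 q' hq'
        have h6 := dist_triangle4 x (z (r q)) (z (r q')) x'
        rw [dist_comm (z (r q')) x'] at h6
        have h7 := norm_nonneg (π (z (r q)) - π (z (r q')))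
        have h8 : C * (‖π (z (r q)) - π (z (r q'))‖ + scale (r q).1 + scale (r q').1) ≤
            C * (‖π (z (r q)) - π (z (r q'))‖ + scale q.1 + scale q'.1) := by gcongr
        have h9 : 0 ≤ 2 * Λ * ‖π (z (r q)) - π (z (r q'))‖ := by positivity
        calc dist x x' ≤ 2 * Λ * scale q.1 +
              C * (‖π (z (r q)) - π (z (r q'))‖ + scale q.1 + scale q'.1) +
              2 * Λ * scale q'.1 := by linarith
          _ ≤ _ := by linarith
    · refine ⟨D.pairs (k + 1) (k + 1) T, 0, fun h' => (h' hkm).elim, fun _ =>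
        ⟨?_, ?_, fun _ => ?_, ?_, ?_, fun _ hB' => (hB hB').elim⟩⟩
      · intro q hq
        rw [h.mem_pairs hTb] at hq ⊢
        exact ⟨⟨hq.1.1, by have := hq.1.2; omega⟩, hq.2⟩
      · intro q hq q' hq' x hx hx'
        rw [h.mem_pairs hTb] at hq hq'
        have h1 : q.1 = q'.1 := by omega
        exact Prod.ext h1 (D.eq_of_mem hq.2.1 (h1 ▸ hq'.2.1) hx hx')
      · intro x hx
        have hxE := D.subset_E hT hx
        refine mem_iUnion₂.2 ⟨(k + 1, D.cubeAt (k + 1) x), (h.mem_pairs hTb).2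
          ⟨⟨le_rfl, le_rfl⟩, D.cubeAt_mem _ hxE, ?_⟩, D.mem_cubeAt _ hxE⟩
        exact D.subset_of_mem (by omega) (D.cubeAt_mem _ hxE) hT (D.mem_cubeAt _ hxE) hx
      · intro q _
        simp only [Pi.zero_apply, norm_zero]
        positivity
      · intro q hq q' hq' x hx x' hx'
        rw [h.mem_pairs hTb] at hq hq'
        have h1 : q.1 = k + 1 := by omega
        have h2 : q'.1 = k + 1 := by omega
        have h3 := h.dist_le k T hT x (hq.2.2 hx) x' (hq'.2.2 hx')
        simp only [Pi.zero_apply, sub_zero, norm_zero]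
        rw [h1, h2, scale_succ]
        have : 0 ≤ C * scale k := by positivity
        have : 0 ≤ Λ * scale k := by positivity
        linarith
  choose K a h1 h2 using key
  exact ⟨⟨K, a, h1, fun p hp => (h2 p hp).1, fun p hp => (h2 p hp).2.1,
    fun p hm hp => (h2 p hp).2.2.1 hm, fun p hp => (h2 p hp).2.2.2.1,
    fun p hp => (h2 p hp).2.2.2.2.1, fun p hm hp => (h2 p hp).2.2.2.2.2 hm⟩⟩

end Nice

namespace Branching

variable {n : ℕ} {E : Set (ES n)} {D : DyadicSystem n E} {Λ C η ε : ℝ} {m : ℤ}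

lemma mem_K (h : Nice n E D Λ) (B : Branching n E D m C η ε) {p q : ℤ × Set (ES n)}
    (hp : p.2 ∈ D.cubes p.1) (hq : q ∈ B.K p) :
    (p.1 + 1 ≤ q.1 ∧ q.1 ≤ m) ∧ q.2 ∈ D.cubes q.1 ∧ q.2 ⊆ p.2 :=
  (h.mem_pairs (h.bounded hp)).1 (B.subset_pairs p hp hq)

lemma sum_K (h : Nice n E D Λ) (B : Branching n E D m C η ε) {p : ℤ × Set (ES n)}
    (hp : p.2 ∈ D.cubes p.1) (hpm : p.1 < m) :
    ∑ q ∈ B.K p, (surfMeasure n E).real q.2 = (surfMeasure n E).real p.2 := by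
  rw [h.sum_measure_eq (fun q hq => (B.mem_K h hp hq).2.1) (B.disj p hp)]
  congr 1
  exact (iUnion₂_subset fun q hq => (B.mem_K h hp hq).2.2).antisymm (B.cover p hpm hp)

/-- The total measure of the first `N` layers of the scheme below a cube. -/
def layers (B : Branching n E D m C η ε) : ℕ → ℤ × Set (ES n) → ℝ
  | 0, p => (surfMeasure n E).real p.2
  | N + 1, p => (surfMeasure n E).real p.2 + ∑ q ∈ B.K p, B.layers N q

open Classical in
/-- The total measure of the subcubes of generation less than `m` which are not flat. -/
def badSum (_ : Branching n E D m C η ε) (p : ℤ × Set (ES n)) : ℝ :=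
  ∑ q ∈ D.pairs p.1 (m - 1) p.2 with ¬ LocalBAUP E D ε q.1 q.2, (surfMeasure n E).real q.2

lemma layers_nonneg (B : Branching n E D m C η ε) (N : ℕ) (p : ℤ × Set (ES n)) :
    0 ≤ B.layers N p := by
  induction N generalizing p with
  | zero => exact measureReal_nonneg
  | succ N ih =>
    rw [layers]
    have := Finset.sum_nonneg fun q (_ : q ∈ B.K p) => ih q
    have : 0 ≤ (surfMeasure n E).real p.2 := measureReal_nonneg
    linarith

lemma badSum_nonneg (B : Branching n E D m C η ε) (p : ℤ × Set (ES n)) : 0 ≤ B.badSum p :=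
  Finset.sum_nonneg fun _ _ => measureReal_nonneg

lemma badSum_step (h : Nice n E D Λ) (B : Branching n E D m C η ε) {p : ℤ × Set (ES n)}
    (hp : p.2 ∈ D.cubes p.1) (hpm : p.1 < m) :
    ∑ q ∈ B.K p, B.badSum q ≤ B.badSum p ∧
    (¬ LocalBAUP E D ε p.1 p.2 →
      (surfMeasure n E).real p.2 + ∑ q ∈ B.K p, B.badSum q ≤ B.badSum p) := by
  classical
  have hpb := h.bounded hp
  set S : ℤ × Set (ES n) → Finset (ℤ × Set (ES n)) := fun q =>
    {q' ∈ D.pairs q.1 (m - 1) q.2 | ¬ LocalBAUP E D ε q'.1 q'.2} with hS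
  have hmem : ∀ q, q.2 ∈ D.cubes q.1 → ∀ q', q' ∈ S q ↔
      ((q.1 ≤ q'.1 ∧ q'.1 ≤ m - 1) ∧ q'.2 ∈ D.cubes q'.1 ∧ q'.2 ⊆ q.2) ∧
        ¬ LocalBAUP E D ε q'.1 q'.2 := by
    intro q hq q'
    simp only [hS, Finset.mem_filter, h.mem_pairs (h.bounded hq)]
  have hdisj : Set.PairwiseDisjoint (↑(B.K p)) S := by
    intro q hq q' hq' hne
    refine Finset.disjoint_left.2 fun r hr hr' => hne ?_
    have h1 := (hmem q (B.mem_K h hp hq).2.1 r).1 hr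
    have h2 := (hmem q' (B.mem_K h hp hq').2.1 r).1 hr'
    have h3 := D.center_mem _ _ h1.1.2.1
    exact B.disj p hp q hq q' hq' _ (h1.1.2.2 h3) (h2.1.2.2 h3)
  have hsum : ∑ q ∈ B.K p, B.badSum q =
      ∑ q ∈ (B.K p).biUnion S, (surfMeasure n E).real q.2 := by
    rw [Finset.sum_biUnion hdisj]
    refine Finset.sum_congr rfl fun q _ => ?_
    rw [badSum]
  have hbp : B.badSum p = ∑ q ∈ S p, (surfMeasure n E).real q.2 := by
    rw [badSum]
  have hsub : ∀ r ∈ (B.K p).biUnion S, r ∈ S p ∧ p.1 < r.1 := by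
    intro r hr
    obtain ⟨q, hq, hrq⟩ := Finset.mem_biUnion.1 hr
    have h1 := B.mem_K h hp hq
    have h2 := (hmem q h1.2.1 r).1 hrq
    exact ⟨(hmem p hp r).2 ⟨⟨⟨by omega, h2.1.1.2⟩, h2.1.2.1, h2.1.2.2.trans h1.2.2⟩, h2.2⟩,
      by omega⟩
  rw [hsum, hbp]
  refine ⟨Finset.sum_le_sum_of_subset_of_nonneg (fun r hr => (hsub r hr).1)
    fun _ _ _ => measureReal_nonneg, fun hbad => ?_⟩
  have hnot : p ∉ (B.K p).biUnion S := fun hcon => lt_irrefl _ (hsub p hcon).2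
  refine (Finset.sum_insert (f := fun q : ℤ × Set (ES n) => (surfMeasure n E).real q.2)
    hnot).symm.trans_le ?_
  refine Finset.sum_le_sum_of_subset_of_nonneg (Finset.insert_subset ?_
    fun r hr => (hsub r hr).1) fun _ _ _ => measureReal_nonneg
  exact (hmem p hp p).2 ⟨⟨⟨le_rfl, by omega⟩, hp, subset_rfl⟩, hbad⟩

lemma layers_le (h : Nice n E D Λ) (B : Branching n E D m C η ε) (hη : 0 < η) (N : ℕ) :
    ∀ p : ℤ × Set (ES n), p.2 ∈ D.cubes p.1 → p.1 ≤ m →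
      B.layers N p ≤ (1 + η⁻¹) * ((surfMeasure n E).real p.2 + B.badSum p) ∧
      (p.1 = m ∨ ¬ LocalBAUP E D ε p.1 p.2 →
        B.layers N p ≤ (surfMeasure n E).real p.2 + (1 + η⁻¹) * B.badSum p) := by
  classical
  have hη' : 0 < η⁻¹ := by positivity
  induction N with
  | zero =>
    intro p hp hpm
    have h1 : 0 ≤ (surfMeasure n E).real p.2 := measureReal_nonneg
    have h2 := B.badSum_nonneg p
    have h3 : 0 ≤ (1 + η⁻¹) * B.badSum p := by positivity
    have h4 : 0 ≤ η⁻¹ * (surfMeasure n E).real p.2 := by positivity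
    rw [layers]
    exact ⟨by linarith, fun _ => by linarith⟩
  | succ N ih =>
    intro p hp hpm
    have h1 : 0 ≤ (surfMeasure n E).real p.2 := measureReal_nonneg
    have h2 := B.badSum_nonneg p
    have h3 : 0 ≤ (1 + η⁻¹) * B.badSum p := by positivity
    have h4 : 0 ≤ η⁻¹ * (surfMeasure n E).real p.2 := by positivity
    rw [layers]
    by_cases hlt : p.1 < m
    swap
    · rw [B.terminal p hlt, Finset.sum_empty]
      exact ⟨by linarith, fun _ => by linarith⟩
    obtain ⟨hb1, hb2⟩ := B.badSum_step h hp hlt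
    have hK := B.sum_K h hp hlt
    have hall : ∀ q ∈ B.K p,
        B.layers N q ≤ (1 + η⁻¹) * ((surfMeasure n E).real q.2 + B.badSum q) :=
      fun q hq => (ih q (B.mem_K h hp hq).2.1 (B.mem_K h hp hq).1.2).1
    have hsum : ∑ q ∈ B.K p, B.layers N q ≤
        (1 + η⁻¹) * ((surfMeasure n E).real p.2 + ∑ q ∈ B.K p, B.badSum q) := by
      refine (Finset.sum_le_sum hall).trans_eq ?_
      rw [← Finset.mul_sum, Finset.sum_add_distrib, hK]
    by_cases hbad : LocalBAUP E D ε p.1 p.2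
    swap
    · have hs := hb2 hbad
      have h5 := mul_le_mul_of_nonneg_left hs (show 0 ≤ 1 + η⁻¹ by positivity)
      exact ⟨by linarith, fun _ => by linarith⟩
    · refine ⟨?_, fun h' => h'.elim (fun h' => absurd h' hlt.ne) fun h' => absurd hbad h'⟩
      obtain ⟨s, hsK, hs, hmass⟩ := B.many p hlt hp hbad
      have hgood : ∀ q ∈ B.K p, B.layers N q ≤
          (1 + η⁻¹) * ((surfMeasure n E).real q.2 + B.badSum q) -
            if q ∈ s then η⁻¹ * (surfMeasure n E).real q.2 else 0 := by
        intro q hq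
        by_cases hqs : q ∈ s
        · rw [if_pos hqs]
          have := (ih q (B.mem_K h hp hq).2.1 (B.mem_K h hp hq).1.2).2 (hs q hqs)
          linarith
        · rw [if_neg hqs, sub_zero]
          exact hall q hq
      have h6 := Finset.sum_le_sum hgood
      rw [Finset.sum_sub_distrib, ← Finset.mul_sum, Finset.sum_add_distrib, hK,
        Finset.sum_ite_mem, Finset.inter_eq_right.2 hsK, ← Finset.mul_sum] at h6
      have h7 := mul_le_mul_of_nonneg_left hmass hη'.le
      rw [← mul_assoc, inv_mul_cancel₀ hη.ne', one_mul] at h7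
      have h8 := mul_le_mul_of_nonneg_left hb1 (show 0 ≤ 1 + η⁻¹ by positivity)
      linarith

end Branching

/-- Greedy colouring: if every element conflicts with at most `N` elements of smaller or equal
rank, then `N + 1` colours suffice. -/
lemma exists_coloring {α : Type*} [DecidableEq α] (key : α → ℤ) (r : α → α → Prop)
    [DecidableRel r] (hr : ∀ a b, r a b → r b a) (N : ℕ) (s : Finset α)
    (hs : ∀ a ∈ s, ({b ∈ s | b ≠ a ∧ key b ≤ key a ∧ r a b} : Finset α).card ≤ N) :
    ∃ col : α → Fin (N + 1), ∀ a ∈ s, ∀ b ∈ s, a ≠ b → r a b → col a ≠ col b := by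
  induction s using Finset.induction_on_max_value key with
  | empty => exact ⟨fun _ => 0, by simp⟩
  | insert a s ha hmax ih =>
    obtain ⟨col, hcol⟩ := ih fun b hb => (Finset.card_le_card (Finset.filter_subset_filter _
      (Finset.subset_insert a s))).trans (hs b (Finset.mem_insert_of_mem hb))
    set X : Finset α := {b ∈ s | r a b} with hX
    have hXcard : X.card ≤ N := by
      refine (Finset.card_le_card fun b hb => ?_).trans (hs a (Finset.mem_insert_self a s))
      rw [hX, Finset.mem_filter] at hb
      rw [Finset.mem_filter]
      exact ⟨Finset.mem_insert_of_mem hb.1, fun hab => ha (hab ▸ hb.1), hmax b hb.1, hb.2⟩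
    obtain ⟨c, hc⟩ : ∃ c : Fin (N + 1), c ∉ X.image col := by
      by_contra! hcon
      have h1 : (Finset.univ : Finset (Fin (N + 1))).card ≤ (X.image col).card :=
        Finset.card_le_card fun c _ => hcon c
      rw [Finset.card_univ, Fintype.card_fin] at h1
      have := Finset.card_image_le (s := X) (f := col)
      omega
    have hne : ∀ b ∈ s, r a b → c ≠ col b := by
      intro b hb hab hcb
      exact hc (Finset.mem_image.2 ⟨b, Finset.mem_filter.2 ⟨hb, hab⟩, hcb.symm⟩)
    have hba : ∀ b ∈ s, b ≠ a := fun b hb hab => ha (hab ▸ hb)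
    refine ⟨Function.update col a c, fun b hb b' hb' hbb hrb => ?_⟩
    rcases Finset.mem_insert.1 hb with h1 | h1 <;> rcases Finset.mem_insert.1 hb' with h2 | h2
    · exact (hbb (h1.trans h2.symm)).elim
    · rw [h1, Function.update_self, Function.update_of_ne (hba b' h2)]
      exact hne b' h2 (h1 ▸ hrb)
    · rw [h2, Function.update_self, Function.update_of_ne (hba b h1)]
      exact (hne b h1 (hr _ _ (h2 ▸ hrb))).symm
    · rw [Function.update_of_ne (hba b' h2), Function.update_of_ne (hba b h1)]
      exact hcol b h1 b' h2 hbb hrb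

/-- Some colour class carries its share of the total weight. -/
lemma exists_heavy_color {α : Type*} (s : Finset α) (N : ℕ) (col : α → Fin (N + 1))
    (f : α → ℝ) : ∃ c, ∑ a ∈ s, f a ≤ (N + 1) * ∑ a ∈ s with col a = c, f a := by
  by_contra! hcon
  have h1 : ∑ c : Fin (N + 1), ((N + 1 : ℝ) * ∑ a ∈ s with col a = c, f a) <
      ∑ _c : Fin (N + 1), ∑ a ∈ s, f a :=
    Finset.sum_lt_sum_of_nonempty Finset.univ_nonempty fun c _ => hcon c
  rw [← Finset.mul_sum, Finset.sum_fiberwise, Finset.sum_const, Finset.card_univ,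
    Fintype.card_fin, nsmul_eq_mul] at h1
  push_cast at h1
  exact lt_irrefl _ h1

namespace Branching

variable {n : ℕ} {E : Set (ES n)} {D : DyadicSystem n E} {Λ C η ε : ℝ} {m : ℤ}

/-- Two pieces of the scheme conflict if their anchors are closer than the larger scale. -/
def Conflict (B : Branching n E D m C η ε) (p q q' : ℤ × Set (ES n)) : Prop :=
  ‖B.a p q - B.a p q'‖ < 2 * C * max (scale q.1) (scale q'.1)

lemma Conflict.symm {B : Branching n E D m C η ε} {p q q' : ℤ × Set (ES n)}
    (hc : B.Conflict p q q') : B.Conflict p q' q := by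
  rw [Conflict, norm_sub_rev, max_comm]
  exact hc

open Classical in
/-- The number of larger pieces a given piece conflicts with. -/
def conflicts (B : Branching n E D m C η ε) (p q : ℤ × Set (ES n)) : ℕ :=
  ({q' ∈ B.K p | q' ≠ q ∧ q'.1 ≤ q.1 ∧ B.Conflict p q q'} : Finset _).card

/-- The pieces with at most `M` conflicts. -/
def sparse (B : Branching n E D m C η ε) (M : ℕ) (p : ℤ × Set (ES n)) :
    Finset (ℤ × Set (ES n)) :=
  {q ∈ B.K p | B.conflicts p q ≤ M}

lemma sum_conflicts_le (h : Nice n E D Λ) (B : Branching n E D m C η ε) (hC : 1 ≤ C)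
    {p : ℤ × Set (ES n)} (hp : p.2 ∈ D.cubes p.1) (hpm : p.1 < m) :
    ∑ q ∈ B.K p, (B.conflicts p q : ℝ) * (surfMeasure n E).real q.2 ≤
      Λ ^ 2 * (2 * (C * (2 * C + 3))) ^ n * (surfMeasure n E).real p.2 := by
  classical
  have hΛ := h.pos
  set R := C * (2 * C + 3) with hR
  have hRpos : 0 < R := by positivity
  have hswap : ∑ q ∈ B.K p, (B.conflicts p q : ℝ) * (surfMeasure n E).real q.2 =
      ∑ q' ∈ B.K p, ∑ q ∈ B.K p with q' ≠ q ∧ q'.1 ≤ q.1 ∧ B.Conflict p q q',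
        (surfMeasure n E).real q.2 := by
    simp only [Finset.sum_filter]
    rw [Finset.sum_comm]
    refine Finset.sum_congr rfl fun q _ => ?_
    rw [← Finset.sum_filter, Finset.sum_const, nsmul_eq_mul, conflicts]
  rw [hswap, ← B.sum_K h hp hpm, Finset.mul_sum]
  refine Finset.sum_le_sum fun q' hq' => ?_
  have hq'c := (B.mem_K h hp hq').2.1
  have hs := scale_pos q'.1
  have h1 : ∑ q ∈ B.K p with q' ≠ q ∧ q'.1 ≤ q.1 ∧ B.Conflict p q q',
      (surfMeasure n E).real q.2 ≤
        (surfMeasure n E).real (ball (D.center q'.2) (R * scale q'.1)) := by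
    refine h.sum_measure_le (fun q hq => (B.mem_K h hp (Finset.mem_filter.1 hq).1).2.1)
      (fun q hq r hr => B.disj p hp q (Finset.mem_filter.1 hq).1 r (Finset.mem_filter.1 hr).1)
      (fun q hq x hx => ?_) (h.reg.measure_ball_ne_top _ _)
    obtain ⟨hq, -, hle, hconf⟩ := Finset.mem_filter.1 hq
    have h2 := B.dist_le p hp q hq q' hq' x hx _ (D.center_mem _ _ hq'c)
    have h3 := scale_anti hle
    rw [Conflict, max_eq_right h3] at hconf
    refine lt_of_le_of_lt h2 ?_
    rw [hR, mul_assoc]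
    refine mul_lt_mul_of_pos_left ?_ (by linarith)
    linarith
  refine h1.trans ((h.reg.measure_ball_le _ (by positivity)).trans ?_)
  have h4 := h.lower _ _ hq'c
  have h5 : scale q'.1 ^ n ≤ Λ * (surfMeasure n E).real q'.2 := by
    have := mul_le_mul_of_nonneg_left h4 hΛ.le
    rwa [← mul_assoc, mul_inv_cancel₀ hΛ.ne', one_mul] at this
  calc Λ * (2 * (R * scale q'.1)) ^ n = Λ * (2 * R) ^ n * scale q'.1 ^ n := by
        rw [← mul_assoc 2, mul_pow (2 * R)]; ring
    _ ≤ Λ * (2 * R) ^ n * (Λ * (surfMeasure n E).real q'.2) := by gcongr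
    _ = _ := by ring

lemma sum_crowded_le (h : Nice n E D Λ) (B : Branching n E D m C η ε) (hC : 1 ≤ C) (M : ℕ)
    {p : ℤ × Set (ES n)} (hp : p.2 ∈ D.cubes p.1) (hpm : p.1 < m) :
    (surfMeasure n E).real p.2 - ∑ q ∈ B.sparse M p, (surfMeasure n E).real q.2 ≤
      Λ ^ 2 * (2 * (C * (2 * C + 3))) ^ n / (M + 1) * (surfMeasure n E).real p.2 := by
  have h1 := B.sum_conflicts_le h hC hp hpm
  have h2 := Finset.sum_filter_add_sum_filter_not (B.K p) (fun q => B.conflicts p q ≤ M)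
    fun q => (surfMeasure n E).real q.2
  rw [B.sum_K h hp hpm] at h2
  have h3 : ∑ q ∈ B.K p with ¬ B.conflicts p q ≤ M, (M + 1 : ℝ) * (surfMeasure n E).real q.2 ≤
      ∑ q ∈ B.K p, (B.conflicts p q : ℝ) * (surfMeasure n E).real q.2 := by
    refine (Finset.sum_le_sum fun q hq => ?_).trans (Finset.sum_le_sum_of_subset_of_nonneg
      (Finset.filter_subset _ _) fun q _ _ => by positivity)
    have : (M + 1 : ℕ) ≤ B.conflicts p q := by
      have := (Finset.mem_filter.1 hq).2
      omega
    have : (M + 1 : ℝ) ≤ B.conflicts p q := by exact_mod_cast this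
    gcongr
  rw [← Finset.mul_sum] at h3
  rw [div_mul_eq_mul_div, le_div_iff₀ (by positivity), sparse]
  calc _ = (M + 1 : ℝ) *
        ∑ q ∈ B.K p with ¬ B.conflicts p q ≤ M, (surfMeasure n E).real q.2 := by
        rw [← h2]; ring
    _ ≤ _ := h3.trans h1

open Classical in
/-- The measure which survives when only sparse pieces are kept, in at most `N` rounds. -/
def survive (B : Branching n E D m C η ε) (M : ℕ) : ℕ → ℤ × Set (ES n) → ℝ
  | 0, p => if p.1 < m then 0 else (surfMeasure n E).real p.2
  | N + 1, p => if p.1 < m then ∑ q ∈ B.sparse M p, B.survive M N q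
      else (surfMeasure n E).real p.2

lemma survive_of_not_lt (B : Branching n E D m C η ε) (M N : ℕ) {p : ℤ × Set (ES n)}
    (hp : ¬ p.1 < m) : B.survive M N p = (surfMeasure n E).real p.2 := by
  cases N <;> rw [survive, if_neg hp]

lemma survive_nonneg (B : Branching n E D m C η ε) (M N : ℕ) (p : ℤ × Set (ES n)) :
    0 ≤ B.survive M N p := by
  induction N generalizing p with
  | zero =>
    rw [survive]
    split_ifs
    · exact le_rfl
    · exact measureReal_nonneg
  | succ N ih =>
    rw [survive]
    split_ifs
    · exact Finset.sum_nonneg fun q _ => ih q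
    · exact measureReal_nonneg

lemma survive_le (h : Nice n E D Λ) (B : Branching n E D m C η ε) (M N : ℕ) :
    ∀ p : ℤ × Set (ES n), p.2 ∈ D.cubes p.1 → B.survive M N p ≤ (surfMeasure n E).real p.2 := by
  induction N with
  | zero =>
    intro p hp
    rw [survive]
    split_ifs
    · exact measureReal_nonneg
    · exact le_rfl
  | succ N ih =>
    intro p hp
    rw [survive]
    split_ifs with hpm
    · rw [← B.sum_K h hp hpm]
      exact (Finset.sum_le_sum fun q hq =>
        ih q (B.mem_K h hp (Finset.mem_filter.1 hq).1).2.1).trans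
        (Finset.sum_le_sum_of_subset_of_nonneg (Finset.filter_subset _ _)
          fun _ _ _ => measureReal_nonneg)
    · exact le_rfl

lemma le_survive (h : Nice n E D Λ) (B : Branching n E D m C η ε) (hC : 1 ≤ C) (M N : ℕ) :
    ∀ p : ℤ × Set (ES n), p.2 ∈ D.cubes p.1 →
      N * ((surfMeasure n E).real p.2 - B.survive M N p) ≤
        (1 + N * (Λ ^ 2 * (2 * (C * (2 * C + 3))) ^ n / (M + 1))) * B.layers N p := by
  have hC0 : 0 ≤ Λ ^ 2 * (2 * (C * (2 * C + 3))) ^ n / (M + 1 : ℝ) := by positivity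
  set l := Λ ^ 2 * (2 * (C * (2 * C + 3))) ^ n / (M + 1 : ℝ) with hl
  induction N with
  | zero =>
    intro p _
    have := B.layers_nonneg 0 p
    simpa using this
  | succ N ih =>
    intro p hp
    by_cases hpm : p.1 < m
    swap
    · rw [B.survive_of_not_lt M _ hpm, sub_self, mul_zero]
      have := B.layers_nonneg (N + 1) p
      positivity
    have hcr := B.sum_crowded_le h hC M hp hpm
    rw [← hl] at hcr
    have hsub : B.sparse M p ⊆ B.K p := Finset.filter_subset _ _
    have hdiff : ∀ q ∈ B.K p, 0 ≤ (surfMeasure n E).real q.2 - B.survive M N q := fun q hq =>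
      sub_nonneg.2 (B.survive_le h M N q (B.mem_K h hp hq).2.1)
    set G := ∑ q ∈ B.sparse M p, ((surfMeasure n E).real q.2 - B.survive M N q) with hG
    have hG1 : G ≤ (surfMeasure n E).real p.2 := by
      rw [← B.sum_K h hp hpm]
      refine (Finset.sum_le_sum_of_subset_of_nonneg hsub fun q hq _ => hdiff q hq).trans
        (Finset.sum_le_sum fun q _ => ?_)
      have := B.survive_nonneg M N q
      linarith
    have hG2 : N * G ≤ (1 + N * l) * ∑ q ∈ B.K p, B.layers N q := by
      rw [hG, Finset.mul_sum, Finset.mul_sum]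
      refine (Finset.sum_le_sum fun q hq => ih q (B.mem_K h hp (hsub hq)).2.1).trans
        (Finset.sum_le_sum_of_subset_of_nonneg hsub fun q _ _ => ?_)
      have := B.layers_nonneg N q
      positivity
    rw [survive, if_pos hpm, layers]
    have h1 : (surfMeasure n E).real p.2 - ∑ q ∈ B.sparse M p, B.survive M N q =
        ((surfMeasure n E).real p.2 - ∑ q ∈ B.sparse M p, (surfMeasure n E).real q.2) + G := by
      rw [hG, Finset.sum_sub_distrib]
      ring
    rw [h1]
    push_cast
    have h2 : (N + 1 : ℝ) * ((surfMeasure n E).real p.2 -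
        ∑ q ∈ B.sparse M p, (surfMeasure n E).real q.2) ≤
        (N + 1) * (l * (surfMeasure n E).real p.2) := by gcongr
    have h3 : 0 ≤ ∑ q ∈ B.K p, B.layers N q := Finset.sum_nonneg fun q _ => B.layers_nonneg N q
    have h4 : 0 ≤ l * ∑ q ∈ B.K p, B.layers N q := by positivity
    linarith

end Branching

namespace Branching

variable {n : ℕ} {E : Set (ES n)} {D : DyadicSystem n E} {Λ C η ε : ℝ} {m : ℤ}

/-- Gluing the anchors of the scheme to a map with Lipschitz inverse, up to the final scale. -/
lemma exists_chart (h : Nice n E D Λ) (B : Branching n E D m C η ε) (hC : 1 ≤ C) (hΛC : Λ ≤ C)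
    (M N : ℕ) : ∀ p : ℤ × Set (ES n), p.2 ∈ D.cubes p.1 → p.1 ≤ m →
      ∃ (A : Set (ES n)) (Φ : ES n → EuclideanSpace ℝ (Fin n)), A ⊆ p.2 ∧ MeasurableSet A ∧
        (∀ x ∈ A, ‖Φ x‖ ≤ 2 * C * scale p.1) ∧
        (∀ x ∈ A, ∀ x' ∈ A, dist x x' ≤ 4 ^ N * (6 * C) * (‖Φ x - Φ x'‖ + scale m)) ∧
        B.survive M N p ≤ (M + 1) ^ N * (surfMeasure n E).real A := by
  classical
  have hbase : ∀ N : ℕ, ∀ p : ℤ × Set (ES n), p.2 ∈ D.cubes p.1 → p.1 ≤ m → ¬ p.1 < m →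
      ∃ (A : Set (ES n)) (Φ : ES n → EuclideanSpace ℝ (Fin n)), A ⊆ p.2 ∧ MeasurableSet A ∧
        (∀ x ∈ A, ‖Φ x‖ ≤ 2 * C * scale p.1) ∧
        (∀ x ∈ A, ∀ x' ∈ A, dist x x' ≤ 4 ^ N * (6 * C) * (‖Φ x - Φ x'‖ + scale m)) ∧
        B.survive M N p ≤ (M + 1) ^ N * (surfMeasure n E).real A := by
    intro N p hp hpm hlt
    have hs := scale_pos m
    have heq : p.1 = m := by omega
    refine ⟨p.2, 0, subset_rfl, D.borel _ _ hp, fun x _ => ?_, fun x hx x' hx' => ?_, ?_⟩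
    · have := scale_pos p.1
      simp only [Pi.zero_apply, norm_zero]
      positivity
    · refine (h.dist_le _ _ hp x hx x' hx').trans ?_
      simp only [Pi.zero_apply, sub_zero, norm_zero, zero_add]
      rw [heq]
      have h1 : (1 : ℝ) ≤ 4 ^ N := one_le_pow₀ (by norm_num)
      have h2 : Λ ≤ 4 ^ N * (6 * C) := by
        have : 1 * (6 * C) ≤ 4 ^ N * (6 * C) := by gcongr
        linarith
      gcongr
    · rw [B.survive_of_not_lt M N hlt]
      exact le_mul_of_one_le_left measureReal_nonneg
        (one_le_pow₀ (by have : (0 : ℝ) ≤ M := by positivity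
                         linarith))
  induction N with
  | zero =>
    intro p hp hpm
    by_cases hlt : p.1 < m
    · refine ⟨∅, 0, empty_subset _, MeasurableSet.empty, by simp, by simp, ?_⟩
      rw [survive, if_pos hlt]
      simp
    · exact hbase 0 p hp hpm hlt
  | succ N ih =>
    intro p hp hpm
    by_cases hlt : p.1 < m
    swap
    · exact hbase (N + 1) p hp hpm hlt
    have hsub : B.sparse M p ⊆ B.K p := Finset.filter_subset _ _
    obtain ⟨col, hcol⟩ := exists_coloring (fun q : ℤ × Set (ES n) => q.1) (B.Conflict p)
      (fun _ _ => Conflict.symm) M (B.sparse M p) (by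
        intro q hq
        refine le_trans ?_ (Finset.mem_filter.1 hq).2
        exact Finset.card_le_card (Finset.filter_subset_filter _ hsub))
    obtain ⟨c, hc⟩ := exists_heavy_color (B.sparse M p) M col (B.survive M N)
    set W : Finset (ℤ × Set (ES n)) := {q ∈ B.sparse M p | col q = c} with hW
    have hWK : ∀ q ∈ W, q ∈ B.K p := fun q hq => hsub (Finset.mem_filter.1 hq).1
    have hWsep : ∀ q ∈ W, ∀ q' ∈ W, q ≠ q' →
        2 * C * max (scale q.1) (scale q'.1) ≤ ‖B.a p q - B.a p q'‖ := by
      intro q hq q' hq' hne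
      by_contra! hcon
      rw [hW, Finset.mem_filter] at hq hq'
      exact hcol q hq.1 q' hq'.1 hne hcon (hq.2.trans hq'.2.symm)
    choose! A Φ hA hAm hΦ hdist hmass using fun q (hq : q ∈ W) =>
      ih q (B.mem_K h hp (hWK q hq)).2.1 (B.mem_K h hp (hWK q hq)).1.2
    choose! i hiW hi using fun x (hx : x ∈ ⋃ q ∈ W, A q) => mem_iUnion₂.1 hx
    refine ⟨⋃ q ∈ W, A q, fun x => B.a p (i x) + (1 / 4 : ℝ) • Φ (i x) x,
      iUnion₂_subset fun q hq => (hA q hq).trans (B.mem_K h hp (hWK q hq)).2.2,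
      W.measurableSet_biUnion hAm, fun x hx => ?_, fun x hx x' hx' => ?_, ?_⟩
    · have h1 := B.norm_a_le p hp _ (hWK _ (hiW x hx))
      have h2 := hΦ _ (hiW x hx) x (hi x hx)
      have h3 := scale_half_of_lt (show p.1 < (i x).1 by
        have := (B.mem_K h hp (hWK _ (hiW x hx))).1.1
        omega)
      have h4 := norm_add_le (B.a p (i x)) ((1 / 4 : ℝ) • Φ (i x) x)
      rw [norm_smul, Real.norm_of_nonneg (by norm_num : (0 : ℝ) ≤ 1 / 4)] at h4
      have h5 : C * (2 * scale (i x).1) ≤ C * scale p.1 := by gcongr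
      have h6 : 0 ≤ C * scale p.1 := by have := scale_pos p.1; positivity
      refine h4.trans ?_
      linarith
    · have hx1 := hi x hx
      have hx1' := hi x' hx'
      have hs := scale_pos m
      beta_reduce
      by_cases heq : i x = i x'
      · rw [← heq] at hx1' ⊢
        have h1 := hdist _ (hiW x hx) x hx1 x' hx1'
        rw [add_sub_add_left_eq_sub, ← smul_sub, norm_smul,
          Real.norm_of_nonneg (by norm_num : (0 : ℝ) ≤ 1 / 4)]
        refine h1.trans ?_
        have h2 : 0 ≤ 4 ^ N * (6 * C) * scale m := by positivity
        rw [pow_succ]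
        linarith
      · have h1 := hWsep _ (hiW x hx) _ (hiW x' hx') heq
        have h2 := B.dist_le p hp _ (hWK _ (hiW x hx)) _ (hWK _ (hiW x' hx')) x
          (hA _ (hiW x hx) hx1) x' (hA _ (hiW x' hx') hx1')
        have h3 := hΦ _ (hiW x hx) x hx1
        have h4 := hΦ _ (hiW x' hx') x' hx1'
        have h5 := le_max_left (scale (i x).1) (scale (i x').1)
        have h6 := le_max_right (scale (i x).1) (scale (i x').1)
        set u := B.a p (i x)
        set u' := B.a p (i x')
        set v := Φ (i x) x
        set v' := Φ (i x') x'
        set mx := max (scale (i x).1) (scale (i x').1)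
        have hmx : 0 < mx := lt_of_lt_of_le (scale_pos _) h5
        have h7 : ‖u - u'‖ ≤ ‖u + (1 / 4 : ℝ) • v - (u' + (1 / 4 : ℝ) • v')‖ +
            (1 / 4 * ‖v‖ + 1 / 4 * ‖v'‖) := by
          have e1 : u - u' = (u + (1 / 4 : ℝ) • v - (u' + (1 / 4 : ℝ) • v')) +
              ((1 / 4 : ℝ) • v' - (1 / 4 : ℝ) • v) := by abel
          have e2 := norm_add_le (u + (1 / 4 : ℝ) • v - (u' + (1 / 4 : ℝ) • v'))
            ((1 / 4 : ℝ) • v' - (1 / 4 : ℝ) • v)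
          have e3 := norm_sub_le ((1 / 4 : ℝ) • v') ((1 / 4 : ℝ) • v)
          rw [norm_smul, norm_smul, Real.norm_of_nonneg (by norm_num : (0 : ℝ) ≤ 1 / 4)] at e3
          rw [← e1] at e2
          linarith
        have h8 : C * scale (i x).1 ≤ C * mx := by gcongr
        have h9 : C * scale (i x').1 ≤ C * mx := by gcongr
        have h10 : ‖u - u'‖ ≤ 2 * ‖u + (1 / 4 : ℝ) • v - (u' + (1 / 4 : ℝ) • v')‖ := by linarith
        have h11 : mx ≤ C * mx := le_mul_of_one_le_left hmx.le hC
        have h12 : dist x x' ≤ C * (2 * ‖u - u'‖) := by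
          refine h2.trans ?_
          gcongr
          linarith
        have h13 : (1 : ℝ) ≤ 4 ^ (N + 1) := one_le_pow₀ (by norm_num)
        set w := ‖u + (1 / 4 : ℝ) • v - (u' + (1 / 4 : ℝ) • v')‖
        calc dist x x' ≤ C * (2 * ‖u - u'‖) := h12
          _ ≤ C * (2 * (2 * w)) := by gcongr
          _ ≤ 1 * (6 * C) * (w + scale m) := by
              have : 0 ≤ C * w := by positivity
              have : 0 ≤ C * scale m := by positivity
              linarith
          _ ≤ _ := by gcongr
    · rw [survive, if_pos hlt]
      have h1 : (surfMeasure n E).real (⋃ q ∈ W, A q) =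
          ∑ q ∈ W, (surfMeasure n E).real (A q) := by
        refine measureReal_biUnion_finset ?_ hAm fun q hq =>
          ne_top_of_le_ne_top (h.ne_top (B.mem_K h hp (hWK q hq)).2.1) (measure_mono (hA q hq))
        intro q hq q' hq' hne
        exact Set.disjoint_left.2 fun x hx hx' => hne (B.disj p hp q (hWK q hq) q' (hWK q' hq') x
          (hA q hq hx) (hA q' hq' hx'))
      rw [h1]
      refine hc.trans ?_
      rw [pow_succ', mul_assoc]
      gcongr
      rw [Finset.mul_sum]
      exact Finset.sum_le_sum fun q hq => hmass q hq

end Branching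

namespace Nice

variable {n : ℕ} {E : Set (ES n)} {D : DyadicSystem n E} {Λ : ℝ}

open Classical in
/-- Packing of the non-flat cubes yields big pieces with Lipschitz charts, up to a scale. -/
lemma exists_chart (h : Nice n E D Λ) {ε₀ : ℝ} (hε₀ : 0 < ε₀)
    (hpack : ∀ ε, 0 < ε → ε < ε₀ → ∃ C, ∀ k m, ∀ T ∈ D.cubes k,
      ∑ q ∈ D.pairs k m T with ¬ LocalBAUP E D ε q.1 q.2, (surfMeasure n E).real q.2 ≤
        C * (surfMeasure n E).real T) :
    ∃ θ L : ℝ, 0 < θ ∧ 1 ≤ L ∧ ∀ k m, k ≤ m → ∀ T ∈ D.cubes k,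
      ∃ (A : Set (ES n)) (Φ : ES n → EuclideanSpace ℝ (Fin n)), A ⊆ T ∧ MeasurableSet A ∧
        (∀ x ∈ A, ‖Φ x‖ ≤ L * scale k) ∧
        (∀ x ∈ A, ∀ x' ∈ A, dist x x' ≤ L * (‖Φ x - Φ x'‖ + scale m)) ∧
        θ * (surfMeasure n E).real T ≤ (surfMeasure n E).real A := by
  obtain ⟨ε, η, C, hε, hεε₀, hη, hC, hΛC, hB⟩ := h.exists_branching hε₀
  obtain ⟨Cp, hCp⟩ := hpack ε hε hεε₀
  have hη' : 0 < η⁻¹ := by positivity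
  set Cτ := (1 + η⁻¹) * (1 + |Cp|) with hCτ
  have hCτ0 : 0 < Cτ := by positivity
  set Cc := Λ ^ 2 * (2 * (C * (2 * C + 3))) ^ n with hCc
  have hCc0 : 0 ≤ Cc := by positivity
  obtain ⟨N, hN⟩ := exists_nat_gt (4 * Cτ)
  obtain ⟨M, hM⟩ := exists_nat_gt (4 * Cτ * Cc)
  have hNpos : (0 : ℝ) < N := by linarith
  refine ⟨1 / 2 / (M + 1) ^ N, 4 ^ N * (6 * C), by positivity, ?_, fun k m hkm T hT => ?_⟩
  · have : (1 : ℝ) ≤ 4 ^ N := one_le_pow₀ (by norm_num)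
    nlinarith
  obtain ⟨B⟩ := hB m
  obtain ⟨A, Φ, hA, hAm, hΦ, hdist, hmass⟩ := B.exists_chart h hC hΛC M N (k, T) hT hkm
  have hk := scale_pos k
  refine ⟨A, Φ, hA, hAm, fun x hx => (hΦ x hx).trans ?_, hdist, ?_⟩
  · have : (1 : ℝ) ≤ 4 ^ N := one_le_pow₀ (by norm_num)
    have h2 : 2 * C ≤ 4 ^ N * (6 * C) := by nlinarith
    gcongr
  have hT0 := h.measure_pos hT
  have h1 := (B.layers_le h hη N (k, T) hT hkm).1
  have h2 : B.badSum (k, T) ≤ |Cp| * (surfMeasure n E).real T := by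
    refine le_trans ?_ ((hCp k (m - 1) T hT).trans ?_)
    · rw [Branching.badSum]
    · gcongr
      exact le_abs_self _
  have h3 : B.layers N (k, T) ≤ Cτ * (surfMeasure n E).real T := by
    refine h1.trans ?_
    rw [hCτ, mul_assoc]
    gcongr
    simp only
    linarith
  have h4 := B.le_survive h hC M N (k, T) hT
  rw [← hCc] at h4
  simp only at h4
  have h5 : N * ((surfMeasure n E).real T - B.survive M N (k, T)) ≤
      N * (1 / 2 * (surfMeasure n E).real T) := by
    refine h4.trans ?_
    calc (1 + N * (Cc / (M + 1))) * B.layers N (k, T)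
        ≤ (1 + N * (Cc / (M + 1))) * (Cτ * (surfMeasure n E).real T) := by gcongr
      _ = (Cτ + N * (Cτ * Cc / (M + 1))) * (surfMeasure n E).real T := by ring
      _ ≤ (N / 4 + N * (1 / 4)) * (surfMeasure n E).real T := by
        have e1 : Cτ * Cc / (M + 1) ≤ 1 / 4 := by
          rw [div_le_iff₀ (by positivity)]
          linarith
        have e2 : Cτ ≤ N / 4 := by linarith
        exact mul_le_mul_of_nonneg_right (add_le_add e2
          (mul_le_mul_of_nonneg_left e1 hNpos.le)) hT0.le
      _ = _ := by ring
  have h6 := le_of_mul_le_mul_left h5 hNpos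
  rw [div_mul_eq_mul_div, div_le_iff₀ (by positivity), mul_comm _ ((M + 1 : ℝ) ^ N)]
  linarith

end Nice

/-- A map with Lipschitz inverse up to the scale `t` is inverted on a net by a Lipschitz map. -/
lemma exists_lipschitz_near {X V : Type*} [MetricSpace X] [NormedAddCommGroup V]
    [NormedSpace ℝ V] [FiniteDimensional ℝ V] {A : Set V} (hA : Bornology.IsBounded A)
    {Φ : V → X} {L t : ℝ} (hL : 1 ≤ L) (ht : 0 < t)
    (hΦ : ∀ x ∈ A, ∀ x' ∈ A, dist x x' ≤ L * (dist (Φ x) (Φ x') + t)) :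
    ∃ g : X → V, LipschitzWith (lipschitzExtensionConstant V * (2 * L).toNNReal) g ∧
      ∀ x ∈ A, ∃ y ∈ A, dist x (g (Φ y)) ≤ 2 * L * t := by
  classical
  have : ProperSpace V := FiniteDimensional.proper ℝ V
  obtain ⟨s, hsA, hsep, hnet⟩ := exists_net_of_bounded hA (t := 2 * L * t) (by positivity)
  have hlip : ∀ x ∈ s, ∀ x' ∈ s, dist x x' ≤ 2 * L * dist (Φ x) (Φ x') := by
    intro x hx x' hx'
    by_cases hne : x = x'
    · rw [hne, dist_self, dist_self, mul_zero]
    · have h1 := hsep x hx x' hx' hne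
      have h2 := hΦ x (hsA hx) x' (hsA hx')
      linarith
  choose! g hgs hg using fun u (hu : u ∈ Φ '' (s : Set V)) => hu
  have hg' : ∀ u ∈ Φ '' (s : Set V), g u ∈ s ∧ Φ (g u) = u := fun u hu => ⟨hgs u hu, hg u hu⟩
  have hgΦ : ∀ x ∈ s, g (Φ x) = x := by
    intro x hx
    obtain ⟨h1, h2⟩ := hg' (Φ x) ⟨x, hx, rfl⟩
    have h3 := hlip _ h1 x hx
    rw [h2, dist_self, mul_zero] at h3
    exact dist_le_zero.1 h3
  have hgl : LipschitzOnWith (2 * L).toNNReal g (Φ '' (s : Set V)) := by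
    refine LipschitzOnWith.of_dist_le_mul fun u hu v hv => ?_
    obtain ⟨h1, h2⟩ := hg' u hu
    obtain ⟨h3, h4⟩ := hg' v hv
    rw [Real.coe_toNNReal _ (by positivity)]
    have := hlip _ h1 _ h3
    rwa [h2, h4] at this
  obtain ⟨G, hG, hGg⟩ := hgl.extend_finite_dimension
  refine ⟨G, hG, fun x hx => ?_⟩
  obtain ⟨y, hy, hxy⟩ := hnet x hx
  refine ⟨y, hsA hy, ?_⟩
  rw [← hGg ⟨y, hy, rfl⟩, hgΦ y hy]
  exact hxy.le

/-- A compactness principle: a set of which, for all `t > 0`, a definite portion admits a map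
with Lipschitz inverse up to the scale `t`, contains a big piece of a Lipschitz image. -/
lemma exists_lipschitz_image {V W : Type*} [NormedAddCommGroup V] [NormedSpace ℝ V]
    [FiniteDimensional ℝ V] [MeasurableSpace V] [BorelSpace V] [NormedAddCommGroup W]
    [ProperSpace W] {μ : Measure V} {T : Set V} (hTb : Bornology.IsBounded T)
    (hT : μ T ≠ ⊤) (hTm : MeasurableSet T) {L R c : ℝ} (hL : 1 ≤ L) (hc : 0 < c)
    (h : ∀ t > 0, ∃ (A : Set V) (Φ : V → W), A ⊆ T ∧ (∀ x ∈ A, ‖Φ x‖ ≤ R) ∧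
      (∀ x ∈ A, ∀ x' ∈ A, dist x x' ≤ L * (dist (Φ x) (Φ x') + t)) ∧ c ≤ μ.real A) :
    ∃ g : W → V, LipschitzWith (lipschitzExtensionConstant V * (2 * L).toNNReal) g ∧
      c ≤ μ.real (T ∩ g '' closedBall 0 R) := by
  have : ProperSpace V := FiniteDimensional.proper ℝ V
  set K := lipschitzExtensionConstant V * (2 * L).toNNReal with hK
  have hKpos : (0 : ℝ) < K := by
    have h1 := lipschitzExtensionConstant_pos V
    have h2 : 0 < (2 * L).toNNReal := Real.toNNReal_pos.2 (by positivity)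
    exact_mod_cast mul_pos h1 h2
  set t : ℕ → ℝ := fun j => (2 * L)⁻¹ * (1 / (j + 1)) with ht
  have htpos : ∀ j, 0 < t j := fun j => by positivity
  choose A Φ hA hΦ hdist hmass using fun j => h (t j) (htpos j)
  choose g hg hnear using fun j => exists_lipschitz_near (hTb.subset (hA j)) hL (htpos j) (hdist j)
  have hne : ∀ j, (A j).Nonempty := by
    intro j
    by_contra hcon
    have := hmass j
    rw [Set.not_nonempty_iff_eq_empty.1 hcon, measureReal_empty] at this
    linarith
  obtain ⟨x₀, hx₀⟩ := hne 0
  obtain ⟨ρ, hρ⟩ := hTb.subset_closedBall x₀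
  have hbd : ∀ j, dist (g j 0) x₀ ≤ ρ + 1 + K * R := by
    intro j
    obtain ⟨x, hx⟩ := hne j
    obtain ⟨y, hy, hxy⟩ := hnear j x hx
    have h1 := hρ (hA j hx)
    rw [mem_closedBall] at h1
    have h2 := (hg j).dist_le_mul 0 (Φ j y)
    rw [dist_zero_left] at h2
    have h3 : (K : ℝ) * ‖Φ j y‖ ≤ K * R := mul_le_mul_of_nonneg_left (hΦ j y hy) hKpos.le
    have h4 : 2 * L * t j ≤ 1 := by
      rw [ht]
      simp only
      rw [← mul_assoc, mul_inv_cancel₀ (by positivity), one_mul]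
      exact div_le_one_of_le₀ (by linarith [show (0 : ℝ) ≤ j by positivity]) (by positivity)
    have h5 := dist_triangle4 (g j 0) (g j (Φ j y)) x x₀
    rw [dist_comm _ x] at h5
    linarith
  set U : Ultrafilter ℕ := Filter.hyperfilter ℕ with hU
  have hlim : ∀ u, ∃ v, Filter.Tendsto (fun j => g j u) U (nhds v) := by
    intro u
    have hcomp : IsCompact (closedBall x₀ (ρ + 1 + K * R + K * ‖u‖)) := isCompact_closedBall _ _
    obtain ⟨v, -, hv⟩ := hcomp.ultrafilter_le_nhds (U.map fun j => g j u) (by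
      rw [Filter.le_principal_iff]
      change ∀ᶠ j in (U : Filter ℕ), g j u ∈ closedBall x₀ _
      refine Filter.Eventually.of_forall fun j => ?_
      have h1 := (hg j).dist_le_mul u 0
      rw [dist_zero_right] at h1
      have h2 := dist_triangle (g j u) (g j 0) x₀
      have h3 := hbd j
      change dist (g j u) x₀ ≤ _
      linarith)
    exact ⟨v, hv⟩
  choose G hG using hlim
  have hGl : LipschitzWith K G := by
    refine LipschitzWith.of_dist_le_mul fun u v => ?_
    exact le_of_tendsto ((hG u).dist (hG v))
      (Filter.Eventually.of_forall fun j => (hg j).dist_le_mul u v)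
  refine ⟨G, hGl, ?_⟩
  set S := G '' closedBall 0 R with hS
  have hScomp : IsCompact S := (isCompact_closedBall _ _).image hGl.continuous
  have htend : Filter.Tendsto t U (nhds 0) := by
    have h1 : Filter.Tendsto t Filter.atTop (nhds ((2 * L)⁻¹ * 0)) :=
      tendsto_one_div_add_atTop_nhds_zero_nat.const_mul _
    rw [mul_zero] at h1
    exact h1.mono_left Nat.hyperfilter_le_atTop
  have hclose : ∀ τ > 0, ∃ j, A j ⊆ cthickening τ S := by
    intro τ hτ
    obtain ⟨s, -, -, hnet⟩ := exists_net_of_bounded (A := closedBall (0 : W) R)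
      isBounded_closedBall (t := τ / (4 * K)) (by positivity)
    have h1 : ∀ᶠ j in (U : Filter ℕ), ∀ y ∈ s, dist (g j y) (G y) < τ / 4 :=
      (Finset.eventually_all s).2 fun y _ =>
        (tendsto_iff_dist_tendsto_zero.1 (hG y)).eventually_lt_const (by positivity)
    have h2 : ∀ᶠ j in (U : Filter ℕ), t j < τ / (8 * L) :=
      htend.eventually_lt_const (by positivity)
    obtain ⟨j, hj1, hj2⟩ := (h1.and h2).exists
    refine ⟨j, fun x hx => ?_⟩
    obtain ⟨y, hy, hxy⟩ := hnear j x hx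
    have hu : Φ j y ∈ closedBall (0 : W) R := mem_closedBall_zero_iff.2 (hΦ j y hy)
    obtain ⟨v, hv, huv⟩ := hnet _ hu
    refine mem_cthickening_of_dist_le x (G (Φ j y)) τ S ⟨_, hu, rfl⟩ ?_
    have e1 := (hg j).dist_le_mul (Φ j y) v
    have e2 := hGl.dist_le_mul v (Φ j y)
    rw [dist_comm v] at e2
    have e3 : K * dist (Φ j y) v ≤ K * (τ / (4 * K)) := by gcongr
    have e4 : K * (τ / (4 * K)) = τ / 4 := by field_simp
    have e5 : 2 * L * t j ≤ 2 * L * (τ / (8 * L)) := by gcongr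
    have e6 : 2 * L * (τ / (8 * L)) = τ / 4 := by field_simp; norm_num
    have e7 := hj1 v hv
    have e8 := dist_triangle4 (g j (Φ j y)) (g j v) (G v) (G (Φ j y))
    have e9 := dist_triangle x (g j (Φ j y)) (G (Φ j y))
    linarith
  have : IsFiniteMeasure (μ.restrict T) := ⟨by
    rw [Measure.restrict_apply_univ]
    exact hT.lt_top⟩
  have hcont := tendsto_measure_cthickening_of_isCompact (μ := μ.restrict T) hScomp
  have hcont' := (ENNReal.tendsto_toReal (measure_ne_top (μ.restrict T) S)).comp hcont
  have hge : ∀ τ > 0, c ≤ ((μ.restrict T) (cthickening τ S)).toReal := by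
    intro τ hτ
    obtain ⟨j, hj⟩ := hclose τ hτ
    refine (hmass j).trans ?_
    refine ENNReal.toReal_mono (measure_ne_top _ _) ?_
    rw [Measure.restrict_apply' hTm]
    exact measure_mono fun x hx => ⟨hj hx, hA j hx⟩
  have hfin : c ≤ ((μ.restrict T) S).toReal := by
    refine ge_of_tendsto (hcont'.mono_left (nhdsWithin_le_nhds (s := Ioi 0))) ?_
    filter_upwards [self_mem_nhdsWithin] with τ hτ using hge τ hτ
  rwa [Measure.restrict_apply' hTm, inter_comm] at hfin

namespace Nice

variable {n : ℕ} {E : Set (ES n)} {D : DyadicSystem n E} {Λ : ℝ}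

open Classical in
lemma isUR_of_packing (h : Nice n E D Λ) {ε₀ : ℝ} (hε₀ : 0 < ε₀)
    (hpack : ∀ ε, 0 < ε → ε < ε₀ → ∃ C, ∀ k m, ∀ T ∈ D.cubes k,
      ∑ q ∈ D.pairs k m T with ¬ LocalBAUP E D ε q.1 q.2, (surfMeasure n E).real q.2 ≤
        C * (surfMeasure n E).real T) :
    ∃ θ M₀ : ℝ, IsUR n θ M₀ E := by
  obtain ⟨θ, L, hθ, hL, hchart⟩ := h.exists_chart hε₀ hpack
  have hΛ := h.pos
  have hΛ1 := h.reg.one_le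
  set K := lipschitzExtensionConstant (ES n) * (2 * L).toNNReal with hK
  have hKpos : 0 < K :=
    mul_pos (lipschitzExtensionConstant_pos _) (Real.toNNReal_pos.2 (by positivity))
  refine ⟨θ * Λ⁻¹ * (1 / (4 * Λ)) ^ n, K * L.toNNReal, by positivity, ?_, ?_⟩
  · have : 0 < L.toNNReal := Real.toNNReal_pos.2 (by positivity)
    exact_mod_cast mul_pos hKpos this
  intro x hx r hr _
  obtain ⟨k, hk1, hk2⟩ := exists_scale_le (show 0 < r / (2 * Λ) by positivity)
  have hk := scale_pos k
  rw [le_div_iff₀ (by positivity)] at hk1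
  rw [div_lt_iff₀ (by positivity)] at hk2
  have hT := D.cubeAt_mem k hx
  have hxT := D.mem_cubeAt k hx
  set T := D.cubeAt k x
  have hTpos := h.measure_pos hT
  obtain ⟨g, hg, hmass⟩ := exists_lipschitz_image (μ := surfMeasure n E) (T := T)
    (W := EuclideanSpace ℝ (Fin n)) (h.bounded hT) (h.ne_top hT)
    (D.borel _ _ hT) (L := L) (R := L * scale k) (c := θ * (surfMeasure n E).real T) hL
    (by positivity) (by
      intro t ht
      obtain ⟨j, hj1, -⟩ := exists_scale_le ht
      obtain ⟨A, Φ, hA, -, hΦ, hdist, hm⟩ := hchart k (max j k) (le_max_right _ _) T hT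
      refine ⟨A, Φ, hA, hΦ, fun y hy y' hy' => (hdist y hy y' hy').trans ?_, hm⟩
      rw [dist_eq_norm]
      gcongr
      exact (scale_anti (le_max_left j k)).trans hj1)
  refine ⟨fun u => g (L • u), ?_, ?_⟩
  · have h1 : LipschitzWith L.toNNReal fun u : EuclideanSpace ℝ (Fin n) => L • u := by
      refine LipschitzWith.of_dist_le_mul fun u v => ?_
      rw [dist_smul₀, Real.norm_of_nonneg (by linarith), Real.coe_toNNReal _ (by linarith)]
    have h2 := hg.comp h1
    have h3 : (K * L.toNNReal : ℝ).toNNReal = K * L.toNNReal := by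
      rw [← NNReal.coe_mul, Real.toNNReal_coe]
    rw [h3]
    exact h2
  · have hsub : T ∩ g '' closedBall 0 (L * scale k) ⊆
        E ∩ ball x r ∩ (fun u => g (L • u)) '' ball 0 r := by
      rintro y ⟨hy, u, hu, rfl⟩
      refine ⟨⟨D.subset_E hT hy, ?_⟩, L⁻¹ • u, ?_, ?_⟩
      · rw [mem_ball]
        have h1 := h.dist_le _ _ hT _ hy x hxT
        have : 0 < Λ * scale k := by positivity
        linarith
      · rw [mem_closedBall_zero_iff] at hu
        rw [mem_ball_zero_iff, norm_smul, Real.norm_of_nonneg (by positivity),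
          inv_mul_lt_iff₀ (by positivity)]
        refine hu.trans_lt ?_
        gcongr
        have : 1 * scale k ≤ Λ * scale k := by gcongr
        linarith
      · simp only
        rw [smul_smul, mul_inv_cancel₀ (by positivity), one_smul]
    have hm1 : θ * Λ⁻¹ * (1 / (4 * Λ)) ^ n * r ^ n ≤
        (surfMeasure n E).real (T ∩ g '' closedBall 0 (L * scale k)) := by
      refine le_trans ?_ hmass
      have h1 := h.lower _ _ hT
      have h2 : (1 / (4 * Λ)) ^ n * r ^ n ≤ scale k ^ n := by
        rw [← mul_pow]
        gcongr
        rw [one_div, inv_mul_le_iff₀ (by positivity)]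
        linarith
      calc θ * Λ⁻¹ * (1 / (4 * Λ)) ^ n * r ^ n = θ * (Λ⁻¹ * ((1 / (4 * Λ)) ^ n * r ^ n)) := by ring
        _ ≤ θ * (Λ⁻¹ * scale k ^ n) := by gcongr
        _ ≤ _ := by gcongr
    refine (ENNReal.ofReal_le_ofReal hm1).trans ?_
    rw [Measure.real, ENNReal.ofReal_toReal
      (ne_top_of_le_ne_top (h.ne_top hT) (measure_mono inter_subset_left)), surfMeasure,
      Measure.restrict_apply' h.closed.measurableSet]
    exact measure_mono (inter_subset_left.trans hsub)

open Classical in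
/-- Packing conditions in terms of finite sums. -/
lemma sum_le_of_packedBy (h : Nice n E D Λ) {P : ℤ → Set (ES n) → Prop} {C : ℝ}
    (hP : PackedBy E D P C) (k m : ℤ) {T : Set (ES n)} (hT : T ∈ D.cubes k) :
    ∑ q ∈ D.pairs k m T with P q.1 q.2, (surfMeasure n E).real q.2 ≤
      max C 0 * (surfMeasure n E).real T := by
  have hres : ∀ j, ∀ Q ∈ D.cubes j, surfMeasure n E Q = μH[(n : ℝ)] Q := by
    intro j Q hQ
    rw [surfMeasure, Measure.restrict_apply (D.borel _ _ hQ),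
      inter_eq_left.2 (D.subset_E hQ)]
  have h1 := hP k T hT
  set S : Finset (ℤ × Set (ES n)) := {q ∈ D.pairs k m T | P q.1 q.2}
  have hS : ∀ q ∈ S, q.2 ∈ D.cubes q.1 ∧ P q.1 q.2 ∧ q.2 ⊆ T := by
    intro q hq
    obtain ⟨h2, h3⟩ := Finset.mem_filter.1 hq
    rw [h.mem_pairs (h.bounded hT)] at h2
    exact ⟨h2.2.1, h3, h2.2.2⟩
  have h2 : ∑ q ∈ S, μH[(n : ℝ)] q.2 ≤
      ∑' p : {p : ℤ × Set (ES n) // p.2 ∈ D.cubes p.1 ∧ P p.1 p.2 ∧ p.2 ⊆ T},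
        μH[(n : ℝ)] p.1.2 := by
    rw [← Finset.sum_subtype_of_mem (p := fun p : ℤ × Set (ES n) =>
      p.2 ∈ D.cubes p.1 ∧ P p.1 p.2 ∧ p.2 ⊆ T) (fun q => μH[(n : ℝ)] q.2) hS]
    exact ENNReal.sum_le_tsum _
  have h3 : ∑ q ∈ S, (surfMeasure n E).real q.2 = (∑ q ∈ S, μH[(n : ℝ)] q.2).toReal := by
    rw [ENNReal.toReal_sum fun q hq => by
      rw [← hres _ _ (hS q hq).1]
      exact h.ne_top (hS q hq).1]
    refine Finset.sum_congr rfl fun q hq => ?_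
    rw [Measure.real, hres _ _ (hS q hq).1]
  rw [h3, Measure.real, hres _ _ hT]
  have h4 : μH[(n : ℝ)] T ≠ ⊤ := by
    rw [← hres _ _ hT]
    exact h.ne_top hT
  refine (ENNReal.toReal_mono (ENNReal.mul_ne_top ENNReal.ofReal_ne_top h4)
    (h2.trans h1)).trans_eq ?_
  rw [ENNReal.toReal_mul, ENNReal.toReal_ofReal']

end Nice

namespace Nice

variable {n : ℕ} {E : Set (ES n)} {D : DyadicSystem n E} {Λ : ℝ}

open Classical in
/-- A packing condition holds as soon as it holds, in every cube, for the cubes that meet a set of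
definite proportion. -/
lemma sum_le_of_good_part (h : Nice n E D Λ) {P : ℤ → Set (ES n) → Prop} {θ C : ℝ} (hθ : 0 < θ)
    (hgood : ∀ k m, k ≤ m → ∀ T ∈ D.cubes k, ∃ F ⊆ T,
      θ * (surfMeasure n E).real T ≤ (surfMeasure n E).real F ∧
      ∑ q ∈ D.pairs k m T with P q.1 q.2 ∧ (q.2 ∩ F).Nonempty, (surfMeasure n E).real q.2 ≤
        C * (surfMeasure n E).real T)
    (k m : ℤ) {T : Set (ES n)} (hT : T ∈ D.cubes k) :
    ∑ q ∈ D.pairs k m T with P q.1 q.2, (surfMeasure n E).real q.2 ≤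
      max C 0 / θ * (surfMeasure n E).real T := by
  obtain ⟨N, hN⟩ : ∃ N : ℕ, m + 1 - k ≤ N := ⟨(m + 1 - k).toNat, by omega⟩
  induction N generalizing k T with
  | zero =>
    have hempty : D.pairs k m T = ∅ := by
      refine Finset.eq_empty_of_forall_notMem fun q hq => ?_
      rw [h.mem_pairs (h.bounded hT)] at hq
      have := hq.1.1.trans hq.1.2
      push_cast at hN
      omega
    rw [hempty, Finset.filter_empty, Finset.sum_empty]
    positivity
  | succ N ih =>
    rcases lt_or_ge m k with hmk | hkm
    · exact ih k hT (by omega)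
    obtain ⟨F, hFT, hF, hsum⟩ := hgood k m hkm T hT
    have hTpos := h.measure_pos hT
    have hFne : (T ∩ F).Nonempty := by
      rw [inter_eq_right.2 hFT]
      by_contra hcon
      rw [Set.not_nonempty_iff_eq_empty.1 hcon, measureReal_empty] at hF
      nlinarith
    set kids := D.maxCubes k m T F with hkids
    have hkid : ∀ p ∈ kids, ((k + 1 ≤ p.1 ∧ p.1 ≤ m) ∧ p.2 ∈ D.cubes p.1 ∧ p.2 ⊆ T) ∧
        p.2 ∩ F = ∅ := fun p hp => by
      obtain ⟨h1, h2, -⟩ := (h.mem_maxCubes hT).1 hp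
      exact ⟨h1, h2⟩
    have hmass : ∑ p ∈ kids, (surfMeasure n E).real p.2 ≤ (1 - θ) * (surfMeasure n E).real T := by
      rw [h.sum_measure_eq (fun p hp => (hkid p hp).1.2.1) (h.disjPairs_maxCubes hT)]
      have hUm : MeasurableSet (⋃ p ∈ kids, p.2) :=
        kids.measurableSet_biUnion fun p hp => D.borel _ _ (hkid p hp).1.2.1
      have hUT : (⋃ p ∈ kids, p.2) ⊆ T := iUnion₂_subset fun p hp => (hkid p hp).1.2.2
      have h1 := measureReal_sdiff_add_inter (μ := surfMeasure n E) (s := T) hUm (h.ne_top hT)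
      rw [inter_eq_right.2 hUT] at h1
      have h2 : (surfMeasure n E).real F ≤ (surfMeasure n E).real (T \ ⋃ p ∈ kids, p.2) := by
        refine measureReal_mono (fun x hx => ⟨hFT hx, fun hxU => ?_⟩)
          (ne_top_of_le_ne_top (h.ne_top hT) (measure_mono sdiff_subset))
        obtain ⟨p, hp, hxp⟩ := mem_iUnion₂.1 hxU
        exact absurd (show x ∈ p.2 ∩ F from ⟨hxp, hx⟩) (by simp [(hkid p hp).2])
      linarith
    set S := {q ∈ D.pairs k m T | P q.1 q.2} with hS
    have hSmem : ∀ q ∈ S, ((k ≤ q.1 ∧ q.1 ≤ m) ∧ q.2 ∈ D.cubes q.1 ∧ q.2 ⊆ T) ∧ P q.1 q.2 :=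
      fun q hq => by
        rw [hS, Finset.mem_filter, h.mem_pairs (h.bounded hT)] at hq
        exact hq
    have hφ : ∀ q, ∃ p, q ∈ S → ¬ (q.2 ∩ F).Nonempty → p ∈ kids ∧ q.2 ⊆ p.2 ∧ p.1 ≤ q.1 := by
      intro q
      by_cases hq : q ∈ S ∧ ¬ (q.2 ∩ F).Nonempty
      · obtain ⟨h1, -⟩ := hSmem q hq.1
        obtain ⟨p, hp, hp1, hp2⟩ := h.exists_maxCube hT hFne h1.1.1 h1.1.2 h1.2.1 h1.2.2
          (Set.not_nonempty_iff_eq_empty.1 hq.2)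
        exact ⟨p, fun _ _ => ⟨hp, hp1, hp2⟩⟩
      · exact ⟨q, fun h1 h2 => absurd ⟨h1, h2⟩ hq⟩
    choose φ hφ using hφ
    rw [← Finset.sum_filter_add_sum_filter_not S fun q => (q.2 ∩ F).Nonempty]
    have h1 : ∑ q ∈ S with (q.2 ∩ F).Nonempty, (surfMeasure n E).real q.2 ≤
        max C 0 * (surfMeasure n E).real T := by
      rw [hS, Finset.filter_filter]
      exact hsum.trans (mul_le_mul_of_nonneg_right (le_max_left _ _) hTpos.le)
    have h2 : ∑ q ∈ S with ¬ (q.2 ∩ F).Nonempty, (surfMeasure n E).real q.2 ≤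
        ∑ p ∈ kids, max C 0 / θ * (surfMeasure n E).real p.2 := by
      rw [← Finset.sum_fiberwise_of_maps_to (t := kids) (g := φ) fun q hq =>
        (hφ q (Finset.mem_filter.1 hq).1 (Finset.mem_filter.1 hq).2).1]
      refine Finset.sum_le_sum fun p hp => ?_
      obtain ⟨hp1, -⟩ := hkid p hp
      refine le_trans (Finset.sum_le_sum_of_subset_of_nonneg ?_ fun _ _ _ => measureReal_nonneg)
        (ih p.1 hp1.2.1 (by have := hp1.1.1; push_cast at hN; omega))
      intro q hq
      obtain ⟨hq', hqp⟩ := Finset.mem_filter.1 hq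
      obtain ⟨hqS, hqF⟩ := Finset.mem_filter.1 hq'
      obtain ⟨-, h3, h4⟩ := hφ q hqS hqF
      rw [hqp] at h3 h4
      obtain ⟨h5, h6⟩ := hSmem q hqS
      rw [Finset.mem_filter, h.mem_pairs (h.bounded hp1.2.1)]
      exact ⟨⟨⟨h4, h5.1.2⟩, h5.2.1, h3⟩, h6⟩
    rw [← Finset.mul_sum] at h2
    have h3 : max C 0 / θ * ∑ p ∈ kids, (surfMeasure n E).real p.2 ≤
        max C 0 / θ * ((1 - θ) * (surfMeasure n E).real T) :=
      mul_le_mul_of_nonneg_left hmass (by positivity)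
    have h4 : max C 0 / θ * ((1 - θ) * (surfMeasure n E).real T) =
        max C 0 / θ * (surfMeasure n E).real T - max C 0 * (surfMeasure n E).real T := by
      field_simp
    linarith

end Nice

namespace Nice

variable {n : ℕ} {E : Set (ES n)} {D : DyadicSystem n E} {Λ : ℝ}

open Classical in
/-- Packing conditions from their finite versions. -/
lemma packedBy_of_sum_le (h : Nice n E D Λ) {P : ℤ → Set (ES n) → Prop} {C : ℝ} (hC : 0 ≤ C)
    (hP : ∀ k m, ∀ T ∈ D.cubes k, ∑ q ∈ D.pairs k m T with P q.1 q.2, (surfMeasure n E).real q.2 ≤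
      C * (surfMeasure n E).real T) :
    ∃ C', PackedBy E D P C' := by
  have hΛ := h.reg.pos
  obtain ⟨J, hJ⟩ := pow_unbounded_of_one_lt (Λ ^ 2) (one_lt_two : (1 : ℝ) < 2)
  refine ⟨C + J, fun k T hT => ?_⟩
  have hres : ∀ j, ∀ Q ∈ D.cubes j, μH[(n : ℝ)] Q = ENNReal.ofReal ((surfMeasure n E).real Q) := by
    intro j Q hQ
    rw [Measure.real, ENNReal.ofReal_toReal (h.ne_top hQ), surfMeasure,
      Measure.restrict_apply (D.borel _ _ hQ), inter_eq_left.2 (D.subset_E hQ)]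
  have hcoarse : ∀ j, ∀ Q ∈ D.cubes j, Q ⊆ T → j < k → Q = T ∧ k - J ≤ j := by
    intro j Q hQ hQT hjk
    have hc := D.center_mem _ _ hQ
    have hQ' : Q = T := subset_antisymm hQT (D.subset_of_mem hjk.le hT hQ (hQT hc) hc)
    refine ⟨hQ', ?_⟩
    by_contra! hlt
    have h1 := h.diam_lower j Q hQ
    rw [hQ'] at h1
    have h2 := h1.trans (h.diam_upper hT)
    rw [inv_mul_le_iff₀ hΛ] at h2
    have h3 := scale_anti hlt.le
    have h4 := scale_add_nat (k - J) J
    rw [sub_add_cancel, eq_div_iff (by positivity)] at h4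
    have h5 := mul_lt_mul_of_pos_left hJ (scale_pos k)
    nlinarith
  rw [ENNReal.tsum_eq_iSup_sum, hres _ _ hT, ← ENNReal.ofReal_mul (by positivity)]
  refine iSup_le fun t => ?_
  rw [Finset.sum_congr rfl fun p _ => hres p.1.1 p.1.2 p.2.1,
    ← ENNReal.ofReal_sum_of_nonneg fun _ _ => measureReal_nonneg]
  refine ENNReal.ofReal_le_ofReal ?_
  obtain ⟨m, hm⟩ : ∃ m, ∀ p ∈ t, p.1.1 ≤ m := by
    obtain ⟨m, hm⟩ := (t.image fun p => p.1.1).bddAbove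
    exact ⟨m, fun p hp => hm (Finset.mem_coe.2 (Finset.mem_image_of_mem _ hp))⟩
  refine (Finset.sum_map t (Function.Embedding.subtype _)
    fun p : ℤ × Set (ES n) => (surfMeasure n E).real p.2).symm.le.trans ?_
  set s := t.map (Function.Embedding.subtype _) with hs
  have hs' : ∀ q ∈ s, (q.2 ∈ D.cubes q.1 ∧ P q.1 q.2 ∧ q.2 ⊆ T) ∧ q.1 ≤ m := by
    intro q hq
    obtain ⟨p, hp, rfl⟩ := Finset.mem_map.1 hq
    exact ⟨p.2, hm p hp⟩
  rw [← Finset.sum_filter_add_sum_filter_not s fun q => k ≤ q.1, add_mul]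
  refine add_le_add ?_ ?_
  · refine le_trans (Finset.sum_le_sum_of_subset_of_nonneg ?_ fun _ _ _ => measureReal_nonneg)
      (hP k m T hT)
    intro q hq
    obtain ⟨hq1, hq2⟩ := Finset.mem_filter.1 hq
    obtain ⟨h1, h2⟩ := hs' q hq1
    rw [Finset.mem_filter, h.mem_pairs (h.bounded hT)]
    exact ⟨⟨⟨hq2, h2⟩, h1.1, h1.2.2⟩, h1.2.1⟩
  · have hsub : (s.filter fun q => ¬ k ≤ q.1) ⊆
        (Finset.Ico (k - J) k).image fun j => (j, T) := by
      intro q hq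
      obtain ⟨hq1, hq2⟩ := Finset.mem_filter.1 hq
      obtain ⟨h1, -⟩ := hs' q hq1
      obtain ⟨h3, h4⟩ := hcoarse q.1 q.2 h1.1 h1.2.2 (not_le.1 hq2)
      exact Finset.mem_image.2 ⟨q.1, Finset.mem_Ico.2 ⟨h4, not_le.1 hq2⟩, by rw [← h3]⟩
    refine (Finset.sum_le_sum_of_subset_of_nonneg hsub fun _ _ _ => measureReal_nonneg).trans ?_
    rw [Finset.sum_image fun i _ j _ hij => (Prod.ext_iff.1 hij).1]
    simp

end Nice

namespace Nice

variable {n : ℕ} {E : Set (ES n)} {D : DyadicSystem n E} {Λ : ℝ}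
  {X : Type*} [MetricSpace X] [MeasurableSpace X] [OpensMeasurableSpace X] {μ : Measure X}
  {S : Set X} {Λ' : ℝ}

/-- The total measure of cubes of one generation is controlled by the measure of a set containing
balls that are charged to these cubes through a Lipschitz map. -/
lemma exists_sum_le_measure (h : Nice n E D Λ) (hμ : RegularOn μ S n Λ') {M K c : ℝ} (hM : 0 ≤ M)
    (hK : 0 ≤ K) (hc : 0 < c) :
    ∃ C, 0 ≤ C ∧ ∀ g : X → ES n, (∀ x y, dist (g x) (g y) ≤ M * dist x y) →
      ∀ (j : ℤ) (s : Finset (ℤ × Set (ES n))), (∀ q ∈ s, q.2 ∈ D.cubes q.1 ∧ q.1 = j) →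
      ∀ v : ℤ × Set (ES n) → X,
      (∀ q ∈ s, v q ∈ S ∧ ∃ x ∈ q.2, dist (g (v q)) x ≤ K * scale j) →
      ∀ A, μ A ≠ ⊤ → (∀ q ∈ s, ball (v q) (c * scale j) ⊆ A) →
      ∑ q ∈ s, (surfMeasure n E).real q.2 ≤ C * μ.real A := by
  classical
  have hΛ := h.reg.pos
  have hΛ' := hμ.pos
  set R := M * c + K + Λ with hR
  have hRpos : 0 < R := by positivity
  refine ⟨Λ * Λ' * (8 * R / c) ^ n, by positivity, ?_⟩
  intro g hg j s hs v hv A hA hvA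
  have hℓ := scale_pos j
  obtain ⟨N, hNs, hNsep, hN⟩ := exists_net
    (X := X) (A := (s.image v : Finset X)) (Finset.finite_toSet _).totallyBounded
    (t := c * scale j) (by positivity)
  have hNv : ∀ y ∈ N, ∃ q ∈ s, v q = y := fun y hy =>
    Finset.mem_image.1 (Finset.mem_coe.1 (hNs hy))
  have hcard := hμ.card_mul_le (t := c * scale j) (by positivity)
    (fun y hy => by
      obtain ⟨q, hq, rfl⟩ := hNv y hy
      exact (hv q hq).1) hNsep hA
    (fun y hy => by
      obtain ⟨q, hq, rfl⟩ := hNv y hy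
      refine (ball_subset_ball ?_).trans (hvA q hq)
      linarith [mul_pos hc hℓ])
  set U := ⋃ y ∈ N, closedBall (g y) (R * scale j) with hU
  have hUfin : surfMeasure n E U ≠ ⊤ := h.reg.ne_top_of_bounded
    ((Bornology.isBounded_biUnion_finset _).2 fun _ _ => isBounded_closedBall)
  have hsum : ∑ q ∈ s, (surfMeasure n E).real q.2 ≤ (surfMeasure n E).real U := by
    refine h.sum_measure_le (fun q hq => (hs q hq).1) ?_ ?_ hUfin
    · intro p hp q hq x hxp hxq
      obtain ⟨hp1, hp2⟩ := hs p hp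
      obtain ⟨hq1, hq2⟩ := hs q hq
      have h1 : p.1 = q.1 := hp2.trans hq2.symm
      refine Prod.ext h1 (D.eq_of_mem hp1 ?_ hxp hxq)
      rw [h1]
      exact hq1
    · intro q hq x hx
      obtain ⟨y, hy, hd⟩ := hN (v q) (Finset.mem_coe.2 (Finset.mem_image_of_mem v hq))
      obtain ⟨-, x', hx', hd'⟩ := hv q hq
      refine mem_iUnion₂.2 ⟨y, hy, ?_⟩
      rw [mem_closedBall]
      have h1 := h.dist_le _ _ (hs q hq).1 x hx x' hx'
      rw [(hs q hq).2] at h1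
      have h2 := (hg (v q) y).trans (mul_le_mul_of_nonneg_left hd.le hM)
      have h3 := dist_triangle4 x x' (g (v q)) (g y)
      rw [dist_comm x'] at h3
      rw [hR]
      linarith
  have hmeas : (surfMeasure n E).real U ≤ N.card * (Λ * (4 * (R * scale j)) ^ n) := by
    refine (measureReal_biUnion_finset_le _ _).trans ?_
    refine (Finset.sum_le_sum fun y _ => h.reg.measure_closedBall_le (g y)
      (show 0 < R * scale j by positivity)).trans_eq ?_
    rw [Finset.sum_const, nsmul_eq_mul]
  have hpow : (8 * R / c) ^ n * (c * scale j / 2) ^ n = (4 * (R * scale j)) ^ n := by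
    rw [← mul_pow]
    congr 1
    field_simp
    ring
  calc ∑ q ∈ s, (surfMeasure n E).real q.2 ≤ N.card * (Λ * (4 * (R * scale j)) ^ n) :=
        hsum.trans hmeas
    _ = Λ * Λ' * (8 * R / c) ^ n * (N.card * (Λ'⁻¹ * (c * scale j / 2) ^ n)) := by
        rw [← hpow]
        field_simp
    _ ≤ _ := mul_le_mul_of_nonneg_left hcard (by positivity)

/-- Cubes charged, through a Lipschitz map, to Whitney regions of the complement of a set satisfy
a packing estimate. -/
lemma exists_sum_le_whitney (h : Nice n E D Λ) (hμ : RegularOn μ S n Λ') {M K c : ℝ} (hM : 0 ≤ M)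
    (hK : 0 ≤ K) (hc : 0 < c) :
    ∃ C, 0 ≤ C ∧ ∀ g : X → ES n, (∀ x y, dist (g x) (g y) ≤ M * dist x y) →
      ∀ (k m : ℤ) (s : Finset (ℤ × Set (ES n))),
      (∀ q ∈ s, q.2 ∈ D.cubes q.1 ∧ k ≤ q.1 ∧ q.1 ≤ m) →
      ∀ (v : ℤ × Set (ES n) → X) (G : Set X) (z : X),
      (∀ q ∈ s, v q ∈ S ∧ (∃ x ∈ q.2, dist (g (v q)) x ≤ K * scale q.1) ∧
        c * scale q.1 < infDist (v q) G ∧ infDist (v q) G ≤ K * scale q.1 ∧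
        dist (v q) z ≤ K * scale k) →
      ∑ q ∈ s, (surfMeasure n E).real q.2 ≤ C * scale k ^ n := by
  classical
  have hΛ' := hμ.pos
  obtain ⟨C, hC, hsum⟩ := h.exists_sum_le_measure hμ hM hK (show 0 < c / 2 by positivity)
  obtain ⟨J, hJ⟩ := pow_unbounded_of_one_lt (2 * (K + c) / c) (one_lt_two : (1 : ℝ) < 2)
  refine ⟨C * (J * (Λ' * (2 * (K + c)) ^ n)), by positivity, ?_⟩
  intro g hg k m s hs v G z hv
  set A : ℤ → Set X := fun j => ball z ((K + c) * scale k) ∩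
    {x | c / 2 * scale j < infDist x G ∧ infDist x G < (K + c) * scale j} with hA
  have hk := scale_pos k
  have hB := hμ.measure_ball_ne_top z ((K + c) * scale k)
  rw [← Finset.sum_fiberwise_of_maps_to (t := Finset.Icc k m) (g := Prod.fst) fun q hq =>
    Finset.mem_Icc.2 (hs q hq).2]
  have h1 : ∀ j ∈ Finset.Icc k m, ∑ q ∈ s with q.1 = j, (surfMeasure n E).real q.2 ≤
      C * μ.real (A j) := by
    intro j hj
    have hj' := scale_pos j
    refine hsum g hg j _ (fun q hq => ?_) v (fun q hq => ?_) (A j)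
      (ne_top_of_le_ne_top hB (measure_mono inter_subset_left)) (fun q hq => ?_) <;>
      obtain ⟨hqs, rfl⟩ := Finset.mem_filter.1 hq
    · exact ⟨(hs q hqs).1, rfl⟩
    · exact ⟨(hv q hqs).1, (hv q hqs).2.1⟩
    · intro x hx
      rw [mem_ball] at hx
      obtain ⟨-, -, h3, h4, h5⟩ := hv q hqs
      have h6 := scale_anti (hs q hqs).2.1
      have h7 := mul_le_mul_of_nonneg_left h6 hc.le
      have h8 := dist_triangle x (v q) z
      have h9 := infDist_le_infDist_add_dist (s := G) (x := x) (y := v q)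
      have h10 := infDist_le_infDist_add_dist (s := G) (x := v q) (y := x)
      rw [dist_comm] at h10
      have h11 := mul_pos hc hj'
      refine ⟨?_, ?_, ?_⟩
      · rw [mem_ball]
        linarith
      · linarith
      · linarith
  refine (Finset.sum_le_sum h1).trans ?_
  rw [← Finset.mul_sum, mul_assoc]
  refine mul_le_mul_of_nonneg_left ?_ hC
  refine (sum_measure_le_of_overlap (J := J) hB (fun j _ => ?_)
    (fun j _ => inter_subset_left) ?_).trans ?_
  · exact (isOpen_ball.inter ((isOpen_lt continuous_const (continuous_infDist_pt G)).inter
      (isOpen_lt (continuous_infDist_pt G) continuous_const))).measurableSet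
  · intro i _ j _ hij
    refine Set.disjoint_left.2 fun x hx hx' => ?_
    have h2 := hx.2.1
    have h3 := hx'.2.2
    have h4 := scale_anti hij
    rw [scale_add_nat, le_div_iff₀ (by positivity)] at h4
    rw [div_lt_iff₀ hc] at hJ
    have h5 : c / 2 * scale i < (K + c) * scale j := h2.trans h3
    have h6 := scale_pos j
    have h7 : c / 2 * (scale j * 2 ^ J) ≤ c / 2 * scale i :=
      mul_le_mul_of_nonneg_left h4 (by positivity)
    have h8 := mul_lt_mul_of_pos_left hJ h6
    linarith
  · rw [mul_assoc]
    refine mul_le_mul_of_nonneg_left ?_ (Nat.cast_nonneg J)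
    refine (hμ.measure_ball_le z (by positivity)).trans_eq ?_
    rw [mul_assoc, ← mul_pow]
    ring

end Nice

lemma sum_Icc_sub_le {a d : ℤ → ℝ} (ha : ∀ j, 0 ≤ a j) (hd : ∀ j, d j = a j - a (j - 1))
    {k m : ℤ} (hkm : k ≤ m) : ∑ j ∈ Finset.Icc k m, d j ≤ a m := by
  obtain ⟨N, rfl⟩ : ∃ N : ℕ, m = k + N := ⟨(m - k).toNat, by omega⟩
  clear hkm
  induction N with
  | zero => simpa [hd] using ha (k - 1)
  | succ N ih =>
    have h1 : Finset.Icc k (k + (N + 1 : ℕ)) = insert (k + (N + 1 : ℕ) : ℤ)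
        (Finset.Icc k (k + N)) := by
      ext j
      simp only [Finset.mem_Icc, Finset.mem_insert]
      push_cast
      omega
    rw [h1, Finset.sum_insert (by simp), hd]
    have h2 : k + (N + 1 : ℕ) - 1 = k + (N : ℤ) := by push_cast; ring
    rw [h2]
    linarith

lemma hasCompactSupport_of_norm_le {W : Type*} [NormedAddCommGroup W] [ProperSpace W]
    {F : W → ℝ} {ρ : ℝ} (hF : ∀ w, ρ ≤ ‖w‖ → F w = 0) :
    HasCompactSupport F := by
  refine HasCompactSupport.of_support_subset_isCompact (isCompact_closedBall (0 : W) ρ) ?_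
  intro w hw
  rw [mem_closedBall_zero_iff]
  by_contra! hlt
  exact hw (hF w hlt.le)

section SecondDifferences

variable {W V : Type*} [NormedAddCommGroup W] [InnerProductSpace ℝ W] [FiniteDimensional ℝ W]
  [MeasurableSpace W] [BorelSpace W] [NormedAddCommGroup V] [InnerProductSpace ℝ V]

/-- Second differences of a compactly supported Lipschitz function at dyadic scales are square
summable over scales. -/
lemma sum_measure_secondDiff_le {f : W → V} {M R : ℝ} (hM : 0 ≤ M)
    (hf : ∀ x y, dist (f x) (f y) ≤ M * dist x y) (hfR : ∀ x, R ≤ ‖x‖ → f x = 0)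
    {η : ℝ} (hη : 0 < η) (e : W) {k m : ℤ} (hkm : k ≤ m) :
    ∑ j ∈ Finset.Icc k m, (volume : Measure W).real
        {w | η * scale j ≤ ‖f (w + scale j • e) + f (w - scale j • e) - (2 : ℝ) • f w‖} ≤
      4 * (M * ‖e‖ / η) ^ 2 * (volume : Measure W).real (closedBall 0 (R + scale k * ‖e‖)) := by
  have hcont : Continuous f :=
    (LipschitzWith.of_dist_le_mul (K := M.toNNReal) fun x y => by
      rw [Real.coe_toNNReal _ hM]
      exact hf x y).continuous
  have hzero : ∀ (h : W) (w : W), R + ‖h‖ ≤ ‖w‖ →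
      f w = 0 ∧ f (w + h) = 0 ∧ f (w - h) = 0 := by
    intro h w hw
    have h1 := norm_sub_le (w + h) h
    rw [add_sub_cancel_right] at h1
    have h2 := norm_add_le (w - h) h
    rw [sub_add_cancel] at h2
    exact ⟨hfR _ (by linarith [norm_nonneg h]), hfR _ (by linarith), hfR _ (by linarith)⟩
  have hint1 : ∀ h : W, Integrable fun w => ‖f (w + h) - f w‖ ^ 2 := by
    intro h
    refine Continuous.integrable_of_hasCompactSupport (by fun_prop)
      (hasCompactSupport_of_norm_le (ρ := R + ‖h‖) fun w hw => ?_)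
    obtain ⟨h1, h2, -⟩ := hzero h w hw
    simp [h1, h2]
  have hint2 : ∀ h : W, Integrable fun w => ‖f (w + h) + f (w - h) - (2 : ℝ) • f w‖ ^ 2 := by
    intro h
    refine Continuous.integrable_of_hasCompactSupport (by fun_prop)
      (hasCompactSupport_of_norm_le (ρ := R + ‖h‖) fun w hw => ?_)
    obtain ⟨h1, h2, h3⟩ := hzero h w hw
    simp [h1, h2, h3]
  have hpar : ∀ h : W, ∫ w, ‖f (w + h) + f (w - h) - (2 : ℝ) • f w‖ ^ 2 =
      4 * (∫ w, ‖f (w + h) - f w‖ ^ 2) - ∫ w, ‖f (w + (2 : ℝ) • h) - f w‖ ^ 2 := by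
    intro h
    have e1 : ∀ w, ‖f (w + h) + f (w - h) - (2 : ℝ) • f w‖ ^ 2 =
        2 * ‖f (w + h) - f w‖ ^ 2 + 2 * ‖f (w - h + h) - f (w - h)‖ ^ 2 -
          ‖f (w - h + (2 : ℝ) • h) - f (w - h)‖ ^ 2 := by
      intro w
      have h1 := parallelogram_law_with_norm ℝ (f (w + h) - f w) (f w - f (w - h))
      have h2 : f (w + h) - f w + (f w - f (w - h)) = f (w + h) - f (w - h) := by abel
      have h3 : f (w + h) - f w - (f w - f (w - h)) =
          f (w + h) + f (w - h) - (2 : ℝ) • f w := by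
        rw [two_smul]
        abel
      have h4 : w - h + (2 : ℝ) • h = w + h := by rw [two_smul]; abel
      rw [h2, h3] at h1
      rw [sub_add_cancel, h4]
      nlinarith
    rw [integral_congr_ae (Filter.Eventually.of_forall e1), integral_sub, integral_add,
      integral_const_mul, integral_const_mul,
      integral_sub_right_eq_self (fun w => ‖f (w + h) - f w‖ ^ 2) h,
      integral_sub_right_eq_self (fun w => ‖f (w + (2 : ℝ) • h) - f w‖ ^ 2) h]
    · ring
    · exact (hint1 h).const_mul 2
    · exact ((hint1 h).comp_sub_right h).const_mul 2
    · exact ((hint1 h).const_mul 2).add (((hint1 h).comp_sub_right h).const_mul 2)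
    · exact (hint1 ((2 : ℝ) • h)).comp_sub_right h
  set I : ℤ → ℝ := fun j => ∫ w, ‖f (w + scale j • e) - f w‖ ^ 2 with hI
  have hstep : ∀ j, (volume : Measure W).real
      {w | η * scale j ≤ ‖f (w + scale j • e) + f (w - scale j • e) - (2 : ℝ) • f w‖} ≤
      4 / η ^ 2 * (I j / scale j ^ 2 - I (j - 1) / scale (j - 1) ^ 2) := by
    intro j
    have hj := scale_pos j
    have h1 : scale (j - 1) = 2 * scale j := by
      have := scale_succ (j - 1)
      rw [sub_add_cancel] at this
      linarith
    have h2 := mul_meas_ge_le_integral_of_nonneg (μ := (volume : Measure W))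
      (Filter.Eventually.of_forall fun w => by positivity) (hint2 (scale j • e))
      ((η * scale j) ^ 2)
    rw [hpar, smul_smul, ← h1] at h2
    have h3 : {w | (η * scale j) ^ 2 ≤
        ‖f (w + scale j • e) + f (w - scale j • e) - (2 : ℝ) • f w‖ ^ 2} =
        {w | η * scale j ≤ ‖f (w + scale j • e) + f (w - scale j • e) - (2 : ℝ) • f w‖} := by
      ext w
      exact pow_le_pow_iff_left₀ (by positivity) (norm_nonneg _) two_ne_zero
    rw [h3] at h2
    have h4 : 4 / η ^ 2 * (I j / scale j ^ 2 - I (j - 1) / scale (j - 1) ^ 2) =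
        (4 * I j - I (j - 1)) / (η * scale j) ^ 2 := by
      rw [h1]
      field_simp
      ring
    rw [h4, le_div_iff₀ (by positivity), mul_comm]
    exact h2
  refine (Finset.sum_le_sum fun j _ => hstep j).trans ?_
  rw [← Finset.mul_sum]
  have hm := scale_pos m
  have htel := sum_Icc_sub_le (a := fun j => I j / scale j ^ 2)
    (fun j => div_nonneg (integral_nonneg fun w => by positivity) (by positivity))
    (fun j => rfl) hkm
  have hIm : I m ≤ (M * (scale m * ‖e‖)) ^ 2 *
      (volume : Measure W).real (closedBall 0 (R + scale k * ‖e‖)) := by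
    have h1 : ∀ w ∉ closedBall (0 : W) (R + scale k * ‖e‖), ‖f (w + scale m • e) - f w‖ ^ 2 = 0 := by
      intro w hw
      rw [mem_closedBall_zero_iff, not_le] at hw
      obtain ⟨h2, h3, -⟩ := hzero (scale m • e) w (by
        rw [norm_smul, Real.norm_of_nonneg hm.le]
        have := mul_le_mul_of_nonneg_right (scale_anti hkm) (norm_nonneg e)
        linarith)
      simp [h2, h3]
    rw [hI]
    beta_reduce
    rw [← setIntegral_eq_integral_of_forall_compl_eq_zero h1]
    refine (setIntegral_mono_on (hint1 _).integrableOn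
      (integrableOn_const measure_closedBall_lt_top.ne) measurableSet_closedBall
      (g := fun _ => (M * (scale m * ‖e‖)) ^ 2) fun w _ => ?_).trans ?_
    · have h2 := hf (w + scale m • e) w
      rw [dist_eq_norm, dist_eq_norm, add_sub_cancel_left, norm_smul,
        Real.norm_of_nonneg hm.le] at h2
      exact pow_le_pow_left₀ (norm_nonneg _) h2 2
    · rw [setIntegral_const, smul_eq_mul, mul_comm]
  have h5 : I m / scale m ^ 2 ≤ (M * ‖e‖) ^ 2 *
      (volume : Measure W).real (closedBall 0 (R + scale k * ‖e‖)) := by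
    rw [div_le_iff₀ (by positivity)]
    refine hIm.trans_eq ?_
    ring
  refine (mul_le_mul_of_nonneg_left (htel.trans h5) (by positivity)).trans_eq ?_
  ring

end SecondDifferences

/-- A Lipschitz function whose second differences are small on a large ball is close to an affine
function. -/
lemma exists_affine_of_secondDiff {W V : Type*} [NormedAddCommGroup W] [InnerProductSpace ℝ W]
    [FiniteDimensional ℝ W] [NormedAddCommGroup V] [InnerProductSpace ℝ V] [FiniteDimensional ℝ V]
    {M ε : ℝ} (hM : 0 ≤ M) (hε : 0 < ε) (K : ℝ) :
    ∃ η : ℝ, 0 < η ∧ ∀ f : W → V, (∀ x y, dist (f x) (f y) ≤ M * dist x y) →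
      (∀ v h, ‖v‖ ≤ η⁻¹ → ‖h‖ ≤ η⁻¹ → ‖f (v + h) + f (v - h) - (2 : ℝ) • f v‖ ≤ η) →
      ∃ A : W →ᵃ[ℝ] V, ∀ v ∈ closedBall (0 : W) K, dist (f v) (A v) ≤ ε := by
  by_contra! hcon
  have hη : ∀ i : ℕ, (0 : ℝ) < 1 / (i + 1) := fun i => by positivity
  choose f hf hf2 hfar using fun i : ℕ => hcon (1 / (i + 1)) (hη i)
  set U : Ultrafilter ℕ := Filter.hyperfilter ℕ with hU
  set g : ℕ → W → V := fun i w => f i w - f i 0 with hg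
  have hgl : ∀ i x y, dist (g i x) (g i y) ≤ M * dist x y := fun i x y => by
    rw [hg, dist_sub_right]
    exact hf i x y
  have hlim : ∀ w, ∃ v, Filter.Tendsto (fun j => g j w) U (nhds v) := by
    intro w
    have hcomp : IsCompact (closedBall (0 : V) (M * ‖w‖)) := isCompact_closedBall _ _
    obtain ⟨v, -, hv⟩ := hcomp.ultrafilter_le_nhds (U.map fun j => g j w) (by
      rw [Filter.le_principal_iff]
      change ∀ᶠ j in (U : Filter ℕ), g j w ∈ closedBall (0 : V) _
      refine Filter.Eventually.of_forall fun j => ?_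
      have h1 := hf j w 0
      rwa [dist_zero_right, dist_eq_norm, ← mem_closedBall_zero_iff] at h1)
    exact ⟨v, hv⟩
  choose G hG using hlim
  have hGl : ∀ x y, dist (G x) (G y) ≤ M * dist x y := fun x y =>
    le_of_tendsto ((hG x).dist (hG y)) (Filter.Eventually.of_forall fun j => hgl j x y)
  have hGc : Continuous G :=
    (LipschitzWith.of_dist_le_mul (K := M.toNNReal) fun x y => by
      rw [Real.coe_toNNReal _ hM]
      exact hGl x y).continuous
  have hGmid : ∀ v h, G (v + h) + G (v - h) - (2 : ℝ) • G v = 0 := by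
    intro v h
    rw [← norm_le_zero_iff]
    have h1 : Filter.Tendsto (fun i : ℕ => (1 / (i + 1) : ℝ)) U (nhds 0) :=
      tendsto_one_div_add_atTop_nhds_zero_nat.mono_left Nat.hyperfilter_le_atTop
    refine le_of_tendsto_of_tendsto
      (((hG (v + h)).add (hG (v - h))).sub ((hG v).const_smul (2 : ℝ))).norm h1 ?_
    have h2 : ∀ᶠ i : ℕ in (U : Filter ℕ), (1 / (i + 1) : ℝ) < (1 + ‖v‖ + ‖h‖)⁻¹ :=
      h1.eventually_lt_const (by positivity)
    filter_upwards [h2] with i hi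
    have h3 : 1 + ‖v‖ + ‖h‖ ≤ (1 / (i + 1) : ℝ)⁻¹ := by
      rw [le_inv_comm₀ (by positivity) (hη i)]
      exact hi.le
    have h4 := hf2 i v h (by linarith [norm_nonneg h]) (by linarith [norm_nonneg v])
    refine le_of_eq_of_le (congrArg _ ?_) h4
    rw [hg]
    simp only [two_smul]
    abel
  set A : W →ᵃ[ℝ] V := AffineMap.ofMapMidpoint G (fun x y => by
    have h1 := hGmid (midpoint ℝ x y) ((2 : ℝ)⁻¹ • (x - y))
    have h2 : midpoint ℝ x y + (2 : ℝ)⁻¹ • (x - y) = x := by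
      rw [midpoint_eq_smul_add, invOf_eq_inv, ← smul_add]
      have : x + y + (x - y) = (2 : ℝ) • x := by rw [two_smul]; abel
      rw [this, smul_smul]
      norm_num
    have h3 : midpoint ℝ x y - (2 : ℝ)⁻¹ • (x - y) = y := by
      rw [midpoint_eq_smul_add, invOf_eq_inv, ← smul_sub]
      have : x + y - (x - y) = (2 : ℝ) • y := by rw [two_smul]; abel
      rw [this, smul_smul]
      norm_num
    rw [h2, h3, sub_eq_zero] at h1
    rw [midpoint_eq_smul_add ℝ (G x), h1, invOf_eq_inv, smul_smul]
    norm_num) hGc with hA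
  have hAG : ∀ w, A w = G w := fun w => rfl
  obtain ⟨s, -, -, hnet⟩ := exists_net_of_bounded (A := closedBall (0 : W) K)
    isBounded_closedBall (t := ε / (4 * (M + 1))) (by positivity)
  have h1 : ∀ᶠ j in (U : Filter ℕ), ∀ y ∈ s, dist (g j y) (G y) < ε / 4 :=
    (Finset.eventually_all s).2 fun y _ =>
      (tendsto_iff_dist_tendsto_zero.1 (hG y)).eventually_lt_const (by positivity)
  obtain ⟨j, hj⟩ := h1.exists
  obtain ⟨v, hv, hvfar⟩ := hfar j (A + AffineMap.const ℝ W (f j 0))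
  obtain ⟨y, hy, hvy⟩ := hnet v hv
  have h2 : dist (f j v) ((A + AffineMap.const ℝ W (f j 0)) v) = dist (g j v) (G v) := by
    rw [hg, dist_eq_norm, dist_eq_norm]
    congr 1
    change f j v - (G v + f j 0) = f j v - f j 0 - G v
    abel
  rw [h2] at hvfar
  have h3 := hgl j v y
  have h4 := hGl y v
  rw [dist_comm y] at h4
  have h5 := dist_triangle4 (g j v) (g j y) (G y) (G v)
  have h6 := hj y hy
  have h7 : M * dist v y ≤ (M + 1) * (ε / (4 * (M + 1))) :=
    mul_le_mul (by linarith) hvy.le dist_nonneg (by positivity)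
  have h8 : (M + 1) * (ε / (4 * (M + 1))) = ε / 4 := by field_simp
  linarith

/-- The rescaled form of the comparison of Lipschitz functions with affine functions. -/
lemma exists_affine_of_secondDiff_scale {W V : Type*} [NormedAddCommGroup W]
    [InnerProductSpace ℝ W] [FiniteDimensional ℝ W] [NormedAddCommGroup V] [InnerProductSpace ℝ V]
    [FiniteDimensional ℝ V] {M ε : ℝ} (hM : 0 ≤ M) (hε : 0 < ε) (K : ℝ) :
    ∃ η : ℝ, 0 < η ∧ ∀ f : W → V, (∀ x y, dist (f x) (f y) ≤ M * dist x y) →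
      ∀ u ℓ, 0 < ℓ → (∀ v h, dist v u ≤ η⁻¹ * ℓ → ‖h‖ ≤ η⁻¹ →
        ‖f (v + ℓ • h) + f (v - ℓ • h) - (2 : ℝ) • f v‖ ≤ η * ℓ) →
      ∃ A : W →ᵃ[ℝ] V, ∀ v, dist v u ≤ K * ℓ → dist (f v) (A v) ≤ ε * ℓ := by
  obtain ⟨η, hη, h⟩ := exists_affine_of_secondDiff (W := W) (V := V) hM hε K
  refine ⟨η, hη, fun f hf u ℓ hℓ hsmall => ?_⟩
  obtain ⟨A, hA⟩ := h (fun w => ℓ⁻¹ • f (u + ℓ • w)) (fun x y => by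
      rw [dist_smul₀, Real.norm_of_nonneg (by positivity), inv_mul_le_iff₀ hℓ]
      refine (hf _ _).trans_eq ?_
      rw [dist_add_left, dist_smul₀, Real.norm_of_nonneg hℓ.le]
      ring) (fun v h hv hh => by
      have h1 := hsmall (u + ℓ • v) h (by
        rw [dist_eq_norm, add_sub_cancel_left, norm_smul, Real.norm_of_nonneg hℓ.le, mul_comm]
        exact mul_le_mul_of_nonneg_right hv hℓ.le) hh
      have h2 : ℓ⁻¹ • f (u + ℓ • (v + h)) + ℓ⁻¹ • f (u + ℓ • (v - h)) -
          (2 : ℝ) • ℓ⁻¹ • f (u + ℓ • v) =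
          ℓ⁻¹ • (f (u + ℓ • v + ℓ • h) + f (u + ℓ • v - ℓ • h) - (2 : ℝ) • f (u + ℓ • v)) := by
        rw [smul_add ℓ, smul_sub ℓ, ← add_assoc, ← add_sub_assoc, smul_comm (2 : ℝ), ← smul_add,
          ← smul_sub]
      rw [h2, norm_smul, Real.norm_of_nonneg (by positivity), inv_mul_le_iff₀ hℓ, mul_comm]
      exact h1)
  refine ⟨ℓ • (A.comp (ℓ⁻¹ • (AffineMap.id ℝ W - AffineMap.const ℝ W u))), fun v hv => ?_⟩
  have h3 := hA (ℓ⁻¹ • (v - u)) (by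
    rw [mem_closedBall_zero_iff, norm_smul, Real.norm_of_nonneg (by positivity),
      inv_mul_le_iff₀ hℓ, ← dist_eq_norm, mul_comm]
    exact hv)
  have h4 : u + ℓ • ℓ⁻¹ • (v - u) = v := by
    rw [smul_smul, mul_inv_cancel₀ hℓ.ne', one_smul]
    abel
  beta_reduce at h3
  rw [h4] at h3
  have h5 : (ℓ • (A.comp (ℓ⁻¹ • (AffineMap.id ℝ W - AffineMap.const ℝ W u)))) v =
      ℓ • A (ℓ⁻¹ • (v - u)) := rfl
  have h6 : f v = ℓ • ℓ⁻¹ • f v := by rw [smul_smul, mul_inv_cancel₀ hℓ.ne', one_smul]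
  rw [h5, h6, dist_smul₀, Real.norm_of_nonneg hℓ.le, mul_comm]
  exact mul_le_mul_of_nonneg_right h3 hℓ.le

/-- A Lipschitz function agrees on a ball, up to a constant, with a compactly supported Lipschitz
function. -/
lemma exists_compactSupport_extension {W V : Type*} [NormedAddCommGroup W] [NormedAddCommGroup V]
    [NormedSpace ℝ V] [FiniteDimensional ℝ V] {g : W → V} {M : ℝ≥0}
    (hg : ∀ x y, dist (g x) (g y) ≤ M * dist x y) (R : ℝ) :
    ∃ f : W → V, (∀ x y, dist (f x) (f y) ≤ (lipschitzExtensionConstant V * M : ℝ≥0) * dist x y) ∧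
      (∀ x, ‖x‖ ≤ R → f x = g x - g 0) ∧ ∀ x, 2 * R < ‖x‖ → f x = 0 := by
  classical
  set F : W → V := fun x => if ‖x‖ ≤ R then g x - g 0 else 0 with hF
  have hin : ∀ x, ‖x‖ ≤ R → F x = g x - g 0 := fun x hx => if_pos hx
  have hout : ∀ x, ¬ ‖x‖ ≤ R → F x = 0 := fun x hx => if_neg hx
  have hmixed : ∀ x y, ‖x‖ ≤ R → 2 * R < ‖y‖ → ‖g x - g 0‖ ≤ M * dist x y := by
    intro x y hx hy
    have h1 := hg x 0
    rw [dist_zero_right, dist_eq_norm] at h1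
    have h2 : ‖x‖ ≤ dist x y := by
      have := norm_sub_norm_le y x
      rw [dist_comm, dist_eq_norm]
      linarith
    exact h1.trans (mul_le_mul_of_nonneg_left h2 M.2)
  have hlip : LipschitzOnWith M F {x | ‖x‖ ≤ R ∨ 2 * R < ‖x‖} := by
    refine LipschitzOnWith.of_dist_le_mul fun x hx y hy => ?_
    by_cases hx' : ‖x‖ ≤ R <;> by_cases hy' : ‖y‖ ≤ R
    · rw [hin x hx', hin y hy', dist_sub_right]
      exact hg x y
    · rw [hin x hx', hout y hy', dist_zero_right]
      exact hmixed x y hx' (hy.resolve_left hy')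
    · rw [hout x hx', hin y hy', dist_zero_left, dist_comm]
      exact hmixed y x hy' (hx.resolve_left hx')
    · rw [hout x hx', hout y hy', dist_self]
      positivity
  obtain ⟨f, hf, hfF⟩ := hlip.extend_finite_dimension
  refine ⟨f, fun x y => hf.dist_le_mul x y, fun x hx => ?_, fun x hx => ?_⟩
  · rw [← hfF (Or.inl hx), hin x hx]
  · rw [← hfF (Or.inr hx)]
    by_cases hx' : ‖x‖ ≤ R
    · have h1 : ‖x‖ = 0 := le_antisymm (by linarith) (norm_nonneg x)
      rw [hin x hx', norm_eq_zero.1 h1, sub_self]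
    · exact hout x hx'

namespace Nice

variable {n : ℕ} {E : Set (ES n)} {D : DyadicSystem n E} {Λ : ℝ}

/-- Cubes charged to points at which a Lipschitz map has large second differences satisfy a packing
estimate. -/
lemma exists_sum_le_secondDiff (h : Nice n E D Λ) (M : ℝ≥0) {K η : ℝ} (hK : 0 ≤ K)
    (hη : 0 < η) :
    ∃ C, 0 ≤ C ∧ ∀ g : EuclideanSpace ℝ (Fin n) → ES n,
      (∀ x y, dist (g x) (g y) ≤ M * dist x y) →
      ∀ (k m : ℤ), k ≤ m → ∀ s : Finset (ℤ × Set (ES n)),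
      (∀ q ∈ s, q.2 ∈ D.cubes q.1 ∧ k ≤ q.1 ∧ q.1 ≤ m) →
      ∀ v d : ℤ × Set (ES n) → EuclideanSpace ℝ (Fin n),
      (∀ q ∈ s, (∃ x ∈ q.2, dist (g (v q)) x ≤ K * scale q.1) ∧
        ‖v q‖ ≤ K * scale k ∧ ‖d q‖ ≤ K ∧ η * scale q.1 <
          ‖g (v q + scale q.1 • d q) + g (v q - scale q.1 • d q) - (2 : ℝ) • g (v q)‖) →
      ∑ q ∈ s, (surfMeasure n E).real q.2 ≤ C * scale k ^ n := by
  classical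
  obtain ⟨Λ', hμ⟩ := regularOn_volume n
  have hΛ' := hμ.pos
  have hM := M.2
  set t := η / (8 * (M + 1)) with ht
  set c := η / (16 * (M + 1)) with hc
  have htpos : 0 < t := by positivity
  have hcpos : 0 < c := by positivity
  have htc : 4 * M * c + 2 * M * t ≤ η / 2 := by
    have h1 : 4 * (M + 1) * c + 2 * (M + 1) * t = η / 2 := by
      rw [ht, hc]
      field_simp
      norm_num
    nlinarith
  obtain ⟨N, hNK, -, hN⟩ := exists_net_of_bounded
    (A := closedBall (0 : EuclideanSpace ℝ (Fin n)) K) isBounded_closedBall htpos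
  obtain ⟨C, hC, hsum⟩ := h.exists_sum_le_measure hμ hM hK hcpos
  set M' : ℝ := ((lipschitzExtensionConstant (ES n) * M : ℝ≥0) : ℝ) with hM'
  have hM'0 : 0 ≤ M' := NNReal.coe_nonneg _
  set R := 2 * (2 * K + c) + c + K with hR
  have hRpos : 0 < R := by positivity
  refine ⟨N.card * (C * (4 * (M' * K / (η / 2)) ^ 2 * (Λ' * (4 * R) ^ n))), by positivity, ?_⟩
  intro g hg k m hkm s hs v d hvd
  have hk := scale_pos k
  obtain ⟨f, hf, hfg, hf0⟩ := exists_compactSupport_extension hg ((2 * K + c) * scale k)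
  have hf0' : ∀ x, (2 * (2 * K + c) + c) * scale k ≤ ‖x‖ → f x = 0 := fun x hx =>
    hf0 x (by linarith [mul_pos hcpos hk])
  have hnear : ∀ q, ∃ e, q ∈ s → e ∈ N ∧ dist (d q) e < t := by
    intro q
    by_cases hq : q ∈ s
    · obtain ⟨e, he, hd⟩ := hN (d q) (mem_closedBall_zero_iff.2 (hvd q hq).2.2.1)
      exact ⟨e, fun _ => ⟨he, hd⟩⟩
    · exact ⟨0, fun hq' => absurd hq' hq⟩
  choose e he using hnear
  set A : EuclideanSpace ℝ (Fin n) → ℤ → Set (EuclideanSpace ℝ (Fin n)) := fun e j =>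
    {w | η / 2 * scale j ≤ ‖f (w + scale j • e) + f (w - scale j • e) - (2 : ℝ) • f w‖} with hA
  have hAfin : ∀ e j, volume (A e j) ≠ ⊤ := by
    intro e j
    have hj := scale_pos j
    suffices hb : A e j ⊆ closedBall 0 ((2 * (2 * K + c) + c) * scale k + ‖scale j • e‖) from
      (isBounded_closedBall.subset hb).measure_lt_top.ne
    intro w hw
    rw [mem_closedBall_zero_iff]
    by_contra! hlt
    have h1 := norm_sub_le (w + scale j • e) (scale j • e)
    rw [add_sub_cancel_right] at h1
    have h2 := norm_add_le (w - scale j • e) (scale j • e)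
    rw [sub_add_cancel] at h2
    have h3 : η / 2 * scale j ≤ ‖f (w + scale j • e) + f (w - scale j • e) - (2 : ℝ) • f w‖ := hw
    rw [hf0' w (by linarith [norm_nonneg (scale j • e)]), hf0' (w + scale j • e) (by linarith),
      hf0' (w - scale j • e) (by linarith)] at h3
    simp only [smul_zero, add_zero, sub_zero, norm_zero] at h3
    have : 0 < η / 2 * scale j := by positivity
    linarith
  have hball : ∀ q ∈ s, ball (v q) (c * scale q.1) ⊆ A (e q) q.1 := by
    intro q hq w hw
    obtain ⟨-, hv, -, hbig⟩ := hvd q hq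
    obtain ⟨heN, hde⟩ := he q hq
    have hj := scale_pos q.1
    have hjk := scale_anti (hs q hq).2.1
    set ℓ := scale q.1
    rw [mem_ball, dist_eq_norm] at hw
    have heK : ‖e q‖ ≤ K := mem_closedBall_zero_iff.1 (hNK heN)
    have h1 : ‖ℓ • e q‖ ≤ K * ℓ := by
      rw [norm_smul, Real.norm_of_nonneg hj.le, mul_comm]
      exact mul_le_mul_of_nonneg_right heK hj.le
    have h2 := mul_le_mul_of_nonneg_left hjk hK
    have h3 := mul_le_mul_of_nonneg_left hjk hcpos.le
    have h4 : ‖w‖ ≤ K * scale k + c * scale k := by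
      have := norm_add_le (w - v q) (v q)
      rw [sub_add_cancel] at this
      linarith
    have h5 := norm_add_le w (ℓ • e q)
    have h6 := norm_sub_le w (ℓ • e q)
    have h7 := mul_nonneg hK hk.le
    change η / 2 * ℓ ≤ ‖f (w + ℓ • e q) + f (w - ℓ • e q) - (2 : ℝ) • f w‖
    rw [hfg w (by linarith), hfg (w + ℓ • e q) (by linarith), hfg (w - ℓ • e q) (by linarith)]
    have h8 : g (w + ℓ • e q) - g 0 + (g (w - ℓ • e q) - g 0) - (2 : ℝ) • (g w - g 0) =
        (g (v q + ℓ • d q) + g (v q - ℓ • d q) - (2 : ℝ) • g (v q)) -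
        ((g (v q + ℓ • d q) - g (w + ℓ • e q)) + (g (v q - ℓ • d q) - g (w - ℓ • e q)) -
          (2 : ℝ) • (g (v q) - g w)) := by
      simp only [two_smul]
      abel
    rw [h8]
    have h9 : ‖v q - w‖ ≤ c * ℓ := by
      rw [norm_sub_rev]
      exact hw.le
    have h10 : ‖ℓ • d q - ℓ • e q‖ ≤ t * ℓ := by
      rw [← smul_sub, norm_smul, Real.norm_of_nonneg hj.le, mul_comm, ← dist_eq_norm]
      exact mul_le_mul_of_nonneg_right hde.le hj.le
    have h11 : ‖g (v q) - g w‖ ≤ M * (c * ℓ) := by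
      rw [← dist_eq_norm]
      refine (hg _ _).trans (mul_le_mul_of_nonneg_left ?_ hM)
      rwa [dist_eq_norm]
    have h12 : ‖g (v q + ℓ • d q) - g (w + ℓ • e q)‖ ≤ M * (c * ℓ + t * ℓ) := by
      rw [← dist_eq_norm]
      refine (hg _ _).trans (mul_le_mul_of_nonneg_left ?_ hM)
      rw [dist_eq_norm, add_sub_add_comm]
      exact (norm_add_le _ _).trans (add_le_add h9 h10)
    have h13 : ‖g (v q - ℓ • d q) - g (w - ℓ • e q)‖ ≤ M * (c * ℓ + t * ℓ) := by
      rw [← dist_eq_norm]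
      refine (hg _ _).trans (mul_le_mul_of_nonneg_left ?_ hM)
      rw [dist_eq_norm, sub_sub_sub_comm]
      exact (norm_sub_le _ _).trans (add_le_add h9 h10)
    have h14 : ‖(g (v q + ℓ • d q) - g (w + ℓ • e q)) + (g (v q - ℓ • d q) - g (w - ℓ • e q)) -
        (2 : ℝ) • (g (v q) - g w)‖ ≤ η / 2 * ℓ := by
      refine (norm_sub_le _ _).trans ?_
      have h15 := norm_add_le (g (v q + ℓ • d q) - g (w + ℓ • e q))
        (g (v q - ℓ • d q) - g (w - ℓ • e q))
      have h16 := mul_le_mul_of_nonneg_right htc hj.le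
      rw [norm_smul, Real.norm_two]
      linarith
    have h17 := norm_sub_norm_le
      (g (v q + ℓ • d q) + g (v q - ℓ • d q) - (2 : ℝ) • g (v q))
      ((g (v q + ℓ • d q) - g (w + ℓ • e q)) + (g (v q - ℓ • d q) - g (w - ℓ • e q)) -
        (2 : ℝ) • (g (v q) - g w))
    linarith
  rw [← Finset.sum_fiberwise_of_maps_to (t := N) (g := e) fun q hq => (he q hq).1]
  have hone : ∀ x ∈ N, ∑ q ∈ s with e q = x, (surfMeasure n E).real q.2 ≤
      C * (4 * (M' * K / (η / 2)) ^ 2 * (Λ' * (4 * R) ^ n)) * scale k ^ n := by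
    intro x hx
    have hxK : ‖x‖ ≤ K := mem_closedBall_zero_iff.1 (hNK hx)
    rw [← Finset.sum_fiberwise_of_maps_to (t := Finset.Icc k m) (g := Prod.fst) fun q hq =>
      Finset.mem_Icc.2 (hs q (Finset.mem_filter.1 hq).1).2]
    have h1 : ∀ j ∈ Finset.Icc k m, ∑ q ∈ {q ∈ s | e q = x} with q.1 = j,
        (surfMeasure n E).real q.2 ≤ C * (volume : Measure _).real (A x j) := by
      intro j _
      refine hsum g hg j _ (fun q hq => ?_) v (fun q hq => ?_) (A x j) (hAfin x j)
        (fun q hq => ?_) <;>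
        obtain ⟨hq', rfl⟩ := Finset.mem_filter.1 hq <;>
        obtain ⟨hqs, rfl⟩ := Finset.mem_filter.1 hq'
      · exact ⟨(hs q hqs).1, rfl⟩
      · exact ⟨mem_univ _, (hvd q hqs).1⟩
      · exact hball q hqs
    refine (Finset.sum_le_sum h1).trans ?_
    rw [← Finset.mul_sum, mul_assoc]
    refine mul_le_mul_of_nonneg_left ?_ hC
    refine (sum_measure_secondDiff_le hM'0 hf hf0' (half_pos hη) x hkm).trans ?_
    have h2 : (volume : Measure (EuclideanSpace ℝ (Fin n))).real
        (closedBall 0 ((2 * (2 * K + c) + c) * scale k + scale k * ‖x‖)) ≤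
        Λ' * (4 * R) ^ n * scale k ^ n := by
      refine (measureReal_mono (closedBall_subset_closedBall ?_) measure_closedBall_lt_top.ne).trans
        ((hμ.measure_closedBall_le 0 (show 0 < R * scale k by positivity)).trans_eq ?_)
      · have := mul_le_mul_of_nonneg_left hxK hk.le
        rw [hR]
        linarith
      · rw [← mul_assoc, mul_pow, mul_assoc]
    have h3 : (M' * ‖x‖ / (η / 2)) ^ 2 ≤ (M' * K / (η / 2)) ^ 2 := by gcongr
    have h4 := mul_le_mul h3 h2 measureReal_nonneg (by positivity)
    linarith
  refine (Finset.sum_le_sum hone).trans_eq ?_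
  rw [Finset.sum_const, nsmul_eq_mul]
  ring

end Nice

/-- The image of a ball under a Lipschitz map that is nearly constant in some direction is small. -/
lemma RegularOn.measure_image_le_of_narrow {X : Type*} [MetricSpace X] [MeasurableSpace X]
    {μ : Measure X} {S : Set X} {n : ℕ} {Λ Λ' : ℝ} (hμ : RegularOn μ S n Λ)
    (hvol : RegularOn (volume : Measure (EuclideanSpace ℝ (Fin n))) univ n Λ')
    {f : EuclideanSpace ℝ (Fin n) → X} {M δ ℓ : ℝ} (hM : 1 ≤ M)
    (hf : ∀ x y, dist (f x) (f y) ≤ M * dist x y) (hδ : 0 < δ) (hδ1 : δ ≤ 1) (hℓ : 0 < ℓ)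
    {e u : EuclideanSpace ℝ (Fin n)} (he : ‖e‖ = 1)
    (hnar : ∀ w ∈ closedBall u (5 * ℓ), ∀ t, 0 ≤ t → t ≤ ℓ →
      dist (f (w + t • e)) (f w) ≤ δ * ℓ) :
    μ.real (S ∩ f '' closedBall u (5 * ℓ)) ≤ Λ' ^ 2 * Λ * (256 * M) ^ n * δ * ℓ ^ n := by
  classical
  have hδℓ : 0 < δ * ℓ := mul_pos hδ hℓ
  have hM0 : 0 < M := by linarith
  have hΛ := hμ.pos
  have hΛ' := hvol.pos
  have hcont : Continuous f :=
    (LipschitzWith.of_dist_le_mul (K := M.toNNReal) fun x y => by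
      rw [Real.coe_toNNReal _ hM0.le]
      exact hf x y).continuous
  obtain ⟨s, hsA, hsep, hnet⟩ := exists_net (A := S ∩ f '' closedBall u (5 * ℓ))
    (((isCompact_closedBall u (5 * ℓ)).image hcont).totallyBounded.subset inter_subset_right)
    (show 0 < 4 * δ * ℓ by positivity)
  have hpre : ∀ y, ∃ w, y ∈ s → w ∈ closedBall u (5 * ℓ) ∧ f w = y := by
    intro y
    by_cases hy : y ∈ s
    · obtain ⟨w, hw, hwy⟩ := (hsA hy).2
      exact ⟨w, fun _ => ⟨hw, hwy⟩⟩
    · exact ⟨u, fun hy' => absurd hy' hy⟩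
  choose w hw using hpre
  set N := ⌊1 / δ⌋₊ with hN
  have hNδ : (N : ℝ) * δ ≤ 1 := by
    have := Nat.floor_le (show 0 ≤ 1 / δ by positivity)
    rwa [le_div_iff₀ hδ] at this
  have hNδ' : 1 ≤ ((N : ℝ) + 1) * δ := by
    have := Nat.lt_floor_add_one (1 / δ)
    rw [div_lt_iff₀ hδ] at this
    exact this.le
  set p : X × ℕ → EuclideanSpace ℝ (Fin n) := fun a => w a.1 + ((a.2 : ℝ) * (δ * ℓ)) • e with hp
  have hstep : ∀ q ∈ Finset.range (N + 1), 0 ≤ (q : ℝ) * (δ * ℓ) ∧ (q : ℝ) * (δ * ℓ) ≤ ℓ := by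
    intro q hq
    have h1 : (q : ℝ) ≤ N := by exact_mod_cast Nat.lt_succ_iff.1 (Finset.mem_range.1 hq)
    refine ⟨by positivity, ?_⟩
    have h2 := mul_le_mul_of_nonneg_right h1 hδℓ.le
    have h3 := mul_le_mul_of_nonneg_right hNδ hℓ.le
    linarith
  set t := δ * ℓ / M with ht
  have htpos : 0 < t := div_pos hδℓ hM0
  have hMt : M * t = δ * ℓ := mul_div_cancel₀ _ hM0.ne'
  have htℓ : t ≤ δ * ℓ := div_le_self hδℓ.le hM
  have hpsep : ∀ a ∈ s ×ˢ Finset.range (N + 1), ∀ b ∈ s ×ˢ Finset.range (N + 1), a ≠ b →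
      t ≤ dist (p a) (p b) := by
    rintro ⟨y, q⟩ ha ⟨y', q'⟩ hb hab
    obtain ⟨hy, hq⟩ := Finset.mem_product.1 ha
    obtain ⟨hy', hq'⟩ := Finset.mem_product.1 hb
    by_cases hyy : y = y'
    · subst hyy
      have hqq : q ≠ q' := fun h => hab (by rw [h])
      have h1 : (1 : ℝ) ≤ |(q : ℝ) - q'| := by
        have h2 : (1 : ℤ) ≤ |(q : ℤ) - q'| := Int.one_le_abs (by omega)
        exact_mod_cast h2
      rw [hp]
      simp only [dist_add_left]
      rw [dist_eq_norm, ← sub_smul, norm_smul, he, mul_one, ← sub_mul, Real.norm_eq_abs, abs_mul,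
        abs_of_pos hδℓ]
      exact htℓ.trans (le_mul_of_one_le_left hδℓ.le h1)
    · have h1 := hsep y hy y' hy' hyy
      obtain ⟨hwy, hfy⟩ := hw y hy
      obtain ⟨hwy', hfy'⟩ := hw y' hy'
      have h2 : dist (f (p (y, q))) (f (w y)) ≤ δ * ℓ :=
        hnar _ hwy _ (hstep q hq).1 (hstep q hq).2
      have h3 : dist (f (p (y', q'))) (f (w y')) ≤ δ * ℓ :=
        hnar _ hwy' _ (hstep q' hq').1 (hstep q' hq').2
      rw [hfy] at h2
      rw [hfy'] at h3
      have h4 := hf (p (y, q)) (p (y', q'))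
      have h5 := dist_triangle4 y (f (p (y, q))) (f (p (y', q'))) y'
      rw [dist_comm y (f (p (y, q)))] at h5
      have h6 : M * t ≤ M * dist (p (y, q)) (p (y', q')) := by
        rw [hMt]
        linarith
      exact le_of_mul_le_mul_left h6 hM0
  have hinj : Set.InjOn p ↑(s ×ˢ Finset.range (N + 1)) := by
    intro a ha b hb hab
    by_contra hne
    have := hpsep a ha b hb hne
    rw [hab, dist_self] at this
    linarith
  have hcard := hvol.card_le_of_subset_ball (s := (s ×ˢ Finset.range (N + 1)).image p) (x := u)
    htpos (show 0 < 7 * ℓ by positivity) (subset_univ _)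
    (by
      intro a ha b hb hab
      obtain ⟨a', ha', rfl⟩ := Finset.mem_image.1 ha
      obtain ⟨b', hb', rfl⟩ := Finset.mem_image.1 hb
      exact hpsep a' ha' b' hb' fun h => hab (by rw [h]))
    (by
      intro a ha
      obtain ⟨⟨y, q⟩, ha', rfl⟩ := Finset.mem_image.1 ha
      obtain ⟨hy, hq⟩ := Finset.mem_product.1 ha'
      have h1 := mem_closedBall.1 (hw y hy).1
      have h2 : dist (p (y, q)) (w y) ≤ ℓ := by
        rw [hp, dist_eq_norm, add_sub_cancel_left, norm_smul, he, mul_one,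
          Real.norm_of_nonneg (hstep q hq).1]
        exact (hstep q hq).2
      have h3 := dist_triangle (p (y, q)) (w y) u
      linarith)
  rw [Finset.card_image_of_injOn hinj, Finset.card_product, Finset.card_range] at hcard
  push_cast at hcard
  have hratio : 4 * (7 * ℓ + t) / t ≤ 32 * M / δ := by
    rw [div_le_div_iff₀ htpos hδ]
    have h1 : t ≤ ℓ := htℓ.trans (mul_le_of_le_one_left hℓ.le hδ1)
    have h2 := mul_le_mul_of_nonneg_right h1 hδ.le
    have h3 : 32 * M * t = 32 * (δ * ℓ) := by rw [mul_assoc, hMt]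
    rw [h3]
    nlinarith
  have hcard' : (s.card : ℝ) ≤ δ * (Λ' ^ 2 * (32 * M / δ) ^ n) := by
    have h1 : Λ' ^ 2 * (4 * (7 * ℓ + t) / t) ^ n ≤ Λ' ^ 2 * (32 * M / δ) ^ n := by gcongr
    have h2 := mul_le_mul_of_nonneg_left (hcard.trans h1) hδ.le
    have h3 := mul_le_mul_of_nonneg_left hNδ' (Nat.cast_nonneg (α := ℝ) s.card)
    linarith
  have hmeas := hμ.measure_le_of_net (show 0 < 4 * δ * ℓ by positivity) hnet
  refine hmeas.trans ((mul_le_mul_of_nonneg_right hcard' (by positivity)).trans_eq ?_)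
  have h1 : (256 * M) ^ n * ℓ ^ n = (32 * M / δ) ^ n * (2 * (4 * δ * ℓ)) ^ n := by
    rw [← mul_pow, ← mul_pow]
    congr 1
    field_simp
    norm_num
  calc δ * (Λ' ^ 2 * (32 * M / δ) ^ n) * (Λ * (2 * (4 * δ * ℓ)) ^ n)
      = Λ' ^ 2 * Λ * δ * ((32 * M / δ) ^ n * (2 * (4 * δ * ℓ)) ^ n) := by ring
    _ = Λ' ^ 2 * Λ * (256 * M) ^ n * δ * ℓ ^ n := by rw [← h1]; ring

/-- Vitali covering: a set of points around each of which the image of some ball is small has a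
small image. -/
lemma RegularOn.measure_image_le_of_vitali {X : Type*} [MeasurableSpace X] {μ : Measure X}
    {S : Set X} {n : ℕ} {Λ : ℝ}
    (hvol : RegularOn (volume : Measure (EuclideanSpace ℝ (Fin n))) univ n Λ)
    {f : EuclideanSpace ℝ (Fin n) → X} {c R : ℝ} (hc : 0 ≤ c)
    {B : Set (EuclideanSpace ℝ (Fin n))}
    (hB : ∀ u ∈ B, ∃ ℓ, 0 < ℓ ∧ closedBall u ℓ ⊆ closedBall 0 R ∧ ℓ ≤ R ∧
      μ (S ∩ f '' closedBall u (5 * ℓ)) ≤ ENNReal.ofReal (c * ℓ ^ n)) :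
    μ (S ∩ f '' B) ≤
      ENNReal.ofReal (c * Λ) * (volume : Measure (EuclideanSpace ℝ (Fin n))) (closedBall 0 R) := by
  have hex : ∀ u, ∃ ℓ, u ∈ B → 0 < ℓ ∧ closedBall u ℓ ⊆ closedBall 0 R ∧ ℓ ≤ R ∧
      μ (S ∩ f '' closedBall u (5 * ℓ)) ≤ ENNReal.ofReal (c * ℓ ^ n) := by
    intro u
    by_cases hu : u ∈ B
    · obtain ⟨ℓ, hℓ⟩ := hB u hu
      exact ⟨ℓ, fun _ => hℓ⟩
    · exact ⟨0, fun hu' => absurd hu' hu⟩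
  choose ℓ hℓ using hex
  obtain ⟨U, hUB, hdisj, hcover⟩ := Vitali.exists_disjoint_subfamily_covering_enlargement_closedBall
    B (fun u => u) ℓ R (fun a ha => (hℓ a ha).2.2.1) 5 (by norm_num)
  have hUc : U.Countable := hdisj.countable_of_nonempty_interior fun u hu => by
    refine ⟨u, ?_⟩
    exact ball_subset_interior_closedBall (mem_ball_self (hℓ u (hUB hu)).1)
  have hsub : S ∩ f '' B ⊆ ⋃ b ∈ U, S ∩ f '' closedBall b (5 * ℓ b) := by
    rintro _ ⟨hxS, u, hu, rfl⟩
    obtain ⟨b, hb, hub⟩ := hcover u hu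
    exact mem_iUnion₂.2 ⟨b, hb, hxS, u, hub (mem_closedBall_self (hℓ u hu).1.le), rfl⟩
  calc μ (S ∩ f '' B) ≤ ∑' b : U, μ (S ∩ f '' closedBall (b : EuclideanSpace ℝ (Fin n)) (5 * ℓ b)) :=
        (measure_mono hsub).trans (measure_biUnion_le μ hUc _)
    _ ≤ ∑' b : U, ENNReal.ofReal (c * Λ) *
        (volume : Measure (EuclideanSpace ℝ (Fin n))) (closedBall b (ℓ b)) := by
        refine ENNReal.tsum_le_tsum fun b => (hℓ b (hUB b.2)).2.2.2.trans ?_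
        have hpos := (hℓ b (hUB b.2)).1
        have h1 := hvol.lower (b : EuclideanSpace ℝ (Fin n)) (mem_univ _) _ hpos
        have h2 : (volume : Measure (EuclideanSpace ℝ (Fin n))).real (ball b (ℓ b)) ≤
            (volume : Measure (EuclideanSpace ℝ (Fin n))).real (closedBall b (ℓ b)) :=
          measureReal_mono ball_subset_closedBall measure_closedBall_lt_top.ne
        rw [← ENNReal.ofReal_toReal (measure_closedBall_lt_top (μ := volume)
          (x := (b : EuclideanSpace ℝ (Fin n)))).ne, ← ENNReal.ofReal_mul
          (mul_nonneg hc hvol.pos.le), mul_assoc]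
        refine ENNReal.ofReal_le_ofReal (mul_le_mul_of_nonneg_left ?_ hc)
        have h3 := mul_le_mul_of_nonneg_left (h1.trans h2) hvol.pos.le
        rwa [← mul_assoc, mul_inv_cancel₀ hvol.pos.ne', one_mul] at h3
    _ = ENNReal.ofReal (c * Λ) *
        (volume : Measure (EuclideanSpace ℝ (Fin n))) (⋃ b ∈ U, closedBall b (ℓ b)) := by
        rw [measure_biUnion hUc hdisj fun b _ => measurableSet_closedBall, ENNReal.tsum_mul_left]
    _ ≤ _ := by
        refine mul_le_mul_right (measure_mono (iUnion₂_subset fun b hb => ?_)) _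
        exact (hℓ b (hUB hb)).2.1

/-- The range of an injective affine map from `ℝ^n` is a hyperplane of `ℝ^{n+1}`. -/
lemma isHyperplane_range {n : ℕ} (A : EuclideanSpace ℝ (Fin n) →ᵃ[ℝ] ES n)
    (hA : Function.Injective A.linear) : IsHyperplane (range A) := by
  have h1 := (LinearMap.range A.linear).finrank_add_finrank_orthogonal
  rw [LinearMap.finrank_range_of_inj hA, finrank_euclideanSpace_fin,
    finrank_euclideanSpace_fin] at h1
  have h2 : Module.finrank ℝ (LinearMap.range A.linear)ᗮ = 1 := by omega
  obtain ⟨⟨v, hv⟩, hv0, hspan⟩ := finrank_eq_one_iff'.1 h2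
  have hvne : v ≠ 0 := fun h => hv0 (Subtype.ext h)
  have hnorm : ‖v‖ ≠ 0 := norm_ne_zero_iff.2 hvne
  have hmem : ∀ w, w ∈ LinearMap.range A.linear ↔ ⟪v, w⟫_ℝ = 0 := by
    intro w
    constructor
    · exact fun hw => Submodule.inner_left_of_mem_orthogonal hw hv
    · intro hw
      rw [← (LinearMap.range A.linear).orthogonal_orthogonal, Submodule.mem_orthogonal]
      intro x hx
      obtain ⟨c, hc⟩ := hspan ⟨x, hx⟩
      have hc' : c • v = x := congrArg Subtype.val hc
      rw [← hc', inner_smul_left, hw, mul_zero]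
  refine ⟨(‖v‖⁻¹ : ℝ) • v, ⟪(‖v‖⁻¹ : ℝ) • v, A 0⟫_ℝ, ?_, ?_⟩
  · rw [norm_smul, norm_inv, norm_norm, inv_mul_cancel₀ hnorm]
  · ext Z
    have h3 : Z ∈ range A ↔ Z - A 0 ∈ LinearMap.range A.linear := by
      constructor
      · rintro ⟨u, rfl⟩
        refine ⟨u, ?_⟩
        have := A.linearMap_vsub u 0
        simpa using this
      · rintro ⟨u, hu⟩
        refine ⟨u, ?_⟩
        have := A.linearMap_vsub u 0
        simp only [vsub_eq_sub, sub_zero] at this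
        rw [this] at hu
        exact sub_left_injective hu
    rw [h3, hmem, mem_ofPred_eq, ← sub_eq_zero (a := ⟪(‖v‖⁻¹ : ℝ) • v, Z⟫_ℝ), ← inner_sub_right,
      inner_smul_left]
    simp [hnorm]

namespace Nice

variable {n : ℕ} {E : Set (ES n)} {D : DyadicSystem n E} {Λ : ℝ}

/-- In a uniformly rectifiable set, a definite proportion of each cube is covered by a Lipschitz
image that is not narrow at any of the finitely many scales considered. -/
lemma exists_nonnarrow_part (h : Nice n E D Λ) (hdiam : EMetric.diam E = ⊤) {θ M₀ : ℝ}
    (hUR : IsUR n θ M₀ E) :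
    ∃ (θ' δ : ℝ) (M : ℝ≥0), 0 < θ' ∧ 0 < δ ∧ δ ≤ 1 ∧ 1 ≤ M ∧ ∀ k m, ∀ T ∈ D.cubes k,
      ∃ (ρ : EuclideanSpace ℝ (Fin n) → ES n) (G : Set (EuclideanSpace ℝ (Fin n))),
        (∀ x y, dist (ρ x) (ρ y) ≤ M * dist x y) ∧ G ⊆ ball 0 (scale k) ∧ ρ '' G ⊆ T ∧
        θ' * (surfMeasure n E).real T ≤ (surfMeasure n E).real (ρ '' G) ∧
        ∀ u ∈ G, ∀ j, k ≤ j → j ≤ m → ∀ e : EuclideanSpace ℝ (Fin n), ‖e‖ = 1 →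
          ∃ w ∈ closedBall u (5 * scale j), ∃ t, 0 ≤ t ∧ t ≤ scale j ∧
            δ * scale j < dist (ρ (w + t • e)) (ρ w) := by
  obtain ⟨hθ, -, hUR⟩ := hUR
  obtain ⟨Λ', hvol⟩ := regularOn_volume n
  have hΛ := h.reg.pos
  have hΛ1 := h.reg.one_le
  have hΛ' := hvol.pos
  set M : ℝ≥0 := max M₀.toNNReal 1 with hM
  have hM1 : (1 : ℝ≥0) ≤ M := le_max_right _ _
  have hM1' : (1 : ℝ) ≤ M := by exact_mod_cast hM1
  have hM0 : (0 : ℝ) < M := by linarith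
  set a := Λ' ^ 2 * Λ * (256 * (M : ℝ)) ^ n with ha
  have hapos : 0 < a := by positivity
  set b := a * Λ' * (Λ' * 8 ^ n) with hb
  have hbpos : 0 < b := by positivity
  set δ := min 1 (θ * Λ⁻¹ ^ n / 2 / b) with hδ
  have hδpos : 0 < δ := by positivity
  have hδb : δ * b ≤ θ * Λ⁻¹ ^ n / 2 := by
    have := min_le_right 1 (θ * Λ⁻¹ ^ n / 2 / b)
    rwa [← hδ, le_div_iff₀ hbpos] at this
  refine ⟨θ * Λ⁻¹ ^ n / 2 * Λ⁻¹, δ, M, by positivity, hδpos, min_le_left _ _, hM1, ?_⟩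
  intro k m T hT
  have hk := scale_pos k
  set r := Λ⁻¹ * scale k with hr
  have hrpos : 0 < r := by positivity
  have hrk : r ≤ scale k := mul_le_of_le_one_left hk.le (inv_le_one_of_one_le₀ hΛ1)
  set x := D.center T with hx
  obtain ⟨ρ, hρ, hbig⟩ := hUR x (h.center_mem_E hT) r hrpos
    (lt_of_lt_of_eq ENNReal.ofReal_lt_top hdiam.symm)
  have hlip : ∀ y z, dist (ρ y) (ρ z) ≤ M * dist y z :=
    fun y z => (hρ.weaken (le_max_left _ _)).dist_le_mul y z
  set B := {u ∈ ball (0 : EuclideanSpace ℝ (Fin n)) r | ∃ j, k ≤ j ∧ j ≤ m ∧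
    surfMeasure n E (E ∩ ρ '' closedBall u (5 * scale j)) ≤
      ENNReal.ofReal (a * δ * scale j ^ n)} with hB
  set G := {u ∈ ball (0 : EuclideanSpace ℝ (Fin n)) r | ρ u ∈ E ∩ ball x r} \ B with hG
  have hGT : ρ '' G ⊆ T := by
    rintro _ ⟨u, hu, rfl⟩
    exact h.inner k T hT hu.1.2
  have hBsmall : surfMeasure n E (E ∩ ρ '' B) ≤ ENNReal.ofReal (δ * b * scale k ^ n) := by
    have h1 := hvol.measure_image_le_of_vitali (μ := surfMeasure n E) (S := E) (f := ρ)
      (c := a * δ) (R := 2 * scale k) (B := B) (by positivity) (by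
        rintro u ⟨hu, j, hkj, -, hj⟩
        have hjk := scale_anti hkj
        refine ⟨scale j, scale_pos j, closedBall_subset_closedBall' ?_, by linarith, hj⟩
        have := mem_ball.1 hu
        linarith)
    refine h1.trans ?_
    rw [← ENNReal.ofReal_toReal (measure_closedBall_lt_top (μ := volume)
      (x := (0 : EuclideanSpace ℝ (Fin n)))).ne, ← ENNReal.ofReal_mul (by positivity)]
    refine ENNReal.ofReal_le_ofReal ?_
    have h2 := mul_le_mul_of_nonneg_left
      (hvol.measure_closedBall_le 0 (show 0 < 2 * scale k by positivity))
      (show 0 ≤ a * δ * Λ' by positivity)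
    refine h2.trans_eq ?_
    rw [hb, show 4 * (2 * scale k) = 8 * scale k by ring, mul_pow]
    ring
  set A := E ∩ ball x r ∩ ρ '' ball 0 r with hA
  have hAE : A ⊆ E := fun y hy => hy.1.1
  have hAlow : ENNReal.ofReal (θ * r ^ n) ≤ surfMeasure n E A := by
    rw [surfMeasure, Measure.restrict_eq_self _ hAE]
    exact hbig
  have hAsub : A ⊆ ρ '' G ∪ E ∩ ρ '' B := by
    rintro _ ⟨hy, u, hu, rfl⟩
    by_cases huB : u ∈ B
    · exact Or.inr ⟨hy.1, u, huB, rfl⟩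
    · exact Or.inl ⟨u, ⟨⟨hu, hy⟩, huB⟩, rfl⟩
  refine ⟨ρ, G, hlip, fun u hu => ball_subset_ball hrk hu.1.1, hGT, ?_, ?_⟩
  · have hGfin : surfMeasure n E (ρ '' G) ≠ ⊤ :=
      ne_top_of_le_ne_top (h.ne_top hT) (measure_mono hGT)
    have h1 : ENNReal.ofReal (θ * r ^ n) ≤ ENNReal.ofReal
        ((surfMeasure n E).real (ρ '' G) + δ * b * scale k ^ n) := by
      rw [ENNReal.ofReal_add measureReal_nonneg (by positivity), ofReal_measureReal hGfin]
      exact (hAlow.trans (measure_mono hAsub)).trans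
        ((measure_union_le _ _).trans (add_le_add le_rfl hBsmall))
    have h2 := (ENNReal.ofReal_le_ofReal_iff (by positivity)).1 h1
    rw [hr, mul_pow] at h2
    have h3 := mul_le_mul_of_nonneg_right hδb (pow_pos hk n).le
    have h4 := mul_le_mul_of_nonneg_left (h.upper k T hT)
      (show 0 ≤ θ * Λ⁻¹ ^ n / 2 * Λ⁻¹ by positivity)
    have h5 : θ * Λ⁻¹ ^ n / 2 * Λ⁻¹ * (Λ * scale k ^ n) = θ * Λ⁻¹ ^ n / 2 * scale k ^ n := by
      field_simp
    linarith
  · intro u hu j hkj hjm e he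
    by_contra! hcon
    refine hu.2 ⟨hu.1.1, j, hkj, hjm, ?_⟩
    have h1 := h.reg.measure_image_le_of_narrow hvol hM1' hlip hδpos (min_le_left _ _)
      (scale_pos j) he hcon
    have hbdd : Bornology.IsBounded (E ∩ ρ '' closedBall u (5 * scale j)) :=
      ((hρ.isBounded_image isBounded_closedBall)).subset inter_subset_right
    rw [← ofReal_measureReal (h.reg.ne_top_of_bounded hbdd)]
    exact ENNReal.ofReal_le_ofReal h1

end Nice

namespace Nice

variable {n : ℕ} {E : Set (ES n)} {D : DyadicSystem n E} {Λ : ℝ}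

/-- A cube meeting a non-narrow Lipschitz image is bilaterally well approximated by planes, unless
`E` is far from the image, or the map is far from affine, or its domain has large holes. -/
lemma localBAUP_or_of_nonnarrow (h : Nice n E D Λ) {δ ε : ℝ} {M : ℝ≥0} (hδ : 0 < δ) (hδ1 : δ ≤ 1)
    (hM : 1 ≤ M) (hε : 0 < ε) :
    ∃ ε' η K : ℝ, 0 < ε' ∧ 0 < η ∧ 0 ≤ K ∧
      ∀ (ρ : EuclideanSpace ℝ (Fin n) → ES n) (G : Set (EuclideanSpace ℝ (Fin n))) (j : ℤ),
      ∀ Q ∈ D.cubes j, (∀ x y, dist (ρ x) (ρ y) ≤ M * dist x y) → ρ '' G ⊆ E →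
      (∀ u ∈ G, ∀ e : EuclideanSpace ℝ (Fin n), ‖e‖ = 1 →
        ∃ w ∈ closedBall u (5 * scale j), ∃ t, 0 ≤ t ∧ t ≤ scale j ∧
          δ * scale j < dist (ρ (w + t • e)) (ρ w)) →
      ∀ x ∈ Q, x ∈ ρ '' G → LocalBAUP E D ε j Q ∨
        (∃ y ∈ E, dist y x ≤ K * scale j ∧ ε' * scale j < infDist y (ρ '' G)) ∨
        (∃ v d, dist (ρ v) x ≤ K * scale j ∧ (∃ u ∈ G, dist v u ≤ K * scale j) ∧ ‖d‖ ≤ K ∧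
          η * scale j <
            ‖ρ (v + scale j • d) + ρ (v - scale j • d) - (2 : ℝ) • ρ v‖) ∨
        ∃ v, dist (ρ v) x ≤ K * scale j ∧ (∃ u ∈ G, dist v u ≤ K * scale j) ∧
          ε' * scale j < infDist v G := by
  have hΛ := h.reg.pos
  have hΛ1 := h.reg.one_le
  have hM1 : (1 : ℝ) ≤ M := by exact_mod_cast hM
  have hM0 : (0 : ℝ) < M := by linarith
  set ε' := min (δ / 8) (ε / (3 + 3 * M)) with hε'
  have hε'pos : 0 < ε' := by positivity
  have hε'δ : ε' ≤ δ / 8 := min_le_left _ _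
  have hε'ε : ε' * (3 + 3 * M) ≤ ε := by
    have := min_le_right (δ / 8) (ε / (3 + 3 * M))
    rwa [← hε', le_div_iff₀ (by positivity)] at this
  set K₁ := 48 * Λ / δ with hK₁
  have hK₁δ : K₁ * δ = 48 * Λ := div_mul_cancel₀ _ hδ.ne'
  have hK₁6 : 6 ≤ K₁ := by
    rw [hK₁, le_div_iff₀ hδ]
    linarith
  obtain ⟨η, hη, haff⟩ := exists_affine_of_secondDiff_scale
    (W := EuclideanSpace ℝ (Fin n)) (V := ES n) hM0.le hε'pos K₁
  have hη' : 0 < η⁻¹ := inv_pos.2 hη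
  set K := M * (η⁻¹ + K₁) + 12 * Λ + η⁻¹ + K₁ with hK
  have hKη : η⁻¹ ≤ K := by
    have : 0 ≤ M * (η⁻¹ + K₁) := by positivity
    linarith
  have hK₁K : K₁ ≤ K := by
    have : 0 ≤ M * (η⁻¹ + K₁) := by positivity
    linarith
  refine ⟨ε', η, K, hε'pos, hη, by positivity, ?_⟩
  intro ρ G j Q hQ hρ hGE hnar x hxQ hxG
  by_contra! hcon
  obtain ⟨hbad, hE1, hD1, hD2⟩ := hcon
  refine hbad ?_
  set ℓ := scale j with hℓ
  have hℓpos : 0 < ℓ := scale_pos j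
  have hε'ℓ : 0 < ε' * ℓ := by positivity
  have hδℓ := mul_le_mul_of_nonneg_right hε'δ hℓpos.le
  have hδℓ1 := mul_le_mul_of_nonneg_right hδ1 hℓpos.le
  have hΛℓ := mul_le_mul_of_nonneg_right hΛ1 hℓpos.le
  have hEε := mul_le_mul_of_nonneg_right hε'ε hℓpos.le
  have hMεℓ : 0 ≤ M * (ε' * ℓ) := by positivity
  have hdist : ∀ y, y ∈ ball (D.center Q) (10 * diam Q) → dist y x ≤ 11 * (Λ * ℓ) := by
    intro y hy
    have h1 := mem_ball.1 hy
    have h2 := h.diam_upper hQ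
    have h3 := h.dist_le j Q hQ _ (D.center_mem j Q hQ) x hxQ
    have h4 := dist_triangle y (D.center Q) x
    linarith
  have hnear : ∀ u ∈ G, dist (ρ u) x ≤ 12 * (Λ * ℓ) → ∀ v L, 0 ≤ L → dist v u ≤ L * ℓ →
      dist (ρ v) x ≤ (M * L + 12 * Λ) * ℓ := by
    intro u _ hux v L _ hvu
    have h1 := dist_triangle (ρ v) (ρ u) x
    have h2 := (hρ v u).trans (mul_le_mul_of_nonneg_left hvu hM0.le)
    linarith
  have hA : ∀ u, ∃ A : EuclideanSpace ℝ (Fin n) →ᵃ[ℝ] ES n, u ∈ G → dist (ρ u) x ≤ 12 * (Λ * ℓ) →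
      ∀ v, dist v u ≤ K₁ * ℓ → dist (ρ v) (A v) ≤ ε' * ℓ := by
    intro u
    by_cases hu : u ∈ G ∧ dist (ρ u) x ≤ 12 * (Λ * ℓ)
    · obtain ⟨A, hA⟩ := haff ρ hρ u ℓ hℓpos fun v d hv hd => by
        refine hD1 v d ((hnear u hu.1 hu.2 v _ hη'.le hv).trans
          (mul_le_mul_of_nonneg_right ?_ hℓpos.le))
          ⟨u, hu.1, hv.trans (mul_le_mul_of_nonneg_right hKη hℓpos.le)⟩ (hd.trans hKη)
        have : 0 ≤ M * K₁ := by positivity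
        linarith
      exact ⟨A, fun _ _ => hA⟩
    · exact ⟨AffineMap.const ℝ _ 0, fun h1 h2 => absurd ⟨h1, h2⟩ hu⟩
  choose A hA using hA
  have hexp : ∀ u ∈ G, dist (ρ u) x ≤ 12 * (Λ * ℓ) → ∀ v, δ / 2 * ‖v‖ ≤ ‖(A u).linear v‖ := by
    intro u hu hux v
    rcases eq_or_ne v 0 with rfl | hv
    · simp
    have hvn : ‖v‖ ≠ 0 := norm_ne_zero_iff.2 hv
    obtain ⟨w, hw, t, ht0, htℓ, hlt⟩ := hnar u hu (‖v‖⁻¹ • v) (by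
      rw [norm_smul, norm_inv, norm_norm, inv_mul_cancel₀ hvn])
    set e := ‖v‖⁻¹ • v with he
    have hen : ‖e‖ = 1 := by rw [norm_smul, norm_inv, norm_norm, inv_mul_cancel₀ hvn]
    have hve : v = ‖v‖ • e := by rw [he, smul_smul, mul_inv_cancel₀ hvn, one_smul]
    have hwu := mem_closedBall.1 hw
    have h6 := mul_le_mul_of_nonneg_right hK₁6 hℓpos.le
    have hwe : dist (w + t • e) w = t := by
      rw [dist_eq_norm, add_sub_cancel_left, norm_smul, hen, mul_one, Real.norm_of_nonneg ht0]
    have h1 := hA u hu hux w (by linarith)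
    have h2 := hA u hu hux (w + t • e) (by
      have := dist_triangle (w + t • e) w u
      linarith)
    have h3 := dist_triangle4 (ρ (w + t • e)) (A u (w + t • e)) (A u w) (ρ w)
    rw [dist_comm (A u w)] at h3
    have h4 : dist (A u (w + t • e)) (A u w) = t * ‖(A u).linear e‖ := by
      rw [dist_eq_norm, ← vsub_eq_sub, ← (A u).linearMap_vsub, vsub_eq_sub, add_sub_cancel_left,
        map_smul, norm_smul, Real.norm_of_nonneg ht0]
    have h5 := mul_le_mul_of_nonneg_right htℓ (norm_nonneg ((A u).linear e))
    have h7 : δ / 2 < ‖(A u).linear e‖ := by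
      refine lt_of_mul_lt_mul_right ?_ hℓpos.le
      linarith
    have h8 := mul_le_mul_of_nonneg_right h7.le (norm_nonneg v)
    have h9 : ‖(A u).linear v‖ = ‖(A u).linear e‖ * ‖v‖ := by
      conv_lhs => rw [hve]
      rw [map_smul, norm_smul, norm_norm, mul_comm]
    rwa [h9]
  have hinj : ∀ u ∈ G, dist (ρ u) x ≤ 12 * (Λ * ℓ) → Function.Injective (A u).linear := by
    intro u hu hux
    refine (injective_iff_map_eq_zero _).2 fun v hv => ?_
    have h1 := hexp u hu hux v
    rw [hv, norm_zero] at h1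
    have h2 : ‖v‖ ≤ 0 := le_of_mul_le_mul_left (by linarith) (half_pos hδ)
    exact norm_le_zero_iff.1 h2
  have hGne : (ρ '' G).Nonempty := ⟨x, hxG⟩
  obtain ⟨u₀, hu₀, hu₀x⟩ := hxG
  refine ⟨{P | ∃ u ∈ G, dist (ρ u) x ≤ 12 * (Λ * ℓ) ∧ P = range (A u)},
    ⟨_, u₀, hu₀, by rw [hu₀x, dist_self]; positivity, rfl⟩, ?_, ?_, ?_⟩
  · rintro P ⟨u, hu, hux, rfl⟩
    exact isHyperplane_range (A u) (hinj u hu hux)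
  · rintro y ⟨hyE, hy⟩
    have hyx := hdist y hy
    have h1 := hE1 y hyE (hyx.trans (by
      have : 0 ≤ M * (η⁻¹ + K₁) := by positivity
      have h2 : 11 * Λ ≤ K := by linarith
      have := mul_le_mul_of_nonneg_right h2 hℓpos.le
      linarith))
    obtain ⟨_, ⟨u, hu, rfl⟩, hyu⟩ := (infDist_lt_iff hGne).1 (show infDist y (ρ '' G) <
      2 * (ε' * ℓ) by linarith)
    have hux : dist (ρ u) x ≤ 12 * (Λ * ℓ) := by
      have := dist_triangle_left (ρ u) x y
      linarith
    have h2 := hA u hu hux u (by rw [dist_self]; positivity)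
    have h3 := dist_triangle y (ρ u) (A u u)
    have h4 := infDist_le_dist_of_mem (x := y)
      (show A u u ∈ ⋃₀ {P | ∃ u ∈ G, dist (ρ u) x ≤ 12 * (Λ * ℓ) ∧ P = range (A u)} from
        ⟨_, ⟨u, hu, hux, rfl⟩, u, rfl⟩)
    change _ ≤ ε * ℓ
    linarith
  · rintro z ⟨⟨_, ⟨u, hu, hux, rfl⟩, v, rfl⟩, hz⟩
    have hzx := hdist _ hz
    have h1 := hA u hu hux u (by rw [dist_self]; positivity)
    have h2 := dist_triangle4 (A u v) x (ρ u) (A u u)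
    rw [dist_comm x] at h2
    have h3 : dist (A u v) (A u u) = ‖(A u).linear (v - u)‖ := by
      rw [dist_eq_norm, ← vsub_eq_sub, ← (A u).linearMap_vsub, vsub_eq_sub]
    have h4 := hexp u hu hux (v - u)
    have h5 : dist v u ≤ K₁ * ℓ := by
      rw [dist_eq_norm]
      refine le_of_mul_le_mul_left ?_ (half_pos hδ)
      have : δ / 2 * (K₁ * ℓ) = 24 * (Λ * ℓ) := by linear_combination ℓ / 2 * hK₁δ
      linarith
    have h6 := hD2 v ((hnear u hu hux v K₁ (by linarith) h5).trans
      (mul_le_mul_of_nonneg_right (by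
        have : 0 ≤ M * η⁻¹ := by positivity
        linarith) hℓpos.le)) ⟨u, hu, h5.trans (mul_le_mul_of_nonneg_right hK₁K hℓpos.le)⟩
    obtain ⟨w, hw, hvw⟩ := (infDist_lt_iff ⟨u, hu⟩).1 (show infDist v G < 2 * (ε' * ℓ) by linarith)
    have h7 := hA u hu hux v h5
    rw [dist_comm] at h7
    have h8 := (hρ v w).trans (mul_le_mul_of_nonneg_left hvw.le hM0.le)
    have h9 := dist_triangle (A u v) (ρ v) (ρ w)
    have h10 := infDist_le_dist_of_mem (x := A u v) (hGE ⟨w, hw, rfl⟩)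
    change _ ≤ ε * ℓ
    linarith

end Nice

namespace Nice

variable {n : ℕ} {E : Set (ES n)} {D : DyadicSystem n E} {Λ : ℝ}

/-- In a uniformly rectifiable set, the cubes that are not bilaterally well approximated by planes
satisfy a packing condition. -/
lemma packedBy_of_isUR (h : Nice n E D Λ) (hdiam : EMetric.diam E = ⊤) {θ M₀ : ℝ}
    (hUR : IsUR n θ M₀ E) {ε : ℝ} (hε : 0 < ε) :
    ∃ C, PackedBy E D (fun k Q => ¬ LocalBAUP E D ε k Q) C := by
  classical
  have hΛ := h.reg.pos
  obtain ⟨Λ', hvol⟩ := regularOn_volume n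
  obtain ⟨θ', δ, M, hθ', hδ, hδ1, hM, hpart⟩ := h.exists_nonnarrow_part hdiam hUR
  obtain ⟨ε', η, K, hε', hη, hK, hor⟩ := h.localBAUP_or_of_nonnarrow hδ hδ1 hM hε
  obtain ⟨C₁, hC₁, hsum₁⟩ := h.exists_sum_le_whitney h.reg zero_le_one
    (show 0 ≤ K + Λ by positivity) hε'
  obtain ⟨C₂, hC₂, hsum₂⟩ := h.exists_sum_le_secondDiff M (show 0 ≤ K + 1 by positivity) hη
  obtain ⟨C₃, hC₃, hsum₃⟩ := h.exists_sum_le_whitney hvol M.2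
    (show 0 ≤ K + 1 by positivity) hε'
  obtain ⟨P, hP⟩ : ∃ P : ℤ → Set (ES n) → Prop, P = fun k Q => ¬ LocalBAUP E D ε k Q := ⟨_, rfl⟩
  rw [← hP]
  refine h.packedBy_of_sum_le (C := max ((C₁ + C₂ + C₃) * Λ) 0 / θ') (by positivity)
    fun k m T hT => h.sum_le_of_good_part hθ' (fun k m hkm T hT => ?_) k m hT
  obtain ⟨ρ, G, hρ, hG, hGT, hbig, hnar⟩ := hpart k m T hT
  refine ⟨ρ '' G, hGT, hbig, ?_⟩
  have hk := scale_pos k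
  set s := {q ∈ D.pairs k m T | P q.1 q.2 ∧ (q.2 ∩ ρ '' G).Nonempty} with hs
  have hs' : ∀ q ∈ s, (q.2 ∈ D.cubes q.1 ∧ k ≤ q.1 ∧ q.1 ≤ m) ∧ q.2 ⊆ T := by
    intro q hq
    obtain ⟨hq1, hq2, hq3⟩ := (h.mem_pairs (h.bounded hT)).1 (Finset.mem_filter.1 hq).1
    exact ⟨⟨hq2, hq1⟩, hq3⟩
  set P₁ : ℤ × Set (ES n) → Prop := fun q => ∃ y ∈ E, ∃ x ∈ q.2, x ∈ ρ '' G ∧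
    dist y x ≤ K * scale q.1 ∧ ε' * scale q.1 < infDist y (ρ '' G) with hP₁
  set P₂ : ℤ × Set (ES n) → Prop := fun q => ∃ v d, (∃ x ∈ q.2, dist (ρ v) x ≤ K * scale q.1) ∧
    (∃ u ∈ G, dist v u ≤ K * scale q.1) ∧ ‖d‖ ≤ K ∧ η * scale q.1 <
      ‖ρ (v + scale q.1 • d) + ρ (v - scale q.1 • d) - (2 : ℝ) • ρ v‖ with hP₂
  set P₃ : ℤ × Set (ES n) → Prop := fun q => ∃ v, (∃ x ∈ q.2, dist (ρ v) x ≤ K * scale q.1) ∧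
    (∃ u ∈ G, dist v u ≤ K * scale q.1) ∧ ε' * scale q.1 < infDist v G with hP₃
  have hcases : ∀ q ∈ s, P₁ q ∨ P₂ q ∨ P₃ q := by
    intro q hq
    obtain ⟨⟨hqD, hkq, hqm⟩, hqT⟩ := hs' q hq
    obtain ⟨-, hbad, x, hxq, hxG⟩ := Finset.mem_filter.1 hq
    rcases hor ρ G q.1 q.2 hqD hρ (hGT.trans (D.subset_E hT))
      (fun u hu => hnar u hu q.1 hkq hqm) x hxq hxG with h0 | ⟨y, hy, hyx, hyG⟩ |
      ⟨v, d, hvx, hvu, hd, hbig⟩ | ⟨v, hvx, hvu, hvG⟩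
    · rw [hP] at hbad
      exact absurd h0 hbad
    · exact Or.inl ⟨y, hy, x, hxq, hxG, hyx, hyG⟩
    · exact Or.inr (Or.inl ⟨v, d, ⟨x, hxq, hvx⟩, hvu, hd, hbig⟩)
    · exact Or.inr (Or.inr ⟨v, ⟨x, hxq, hvx⟩, hvu, hvG⟩)
  have hnorm : ∀ q ∈ s, ∀ v : EuclideanSpace ℝ (Fin n), (∃ u ∈ G, dist v u ≤ K * scale q.1) →
      ‖v‖ ≤ (K + 1) * scale k := by
    rintro q hq v ⟨u, hu, hvu⟩
    have h1 := mem_ball_zero_iff.1 (hG hu)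
    have h2 := mul_le_mul_of_nonneg_left (scale_anti (hs' q hq).1.2.1) hK
    have h3 := dist_triangle v u 0
    rw [dist_zero_right, dist_zero_right] at h3
    linarith
  have hone₁ : ∑ q ∈ s with P₁ q, (surfMeasure n E).real q.2 ≤ C₁ * scale k ^ n := by
    have hP : ∀ q ∈ s.filter P₁, ∃ y ∈ E, ∃ x ∈ q.2, x ∈ ρ '' G ∧
      dist y x ≤ K * scale q.1 ∧ ε' * scale q.1 < infDist y (ρ '' G) :=
      fun q hq => (Finset.mem_filter.1 hq).2
    choose! v hvE x hxq hxG hvx hvG using hP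
    refine hsum₁ id (fun x y => by rw [one_mul, id, id]) k m _
      (fun q hq => (hs' q (Finset.mem_filter.1 hq).1).1) v (ρ '' G) (D.center T) fun q hq => ?_
    have hqs := hs' q (Finset.mem_filter.1 hq).1
    have h1 := mul_pos hΛ (scale_pos q.1)
    refine ⟨hvE q hq, ⟨x q, hxq q hq, ?_⟩, hvG q hq, ?_, ?_⟩
    · have := hvx q hq
      rw [id]
      linarith
    · have := (infDist_le_dist_of_mem (hxG q hq)).trans (hvx q hq)
      linarith
    · have h2 := h.dist_le k T hT _ (hqs.2 (hxq q hq)) _ (D.center_mem k T hT)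
      have h3 := mul_le_mul_of_nonneg_left (scale_anti hqs.1.2.1) hK
      have h4 := dist_triangle (v q) (x q) (D.center T)
      have h5 := hvx q hq
      linarith
  have hone₂ : ∑ q ∈ s with P₂ q, (surfMeasure n E).real q.2 ≤ C₂ * scale k ^ n := by
    have hP : ∀ q ∈ s.filter P₂, ∃ v d, (∃ x ∈ q.2, dist (ρ v) x ≤ K * scale q.1) ∧
      (∃ u ∈ G, dist v u ≤ K * scale q.1) ∧ ‖d‖ ≤ K ∧ η * scale q.1 <
        ‖ρ (v + scale q.1 • d) + ρ (v - scale q.1 • d) - (2 : ℝ) • ρ v‖ :=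
      fun q hq => (Finset.mem_filter.1 hq).2
    choose! v d hvd using hP
    refine hsum₂ ρ hρ k m hkm _ (fun q hq => (hs' q (Finset.mem_filter.1 hq).1).1) v d
      fun q hq => ?_
    obtain ⟨⟨x, hxq, hvx⟩, hvu, hd, hbig⟩ := hvd q hq
    have h1 := scale_pos q.1
    exact ⟨⟨x, hxq, by linarith⟩, hnorm q (Finset.mem_filter.1 hq).1 _ hvu, by linarith, hbig⟩
  have hone₃ : ∑ q ∈ s with P₃ q, (surfMeasure n E).real q.2 ≤ C₃ * scale k ^ n := by
    have hP : ∀ q ∈ s.filter P₃, ∃ v, (∃ x ∈ q.2, dist (ρ v) x ≤ K * scale q.1) ∧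
      (∃ u ∈ G, dist v u ≤ K * scale q.1) ∧ ε' * scale q.1 < infDist v G :=
      fun q hq => (Finset.mem_filter.1 hq).2
    choose! v hv using hP
    refine hsum₃ ρ hρ k m _ (fun q hq => (hs' q (Finset.mem_filter.1 hq).1).1) v G 0
      fun q hq => ?_
    obtain ⟨⟨x, hxq, hvx⟩, hvu, hvG⟩ := hv q hq
    have h1 := scale_pos q.1
    refine ⟨mem_univ _, ⟨x, hxq, by linarith⟩, hvG, ?_, ?_⟩
    · obtain ⟨u, hu, hvu⟩ := hvu
      have := (infDist_le_dist_of_mem hu).trans hvu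
      linarith
    · rw [dist_zero_right]
      exact hnorm q (Finset.mem_filter.1 hq).1 _ hvu
  have hsplit : ∑ q ∈ s, (surfMeasure n E).real q.2 ≤
      ∑ q ∈ s with P₁ q, (surfMeasure n E).real q.2 +
      ∑ q ∈ s with P₂ q, (surfMeasure n E).real q.2 +
      ∑ q ∈ s with P₃ q, (surfMeasure n E).real q.2 := by
    rw [Finset.sum_filter P₁, Finset.sum_filter P₂, Finset.sum_filter P₃, ← Finset.sum_add_distrib,
      ← Finset.sum_add_distrib]
    refine Finset.sum_le_sum fun q hq => ?_
    have h0 : 0 ≤ (surfMeasure n E).real q.2 := measureReal_nonneg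
    rcases hcases q hq with h1 | h1 | h1 <;> rw [if_pos h1] <;> split_ifs <;> linarith
  have hT' := mul_le_mul_of_nonneg_left (h.lower k T hT)
    (show 0 ≤ (C₁ + C₂ + C₃) * Λ by positivity)
  have hT'' : (C₁ + C₂ + C₃) * Λ * (Λ⁻¹ * scale k ^ n) = (C₁ + C₂ + C₃) * scale k ^ n := by
    field_simp
  linarith

end Nice

section Degenerate

variable {n : ℕ} {C : ℝ} {E : Set (ES n)}

lemma isUR_of_subsingleton (hs : E.Subsingleton) : IsUR n 1 1 E := by
  refine ⟨one_pos, one_pos, fun x _ r _ hlt => ?_⟩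
  exact absurd (lt_of_lt_of_eq hlt (ediam_subsingleton hs)) not_lt_zero

lemma exists_isHyperplane (n : ℕ) : ∃ P : Set (ES n), IsHyperplane P :=
  ⟨_, EuclideanSpace.single 0 1, 0, by simp, rfl⟩

lemma localBAUP_of_subsingleton (hs : E.Subsingleton) (D : DyadicSystem n E) (ε : ℝ) {k : ℤ}
    {Q : Set (ES n)} (hQ : Q ∈ D.cubes k) : LocalBAUP E D ε k Q := by
  obtain ⟨P, hP⟩ := exists_isHyperplane n
  have hdiam : diam Q = 0 := diam_subsingleton (hs.anti (D.subset_E hQ))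
  refine ⟨{P}, singleton_nonempty P, ?_, ?_, ?_⟩
  · rintro _ rfl
    exact hP
  · rintro y ⟨-, hy⟩
    rw [hdiam, mul_zero, ball_zero] at hy
    exact hy.elim
  · rintro z ⟨-, hz⟩
    rw [hdiam, mul_zero, ball_zero] at hz
    exact hz.elim

lemma packedBy_of_subsingleton (hs : E.Subsingleton) (D : DyadicSystem n E) (ε : ℝ) :
    PackedBy E D (fun k Q => ¬ LocalBAUP E D ε k Q) 0 := by
  intro k Q _
  have : IsEmpty {p : ℤ × Set (ES n) // p.2 ∈ D.cubes p.1 ∧ ¬ LocalBAUP E D ε p.1 p.2 ∧ p.2 ⊆ Q} :=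
    ⟨fun p => p.2.2.1 (localBAUP_of_subsingleton hs D ε p.2.1)⟩
  rw [tsum_empty]
  exact zero_le

/-- A bounded regular set with more than one point carries no dyadic system indexed by all of
`ℤ`. -/
lemma DyadicSystem.ediam_eq_top (hE : IsADR n C E) (D : DyadicSystem n E)
    (hnt : E.Nontrivial) : ediam E = ⊤ := by
  by_contra hne
  obtain ⟨hclosed, hC1, hreg⟩ := hE
  have hbdd : Bornology.IsBounded E := isBounded_iff_ediam_ne_top.2 hne
  have hd : 0 < diam E := diam_pos hnt hbdd
  obtain ⟨x₀, hx₀⟩ := hnt.nonempty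
  have hhalf : ENNReal.ofReal (diam E / 2) < ediam E := by
    rw [← ENNReal.ofReal_toReal hne]
    exact (ENNReal.ofReal_lt_ofReal_iff hd).2 (half_lt_self hd)
  have hpos : μH[(n : ℝ)] E ≠ 0 := by
    have hC : 0 < C := by linarith
    have h1 := (hreg x₀ hx₀ _ (half_pos hd) hhalf).1.trans (measure_mono inter_subset_left)
    exact ((ENNReal.ofReal_pos.2 (by positivity)).trans_le h1).ne'
  have hfin : μH[(n : ℝ)] E ≠ ⊤ := by
    obtain ⟨t, htE, htfin, hcov⟩ :=
      finite_cover_balls_of_compact (Metric.isCompact_of_isClosed_isBounded hclosed hbdd)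
        (half_pos hd)
    have hsub : E ⊆ ⋃ x ∈ t, E ∩ ball x (diam E / 2) := fun y hy => by
      obtain ⟨x, hx, hyx⟩ := mem_iUnion₂.1 (hcov hy)
      exact mem_iUnion₂.2 ⟨x, hx, hy, hyx⟩
    refine ((measure_mono hsub).trans_lt (measure_biUnion_lt_top htfin fun x hx => ?_)).ne
    exact (hreg x (htE hx) _ (half_pos hd) hhalf).2.trans_lt ENNReal.ofReal_lt_top
  obtain ⟨k, hk⟩ : ∃ k : ℤ, diam E < D.a₀ * 2 ^ (-k) := by
    obtain ⟨N, hN⟩ := pow_unbounded_of_one_lt (diam E / D.a₀) (one_lt_two : (1 : ℝ) < 2)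
    refine ⟨-N, ?_⟩
    rw [neg_neg, zpow_natCast, mul_comm]
    exact (div_lt_iff₀ D.a₀_pos).1 hN
  obtain ⟨Q, hQ, -⟩ := mem_sUnion.1 ((D.cover k).symm ▸ hx₀)
  have hQE : Q = E := by
    refine (D.subset_E hQ).antisymm fun y hy => D.contains_ball k Q hQ ⟨hy, ?_⟩
    exact (dist_le_diam_of_mem hbdd hy (D.subset_E hQ (D.center_mem k Q hQ))).trans_lt hk
  have hγ := D.γ_pos
  have hCs := D.Cstar_pos
  set ϱ := min (D.a₀ / 2) ((1 / (2 * D.Cstar)) ^ D.γ⁻¹) with hϱ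
  have hϱpos : 0 < ϱ := lt_min (half_pos D.a₀_pos) (Real.rpow_pos_of_pos (by positivity) _)
  have hsmall := D.small_boundary k Q hQ ϱ hϱpos
    ((min_le_left _ _).trans_lt (half_lt_self D.a₀_pos))
  have hset : {x ∈ Q | infDist x (E \ Q) ≤ ϱ * 2 ^ (-k)} = E := by
    ext x
    constructor
    · exact fun hx => D.subset_E hQ hx.1
    · intro hx
      refine ⟨hQE.symm ▸ hx, ?_⟩
      rw [hQE, Set.sdiff_self, infDist_empty]
      positivity
  rw [hset, hQE] at hsmall
  have hlt : ENNReal.ofReal (D.Cstar * ϱ ^ D.γ) < 1 := by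
    rw [← ENNReal.ofReal_one, ENNReal.ofReal_lt_ofReal_iff one_pos]
    have h1 : ϱ ^ D.γ ≤ 1 / (2 * D.Cstar) := by
      refine (Real.rpow_le_rpow hϱpos.le (min_le_right _ _) hγ.le).trans_eq ?_
      rw [← Real.rpow_mul (by positivity), inv_mul_cancel₀ hγ.ne', Real.rpow_one]
    have h2 := mul_le_mul_of_nonneg_left h1 hCs.le
    have h3 : D.Cstar * (1 / (2 * D.Cstar)) = 1 / 2 := by field_simp
    linarith
  have := (ENNReal.mul_lt_mul_left hpos hfin hlt).trans_le (one_mul _).le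
  exact absurd (hsmall.trans_lt this) (lt_irrefl _)

/-- An unbounded regular set has positive dimension. -/
lemma IsADR.one_le_of_ediam (hE : IsADR n C E) (hdiam : ediam E = ⊤) : 1 ≤ n := by
  by_contra! hn
  obtain rfl : n = 0 := by omega
  obtain ⟨-, -, hreg⟩ := hE
  have hinf : E.Infinite := fun hfin => isBounded_iff_ediam_ne_top.1 hfin.isBounded hdiam
  obtain ⟨N, hN⟩ := exists_nat_gt C
  obtain ⟨s, hsE, hcard⟩ := hinf.exists_subset_card_eq (N + 1)
  obtain ⟨x, hx⟩ := hinf.nonempty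
  obtain ⟨r, hr⟩ := s.finite_toSet.isBounded.subset_ball x
  have hup := (hreg x hx (max r 1) (by positivity)
    (lt_of_lt_of_eq ENNReal.ofReal_lt_top hdiam.symm)).2
  have hlow : (s.card : ℝ≥0∞) ≤ μH[((0 : ℕ) : ℝ)] (E ∩ ball x (max r 1)) := by
    refine le_trans ?_ (measure_mono (subset_inter hsE
      (hr.trans (ball_subset_ball (le_max_left _ _)))))
    rw [← sum_measure_singleton, Nat.cast_zero]
    simp
  have h1 := hlow.trans hup
  rw [hcard, pow_zero, mul_one, ← ENNReal.ofReal_natCast] at h1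
  have h2 := (ENNReal.ofReal_le_ofReal_iff' (p := ((N + 1 : ℕ) : ℝ))).1 h1
  push_cast at h2
  have h3 : (0 : ℝ) ≤ N := Nat.cast_nonneg N
  rcases h2 with h2 | h2 <;> linarith

end Degenerate

/-- David–Semmes. An `n`-dimensional ADR set `E ⊆ ℝ^{n+1}` is uniformly
rectifiable if and only if it satisfies the BAUP condition: for some `ε₀ > 0` and every
`0 < ε < ε₀`, the cubes failing the `ε`-local BAUP condition satisfy a Carleson packing
condition. -/
theorem UR_iff_BAUP (n : ℕ) (C_ADR : ℝ) (E : Set (ES n)) (hE : IsADR n C_ADR E)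
    (D : DyadicSystem n E) :
    (∃ θ M₀ : ℝ, IsUR n θ M₀ E) ↔
      ∃ ε₀ : ℝ, 0 < ε₀ ∧ ∀ ε : ℝ, 0 < ε → ε < ε₀ →
        ∃ C : ℝ, PackedBy E D (fun k Q => ¬ LocalBAUP E D ε k Q) C := by
  rcases E.subsingleton_or_nontrivial with hs | hnt
  · exact ⟨fun _ => ⟨1, one_pos, fun ε _ _ => ⟨0, packedBy_of_subsingleton hs D ε⟩⟩,
      fun _ => ⟨1, 1, isUR_of_subsingleton hs⟩⟩
  have hdiam := D.ediam_eq_top hE hnt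
  obtain ⟨Λ, h⟩ := nice_of_isADR hE D (hE.one_le_of_ediam hdiam) hdiam
  constructor
  · rintro ⟨θ, M₀, hUR⟩
    exact ⟨1, one_pos, fun ε hε _ => h.packedBy_of_isUR hdiam hUR hε⟩
  · rintro ⟨ε₀, hε₀, hpack⟩
    refine h.isUR_of_packing hε₀ fun ε hε hεε₀ => ?_
    obtain ⟨C, hC⟩ := hpack ε hε hεε₀
    refine ⟨max C 0, fun k m T hT => ?_⟩
    convert h.sum_le_of_packedBy hC k m hT
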